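/- There exists a constant ε > 0 (with ε ≈ 10^{-5}) such that for all integers q and Δ there is a constant C = C(q,Δ) with the following property: for every list-coloring instance (G, L) with n ≥ 2 vertices, maximum degree at most Δ, lists L(v) ⊆ [q], and |L(v)| ≥ max((11/6 − ε)·Δ, Δ+2) for all v ∈ V, the Glauber dynamics for the uniform distribution μ over proper list-colorings has mixing time t_mix(1/4) ≤ C·n·log n. -/

import Mathlib

open Finset

attribute [local instance] Classical.propDecidable

/-- `μ` is a probability distribution on the finite type `Ω`. -/
def IsProbDist {Ω : Type*} [Fintype Ω] (μ : Ω → ℝ) : Prop :=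
  (∀ x, 0 ≤ μ x) ∧ ∑ x, μ x = 1

/-- `P` is a row-stochastic transition matrix whose dynamics is supported on `Ω₀`
(transitions out of `Ω₀` are impossible, and off `Ω₀` the matrix is extended as the identity,
so that `P` together with its powers faithfully represents a Markov chain on state space `Ω₀`). -/
def IsTransOn {Ω : Type*} [Fintype Ω] [DecidableEq Ω] (P : Matrix Ω Ω ℝ) (Ω₀ : Set Ω) : Prop :=
  (∀ x y, 0 ≤ P x y) ∧ (∀ x, ∑ y, P x y = 1) ∧
    (∀ x ∈ Ω₀, ∀ y, P x y ≠ 0 → y ∈ Ω₀) ∧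
    (∀ x, x ∉ Ω₀ → ∀ y, P x y = if x = y then 1 else 0)

/-- `P` is reversible with respect to `π`. -/
def ReversibleWrt {Ω : Type*} (P : Matrix Ω Ω ℝ) (π : Ω → ℝ) : Prop :=
  ∀ x y, π x * P x y = π y * P y x

/-- `π` is stationary for `P`. -/
def StationaryWrt {Ω : Type*} [Fintype Ω] (P : Matrix Ω Ω ℝ) (π : Ω → ℝ) : Prop :=
  ∀ y, ∑ x, π x * P x y = π y

/-- `P` is irreducible on the state space `Ω₀`. -/
def IrreducibleOn {Ω : Type*} [Fintype Ω] [DecidableEq Ω] (P : Matrix Ω Ω ℝ) (Ω₀ : Set Ω) : Prop :=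
  ∀ x ∈ Ω₀, ∀ y ∈ Ω₀, ∃ t : ℕ, 0 < (P ^ t) x y

/-- `P` is aperiodic on the state space `Ω₀`: for every state, the gcd of the return
times is `1` (every common divisor of the return times equals `1`). -/
def AperiodicOn {Ω : Type*} [Fintype Ω] [DecidableEq Ω] (P : Matrix Ω Ω ℝ) (Ω₀ : Set Ω) : Prop :=
  ∀ x ∈ Ω₀, ∀ d : ℕ, 0 < d → (∀ t : ℕ, 0 < t → 0 < (P ^ t) x x → d ∣ t) → d = 1

/-- A coupling of two faithful copies of the chain `P`, recorded through its time-`t` joint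
distributions: `coup x y t a b` is the probability that `(X t, Y t) = (a, b)` given the starting
states `X 0 = x` and `Y 0 = y`; marginally each copy evolves according to `P`. -/
def IsCoupling {Ω : Type*} [Fintype Ω] [DecidableEq Ω] (P : Matrix Ω Ω ℝ)
    (coup : Ω → Ω → ℕ → Ω → Ω → ℝ) : Prop :=
  (∀ x y t a b, 0 ≤ coup x y t a b) ∧
    (∀ x y t a, ∑ b, coup x y t a b = (P ^ t) x a) ∧
    (∀ x y t b, ∑ a, coup x y t a b = (P ^ t) y b)

/-- Hamming distance between two finite sets: the size of their symmetric difference. -/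
def hamm {U : Type*} [DecidableEq U] (S T : Finset U) : ℕ := ((S \ T) ∪ (T \ S)).card

/-- `margOf μ j = Pr_{S ∼ μ}[j ∈ S]`. -/
def margOf {U : Type*} [Fintype U] [DecidableEq U] (μ : Finset U → ℝ) (j : U) : ℝ :=
  ∑ S : Finset U, if j ∈ S then μ S else 0

/-- `μ` conditioned on the event `{S : A ⊆ S}`. -/
noncomputable def condOn {U : Type*} [Fintype U] [DecidableEq U] (μ : Finset U → ℝ)
    (A : Finset U) : Finset U → ℝ := fun S =>
  if A ⊆ S then μ S / ∑ T : Finset U, (if A ⊆ T then μ T else 0) else 0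

section ProductSpace

variable {V : Type*} [Fintype V] [DecidableEq V]
  {Ωv : V → Type*} [∀ v, Fintype (Ωv v)] [∀ v, DecidableEq (Ωv v)]

/-- `condMarg μ σ v c = μ^v(c ∣ σ_{-v})`: the conditional law at the coordinate `v` given the
values of `σ` off `v`. -/
noncomputable def condMarg (μ : (∀ v, Ωv v) → ℝ) (σ : ∀ v, Ωv v) (v : V) (c : Ωv v) : ℝ :=
  μ (Function.update σ v c) / ∑ c' : Ωv v, μ (Function.update σ v c')

/-- The Glauber dynamics (Gibbs sampler) for `μ`: pick a uniformly random coordinate `v` and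
resample it from the conditional law of `μ` given the other coordinates. -/
noncomputable def glauber (μ : (∀ v, Ωv v) → ℝ) :
    Matrix (∀ v, Ωv v) (∀ v, Ωv v) ℝ := fun σ τ =>
  (Fintype.card V : ℝ)⁻¹ *
    ∑ v : V, if ∀ w, w ≠ v → σ w = τ w then condMarg μ σ v (τ v) else 0

/-- Hamming distance between two configurations: the number of coordinates where they differ. -/
def hammConf (σ τ : ∀ v, Ωv v) : ℕ := (Finset.univ.filter fun v => σ v ≠ τ v).card

/-- `prV μ v c = Pr_{σ∼μ}[σ(v) = c]`. -/
noncomputable def prV (μ : (∀ v, Ωv v) → ℝ) (v : V) (c : Ωv v) : ℝ :=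
  ∑ σ : ∀ v, Ωv v, if σ v = c then μ σ else 0

/-- `prVV μ u c v c' = Pr_{σ∼μ}[σ(u) = c ∧ σ(v) = c']`. -/
noncomputable def prVV (μ : (∀ v, Ωv v) → ℝ) (u : V) (c : Ωv u) (v : V) (c' : Ωv v) : ℝ :=
  ∑ σ : ∀ v, Ωv v, if σ u = c ∧ σ v = c' then μ σ else 0

end ProductSpace

section ListColoring

variable {V : Type*} [Fintype V] [DecidableEq V] {q : ℕ}

/-- `σ` is a proper list-coloring of the instance `(G, L)`. -/
def IsProperListColoring (G : SimpleGraph V) (L : V → Finset (Fin q)) (σ : V → Fin q) : Prop :=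
  (∀ v, σ v ∈ L v) ∧ ∀ u v, G.Adj u v → σ u ≠ σ v

/-- One step of an alternating path inside the active vertex set `Vs`, using only the two
colors `a` and `b`. -/
def kempeStep (G : SimpleGraph V) (Vs : Finset V) (σ : V → Fin q) (a b : Fin q)
    (w w' : V) : Prop :=
  w ∈ Vs ∧ w' ∈ Vs ∧ G.Adj w w' ∧ (σ w = a ∨ σ w = b) ∧ (σ w' = a ∨ σ w' = b) ∧ σ w ≠ σ w'

/-- The Kempe component `S_σ(u,c)` (within the active vertex set `Vs`): all vertices reachable
from `u` along an alternating path using the colors `σ u` and `c`. -/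
noncomputable def kempeComp (G : SimpleGraph V) (Vs : Finset V) (σ : V → Fin q)
    (u : V) (c : Fin q) : Finset V :=
  Finset.univ.filter fun v => Relation.ReflTransGen (kempeStep G Vs σ (σ u) c) u v

/-- The coloring obtained from `σ` by interchanging the colors `a` and `b` on `S`. -/
def flipConf (σ : V → Fin q) (a b : Fin q) (S : Finset V) : V → Fin q := fun v =>
  if v ∈ S then (if σ v = a then b else if σ v = b then a else σ v) else σ v

/-- The flip dynamics with flip parameters `p`: pick a uniformly random active vertex
`v ∈ Vs` and a uniformly random color `c` from the pick-list `Lpick v`; if the Kempe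
component `S = S_σ(v,c)` (within `Vs`) is flippable (i.e. the flipped coloring is a proper
list-coloring for `(G, L)`), flip it with probability `p |S| / |S|`, otherwise stay. -/
noncomputable def flipMatrix (G : SimpleGraph V) (Vs : Finset V)
    (Lpick L : V → Finset (Fin q)) (p : ℕ → ℝ) :
    Matrix (V → Fin q) (V → Fin q) ℝ := fun σ τ =>
  (Vs.card : ℝ)⁻¹ * ∑ v ∈ Vs, ((Lpick v).card : ℝ)⁻¹ * ∑ c ∈ Lpick v,
    ((if IsProperListColoring G L (flipConf σ (σ v) c (kempeComp G Vs σ v c)) ∧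
          τ = flipConf σ (σ v) c (kempeComp G Vs σ v c)
        then p (kempeComp G Vs σ v c).card / ((kempeComp G Vs σ v c).card : ℝ) else 0) +
      (if τ = σ then
          1 - (if IsProperListColoring G L (flipConf σ (σ v) c (kempeComp G Vs σ v c))
              then p (kempeComp G Vs σ v c).card / ((kempeComp G Vs σ v c).card : ℝ) else 0)
        else 0))

end ListColoring

/-- The uniform distribution over proper list-colorings of `(G, L)`. -/
noncomputable def uniformProper {V : Type*} [Fintype V] [DecidableEq V] {q : ℕ}
    (G : SimpleGraph V) (L : V → Finset (Fin q)) : (V → Fin q) → ℝ := fun σ =>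
  if IsProperListColoring G L σ then
    ((Finset.univ.filter fun τ : V → Fin q => IsProperListColoring G L τ).card : ℝ)⁻¹
  else 0

namespace ListColoringMixing

set_option linter.unusedSectionVars false
set_option linter.unusedVariables false

section Clusters

variable {V : Type*} [Fintype V] {q : ℕ}

/-- The set of vertices reachable from `x` in `H`. -/
noncomputable def reachSet (H : SimpleGraph V) (x : V) : Finset V :=
  univ.filter fun y => H.Reachable x y

lemma mem_reachSet {H : SimpleGraph V} {x y : V} : y ∈ reachSet H x ↔ H.Reachable x y := by
  simp [reachSet]

lemma reachSet_subset_of_closed {H : SimpleGraph V} {x : V} {S : Finset V} (hx : x ∈ S)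
    (hS : ∀ y ∈ S, ∀ z, H.Adj y z → z ∈ S) : reachSet H x ⊆ S := by
  intro y hy
  rw [mem_reachSet] at hy
  obtain ⟨w⟩ := hy
  induction w with
  | nil => exact hx
  | cons h _ ih => exact ih (hS _ hx _ h)

/-- The graph of `{a,b}`-alternating edges inside the vertex set `W`. -/
def biGraph (G : SimpleGraph V) (W : Finset V) (σ : V → Fin q) (a b : Fin q) : SimpleGraph V where
  Adj x y := G.Adj x y ∧ x ∈ W ∧ y ∈ W ∧ ((σ x = a ∧ σ y = b) ∨ (σ x = b ∧ σ y = a))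
  symm := ⟨fun x y ⟨h, hx, hy, hc⟩ => ⟨h.symm, hy, hx, by tauto⟩⟩
  loopless := ⟨fun x h => h.1.ne rfl⟩

/-- The Kempe clusters of `σ` for the colors `a, b` inside `W`. -/
noncomputable def clusters (G : SimpleGraph V) (W : Finset V) (σ : V → Fin q) (a b : Fin q) :
    Finset (Finset V) :=
  (W.filter fun x => σ x = a ∨ σ x = b).image (reachSet (biGraph G W σ a b))

variable {G : SimpleGraph V} {W : Finset V} {σ τ : V → Fin q} {a b : Fin q} {S T : Finset V}
  {x y v : V}

lemma biGraph_comm : biGraph G W σ a b = biGraph G W σ b a := by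
  ext x y; simp only [biGraph]; tauto

lemma clusters_comm : clusters G W σ a b = clusters G W σ b a := by
  unfold clusters; rw [biGraph_comm]; congr 1; ext x; simp only [mem_filter]; tauto

lemma mem_clusters : S ∈ clusters G W σ a b ↔
    ∃ x ∈ W, (σ x = a ∨ σ x = b) ∧ reachSet (biGraph G W σ a b) x = S := by
  simp [clusters, and_assoc]

lemma self_mem_reachSet (H : SimpleGraph V) (x : V) : x ∈ reachSet H x :=
  mem_reachSet.2 (SimpleGraph.Reachable.refl _)

lemma reachSet_mem_clusters (hx : x ∈ W) (hc : σ x = a ∨ σ x = b) :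
    reachSet (biGraph G W σ a b) x ∈ clusters G W σ a b := mem_clusters.2 ⟨x, hx, hc, rfl⟩

lemma clusters_colored (hS : S ∈ clusters G W σ a b) (hx : x ∈ S) :
    x ∈ W ∧ (σ x = a ∨ σ x = b) := by
  obtain ⟨y, hy, hc, rfl⟩ := mem_clusters.1 hS
  have : reachSet (biGraph G W σ a b) y ⊆ W.filter fun x => σ x = a ∨ σ x = b := by
    refine reachSet_subset_of_closed (by simp [hy, hc]) ?_
    rintro z hz w ⟨_, _, h3, h4⟩
    simp only [mem_filter]
    exact ⟨h3, by tauto⟩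
  simpa using this hx

lemma clusters_eq_reachSet (hS : S ∈ clusters G W σ a b) (hx : x ∈ S) :
    S = reachSet (biGraph G W σ a b) x := by
  obtain ⟨y, hy, hc, rfl⟩ := mem_clusters.1 hS
  rw [mem_reachSet] at hx
  ext z
  simp only [mem_reachSet]
  exact ⟨fun h => hx.symm.trans h, fun h => hx.trans h⟩

lemma clusters_eq_of_mem (hS : S ∈ clusters G W σ a b) (hT : T ∈ clusters G W σ a b)
    (hx : x ∈ S) (hx' : x ∈ T) : S = T := by
  rw [clusters_eq_reachSet hS hx, clusters_eq_reachSet hT hx']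

lemma clusters_closed (hS : S ∈ clusters G W σ a b) (hx : x ∈ S)
    (h : (biGraph G W σ a b).Adj x y) : y ∈ S := by
  rw [clusters_eq_reachSet hS hx, mem_reachSet]
  exact h.reachable

lemma clusters_nonempty (hS : S ∈ clusters G W σ a b) : S.Nonempty := by
  obtain ⟨y, _, _, rfl⟩ := mem_clusters.1 hS
  exact ⟨y, self_mem_reachSet _ _⟩

lemma reachSet_eq_singleton (h : ∀ y, ¬ (biGraph G W σ a b).Adj x y) :
    reachSet (biGraph G W σ a b) x = {x} := by
  refine Subset.antisymm (reachSet_subset_of_closed (mem_singleton_self x) ?_) ?_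
  · intro y hy z hz
    rw [mem_singleton.1 hy] at hz
    exact absurd hz (h z)
  · simpa using self_mem_reachSet _ _

lemma clusters_congr (h : ∀ x ∈ W, σ x = τ x) : clusters G W σ a b = clusters G W τ a b := by
  have : biGraph G W σ a b = biGraph G W τ a b := by
    ext x y
    simp only [biGraph]
    constructor
    · rintro ⟨h1, h2, h3, h4⟩
      rw [h x h2, h y h3] at h4
      exact ⟨h1, h2, h3, h4⟩
    · rintro ⟨h1, h2, h3, h4⟩
      rw [← h x h2, ← h y h3] at h4
      exact ⟨h1, h2, h3, h4⟩
  unfold clusters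
  rw [this]
  congr 1
  ext x
  simp only [mem_filter]
  constructor <;> rintro ⟨h1, h2⟩
  · exact ⟨h1, by rwa [h x h1] at h2⟩
  · exact ⟨h1, by rwa [← h x h1] at h2⟩

/-- A vertex set meets the `b`-colored neighbours of `v`. -/
def Meets (G : SimpleGraph V) (σ : V → Fin q) (v : V) (b : Fin q) (S : Finset V) : Prop :=
  ∃ u ∈ S, G.Adj v u ∧ σ u = b

/-- Clusters avoiding `v` that touch the `b`-colored neighbours of `v`. -/
noncomputable def touching (G : SimpleGraph V) (σ : V → Fin q) (v : V) (a b c : Fin q) :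
    Finset (Finset V) :=
  (clusters G (univ.erase v) σ a b).filter (Meets G σ v c)

/-- The cluster of `v` assembled from the clusters avoiding `v`. -/
noncomputable def bigCluster (G : SimpleGraph V) (σ : V → Fin q) (v : V) (a b : Fin q) :
    Finset V :=
  insert v ((touching G σ v a b b).biUnion id)

lemma clusters_erase_of_not (h : ¬ (σ v = a ∨ σ v = b)) :
    clusters G univ σ a b = clusters G (univ.erase v) σ a b := by
  have : biGraph G univ σ a b = biGraph G (univ.erase v) σ a b := by
    ext x y
    simp only [biGraph, mem_univ, true_and, mem_erase, and_true]
    constructor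
    · rintro ⟨h1, h4⟩
      refine ⟨h1, ?_, ?_, h4⟩ <;> rintro rfl <;> tauto
    · tauto
  unfold clusters
  rw [this]
  congr 1
  ext x
  simp only [mem_filter, mem_univ, true_and, mem_erase, and_true]
  refine ⟨fun h1 => ⟨?_, h1⟩, fun h1 => h1.2⟩
  rintro rfl; exact h h1

lemma biGraph_mono : biGraph G (univ.erase v) σ a b ≤ biGraph G univ σ a b := by
  intro x y h
  exact ⟨h.1, mem_univ _, mem_univ _, h.2.2.2⟩

lemma reachSet_mono {H H' : SimpleGraph V} (h : H ≤ H') (x : V) :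
    reachSet H x ⊆ reachSet H' x := fun y hy =>
  mem_reachSet.2 ((mem_reachSet.1 hy).mono h)

lemma adj_erase_of_ne (h : (biGraph G univ σ a b).Adj x y) (hx : x ≠ v) (hy : y ≠ v) :
    (biGraph G (univ.erase v) σ a b).Adj x y :=
  ⟨h.1, by simp [hx], by simp [hy], h.2.2.2⟩

lemma reachSet_eq_bigCluster (hv : σ v = a) (hab : a ≠ b) :
    reachSet (biGraph G univ σ a b) v = bigCluster G σ v a b := by
  apply Subset.antisymm
  · refine reachSet_subset_of_closed (by simp [bigCluster]) ?_
    intro y hy z hz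
    by_cases hzv : z = v
    · simp [bigCluster, hzv]
    by_cases hyv : y = v
    · subst hyv
      obtain ⟨h1, -, -, h4⟩ := hz
      have hzb : σ z = b := by
        rcases h4 with h4 | h4
        · exact h4.2
        · exact absurd (hv.symm.trans h4.1) hab
      simp only [bigCluster, mem_insert, mem_biUnion, touching, mem_filter, id]
      right
      exact ⟨_, ⟨reachSet_mem_clusters (x := z) (by simp [hzv]) (Or.inr hzb), z,
        self_mem_reachSet _ _, h1, hzb⟩, self_mem_reachSet _ _⟩
    · simp only [bigCluster, mem_insert, hyv, false_or, mem_biUnion, touching, mem_filter, id] at hy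
      obtain ⟨C, ⟨hC, hm⟩, hyC⟩ := hy
      simp only [bigCluster, mem_insert, mem_biUnion, touching, mem_filter, id]
      right
      exact ⟨C, ⟨hC, hm⟩, clusters_closed hC hyC (adj_erase_of_ne hz hyv hzv)⟩
  · intro y hy
    simp only [bigCluster, mem_insert, mem_biUnion, touching, mem_filter, id] at hy
    rcases hy with rfl | ⟨C, ⟨hC, u, hu, hadj, hub⟩, hyC⟩
    · exact self_mem_reachSet _ _
    · rw [clusters_eq_reachSet hC hu] at hyC
      have h1 := mem_reachSet.1 (reachSet_mono biGraph_mono _ hyC)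
      have h2 : (biGraph G univ σ a b).Adj v u :=
        ⟨hadj, mem_univ _, mem_univ _, Or.inl ⟨hv, hub⟩⟩
      exact mem_reachSet.2 (h2.reachable.trans h1)

lemma reachSet_eq_of_not_meets (hv : σ v = a) (hab : a ≠ b)
    (hS : S ∈ clusters G (univ.erase v) σ a b) (hm : ¬ Meets G σ v b S) (hx : x ∈ S) :
    reachSet (biGraph G univ σ a b) x = S := by
  apply Subset.antisymm
  · refine reachSet_subset_of_closed hx ?_
    intro y hy z hz
    have hyv : y ≠ v := by
      have := (clusters_colored hS hy).1
      simpa using this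
    by_cases hzv : z = v
    · subst hzv
      exfalso
      apply hm
      refine ⟨y, hy, hz.1.symm, ?_⟩
      rcases hz.2.2.2 with h | h
      · exact absurd (hv.symm.trans h.2) hab
      · exact h.1
    · exact clusters_closed hS hy (adj_erase_of_ne hz hyv hzv)
  · rw [clusters_eq_reachSet hS hx]
    exact reachSet_mono biGraph_mono _

lemma clusters_eq_insert (hv : σ v = a) (hab : a ≠ b) :
    clusters G univ σ a b = insert (bigCluster G σ v a b)
      (clusters G (univ.erase v) σ a b \ touching G σ v a b b) := by
  ext S
  simp only [mem_insert, mem_sdiff, touching, mem_filter, not_and]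
  constructor
  · intro hS
    by_cases hvS : v ∈ S
    · left
      rw [clusters_eq_reachSet hS hvS, reachSet_eq_bigCluster hv hab]
    · right
      obtain ⟨x, hx⟩ := clusters_nonempty hS
      have hxv : x ≠ v := fun h => hvS (h ▸ hx)
      have hT := reachSet_mem_clusters (G := G) (x := x) (W := univ.erase v) (by simp [hxv])
        (clusters_colored hS hx).2
      have hxT := self_mem_reachSet (biGraph G (univ.erase v) σ a b) x
      have hm : ¬ Meets G σ v b (reachSet (biGraph G (univ.erase v) σ a b) x) := by
        intro hm
        apply hvS
        rw [clusters_eq_reachSet hS hx, mem_reachSet]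
        apply SimpleGraph.Reachable.symm
        rw [← mem_reachSet, reachSet_eq_bigCluster hv hab]
        simp only [bigCluster, mem_insert, mem_biUnion, touching, mem_filter, id]
        exact Or.inr ⟨_, ⟨hT, hm⟩, hxT⟩
      have hST : S = reachSet (biGraph G (univ.erase v) σ a b) x := by
        rw [clusters_eq_reachSet hS hx]
        exact reachSet_eq_of_not_meets hv hab hT hm hxT
      rw [← hST] at hT hm
      exact ⟨hT, fun _ => hm⟩
  · rintro (rfl | ⟨hS, hm⟩)
    · rw [← reachSet_eq_bigCluster hv hab]
      exact reachSet_mem_clusters (mem_univ _) (Or.inl hv)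
    · obtain ⟨x, hx⟩ := clusters_nonempty hS
      rw [← reachSet_eq_of_not_meets hv hab hS (hm hS) hx]
      exact reachSet_mem_clusters (mem_univ _) (clusters_colored hS hx).2

lemma self_mem_bigCluster : v ∈ bigCluster G σ v a b := by simp [bigCluster]

lemma not_mem_of_mem_clusters_erase (hS : S ∈ clusters G (univ.erase v) σ a b) : v ∉ S := by
  intro h
  have := (clusters_colored hS h).1
  simp at this

lemma bigCluster_not_mem : bigCluster G σ v a b ∉ clusters G (univ.erase v) σ a b :=
  fun h => not_mem_of_mem_clusters_erase h self_mem_bigCluster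

lemma card_bigCluster : (bigCluster G σ v a b).card = 1 + ∑ S ∈ touching G σ v a b b, S.card := by
  unfold bigCluster
  rw [card_insert_of_notMem, card_biUnion, add_comm]
  · rfl
  · intro S hS T hT hne
    rw [Function.onFun, disjoint_left]
    intro x hx hx'
    exact hne (clusters_eq_of_mem (mem_filter.1 hS).1 (mem_filter.1 hT).1 hx hx')
  · simp only [mem_biUnion, id, not_exists, not_and]
    intro S hS
    exact not_mem_of_mem_clusters_erase (mem_filter.1 hS).1

/-- Interchange of the colors `a` and `b` on `S`. -/
noncomputable def swapOn (a b : Fin q) (S : Finset V) (σ : V → Fin q) : V → Fin q := fun x =>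
  if x ∈ S then Equiv.swap a b (σ x) else σ x

lemma swapOn_comm : swapOn a b S σ = swapOn b a S σ := by
  unfold swapOn; rw [Equiv.swap_comm]

lemma swapOn_of_mem (h : x ∈ S) : swapOn a b S σ x = Equiv.swap a b (σ x) := by simp [swapOn, h]

lemma swapOn_of_notMem (h : x ∉ S) : swapOn a b S σ x = σ x := by simp [swapOn, h]

end Clusters

section Numeric

/-- The flip parameters, scaled by `3000`. -/
def flipP : ℕ → ℕ
  | 1 => 3000
  | 2 => 919
  | 3 => 495
  | 4 => 288
  | 5 => 150
  | 6 => 80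
  | _ => 0

/-- The weight of a neighbour whose two clusters have capped sizes `e` and `g`. -/
def pairWeight (e g : ℕ) : ℕ :=
  bif (e.beq 1 || e.beq 7) && (g.beq 1 || g.beq 7) then 5200 else
  bif (e.beq 1 && g.beq 2) || (e.beq 2 && g.beq 1) then 5505 else 5497

/-- The minimum, in a form that evaluates quickly. -/
def bmin (a b : ℕ) : ℕ := bif a.ble b then a else b

lemma bmin_eq (a b : ℕ) : bmin a b = min a b := by
  unfold bmin
  by_cases h : a ≤ b
  · rw [Nat.ble_eq_true_of_le h]; simp [h]
  · have : a.ble b = false := by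
      rw [← Bool.not_eq_true, Nat.ble_eq]; exact h
    rw [this]; simp; omega

def checkOne : Bool :=
  (List.range 7).all fun e => (List.range 7).all fun g =>
    Nat.ble (((e + 1) * (flipP (e + 1) - flipP (e + 2)) +
      (g + 1) * (flipP (g + 1) - flipP (g + 2))) + 3000)
      (pairWeight (e + 1) (g + 1) +
        bmin (flipP (e + 1) - flipP (e + 2)) (flipP (g + 1) - flipP (g + 2)))

lemma checkOne_eq : checkOne = true := by rfl

def testTwo (e g e' g' : ℕ) : Bool :=
  -- the first vertex carries the larger of the two sizes
  Nat.ble (flipP (1 + (e + e')) * e' + flipP (1 + (g + g')) * g' +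
      (e * (flipP e - flipP (1 + (e + e'))) + g * (flipP g - flipP (1 + (g + g')))) +
      (e' * flipP e' + g' * flipP g') + 3000)
    (pairWeight e g + pairWeight e' g' +
      bmin (flipP e - flipP (1 + (e + e'))) (flipP g - flipP (1 + (g + g'))) +
      bmin (flipP e') (flipP g')) &&
  Nat.ble (flipP (1 + (e + e')) * e' + flipP (1 + (g' + g)) * g' +
      (e * (flipP e - flipP (1 + (e + e'))) + g' * flipP g') +
      (e' * flipP e' + g * (flipP g - flipP (1 + (g' + g)))) + 3000)
    (pairWeight e g' + pairWeight e' g +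
      bmin (flipP e - flipP (1 + (e + e'))) (flipP g') +
      bmin (flipP e') (flipP g - flipP (1 + (g' + g))))

def checkTwo : Bool :=
  (List.range 7).all fun e => (List.range 7).all fun g =>
    (List.range (e + 2)).all fun e' => (List.range (g + 2)).all fun g' =>
      testTwo (e + 1) (g + 1) e' g'

set_option maxRecDepth 100000 in
lemma checkTwo_eq : checkTwo = true := by
  exact @of_decide_eq_true (checkTwo = true) (instDecidableEqBool _ _) (by rfl)

def checkY : Bool :=
  (List.range 8).all fun e => (List.range 8).all fun g =>
    Nat.ble (e * flipP e + g * flipP g + 1507) (pairWeight e g + bmin (flipP e) (flipP g))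

lemma checkY_eq : checkY = true := by rfl

lemma flipP_of_ge {k : ℕ} (h : 7 ≤ k) : flipP k = 0 := by
  obtain ⟨m, rfl⟩ := Nat.exists_eq_add_of_le h
  rw [Nat.add_comm]; rfl

lemma flipP_anti {j k : ℕ} (hj : 1 ≤ j) (hjk : j ≤ k) : flipP k ≤ flipP j := by
  by_cases h : 7 ≤ k
  · rw [flipP_of_ge h]; exact Nat.zero_le _
  · interval_cases k <;> interval_cases j <;> simp [flipP]

lemma flipP_le (k : ℕ) : flipP k ≤ 3000 := by
  by_cases h : 7 ≤ k
  · rw [flipP_of_ge h]; omega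
  · interval_cases k <;> simp [flipP]

lemma mul_flipP_le (k : ℕ) : k * flipP k ≤ 3000 := by
  by_cases h : 7 ≤ k
  · rw [flipP_of_ge h]; omega
  · interval_cases k <;> simp [flipP]

lemma mul_flipP_add_le {k : ℕ} : k * flipP (k + 2) ≤ 576 := by
  by_cases h : 5 ≤ k
  · rw [flipP_of_ge (by omega)]; omega
  · interval_cases k <;> simp [flipP]

lemma pair_bound {e g : ℕ} (he : e ≤ 7) (hg : g ≤ 7) :
    e * flipP e + g * flipP g + 1507 ≤ pairWeight e g + min (flipP e) (flipP g) := by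
  have h := checkY_eq
  simp only [checkY, List.all_eq_true, List.mem_range] at h
  have := Nat.le_of_ble_eq_true (h e (by omega) g (by omega))
  rwa [bmin_eq] at this

variable {ι : Type*} {N : Finset ι} {e g : ι → ℕ} {i j : ι}

lemma card_one_bound {e g : ℕ} (he : e ≤ 7) (hg : g ≤ 7) (he1 : 1 ≤ e) (hg1 : 1 ≤ g) :
    e * (flipP e - flipP (1 + e)) + g * (flipP g - flipP (1 + g)) + 3000 ≤
      pairWeight e g + min (flipP e - flipP (1 + e)) (flipP g - flipP (1 + g)) := by
  have h := checkOne_eq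
  simp only [checkOne, List.all_eq_true, List.mem_range] at h
  have := Nat.le_of_ble_eq_true (h (e - 1) (by omega) (g - 1) (by omega))
  rw [bmin_eq] at this
  have h1 : e - 1 + 1 = e := by omega
  have h2 : e - 1 + 2 = 1 + e := by omega
  have h3 : g - 1 + 1 = g := by omega
  have h4 : g - 1 + 2 = 1 + g := by omega
  rwa [h1, h2, h3, h4] at this

lemma test_two {e g e' g' : ℕ} (he : e ≤ 7) (hg : g ≤ 7) (he1 : 1 ≤ e) (hg1 : 1 ≤ g)
    (h1 : e' ≤ e) (h2 : g' ≤ g) : testTwo e g e' g' = true := by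
  have h := checkTwo_eq
  simp only [checkTwo, List.all_eq_true, List.mem_range] at h
  have := h (e - 1) (by omega) (g - 1) (by omega) e' (by omega) g' (by omega)
  rwa [Nat.sub_add_cancel he1, Nat.sub_add_cancel hg1] at this

/-- The cost of one color class in the coupling of flips at two neighbouring colorings. -/
noncomputable def classCost (N : Finset ι) (e g : ι → ℕ) (i j : ι) (α β : ℝ) : ℝ :=
  α * (∑ u ∈ N, (e u : ℝ) - e i) + β * (∑ u ∈ N, (g u : ℝ) - g j) +
    ∑ u ∈ N, ((e u : ℝ) * (flipP (e u) - if u = i then α else 0) +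
      (g u : ℝ) * (flipP (g u) - if u = j then β else 0) -
      min ((flipP (e u) : ℝ) - if u = i then α else 0)
        ((flipP (g u) : ℝ) - if u = j then β else 0))

lemma classCost_zero_le (he : ∀ u ∈ N, e u ≤ 7) (hg : ∀ u ∈ N, g u ≤ 7) :
    classCost N e g i j 0 0 ≤ ∑ u ∈ N, (pairWeight (e u) (g u) : ℝ) := by
  simp only [classCost, zero_mul, ite_self, sub_zero, zero_add]
  refine sum_le_sum fun u hu => ?_
  have := pair_bound (he u hu) (hg u hu)
  have h : ((e u * flipP (e u) + g u * flipP (g u) + 1507 : ℕ) : ℝ) ≤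
    ((pairWeight (e u) (g u) + min (flipP (e u)) (flipP (g u)) : ℕ) : ℝ) := by exact_mod_cast this
  push_cast at h
  linarith

lemma classCost_le_of_three_le (he : ∀ u ∈ N, e u ≤ 7) (hg : ∀ u ∈ N, g u ≤ 7)
    (hi : i ∈ N) (hj : j ∈ N) (hei : 1 ≤ e i) (hgj : 1 ≤ g j) (hN : 3 ≤ N.card) :
    classCost N e g i j (flipP (1 + ∑ u ∈ N, e u)) (flipP (1 + ∑ u ∈ N, g u)) ≤
      ∑ u ∈ N, (pairWeight (e u) (g u) : ℝ) - 3000 := by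
  set α : ℝ := (flipP (1 + ∑ u ∈ N, e u) : ℝ) with hα
  set β : ℝ := (flipP (1 + ∑ u ∈ N, g u) : ℝ) with hβ
  have hα0 : 0 ≤ α := by positivity
  have hβ0 : 0 ≤ β := by positivity
  have key : ∀ (e : ι → ℕ) (i : ι), i ∈ N → 1 ≤ e i →
      (flipP (1 + ∑ u ∈ N, e u) : ℝ) * (∑ u ∈ N, (e u : ℝ) - 1) ≤ 576 := by
    intro e i hi hei
    have h1 : 1 ≤ ∑ u ∈ N, e u := hei.trans (single_le_sum (f := e) (fun _ _ => Nat.zero_le _) hi)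
    obtain ⟨k, hk⟩ := Nat.exists_eq_add_of_le h1
    have h2 := @mul_flipP_add_le k
    have h3 : ∑ u ∈ N, (e u : ℝ) = 1 + k := by exact_mod_cast congrArg (Nat.cast (R := ℝ)) hk
    rw [h3, hk]
    have h4 : (k : ℝ) * flipP (k + 2) ≤ 576 := by exact_mod_cast h2
    rw [show 1 + (1 + k) = k + 2 by ring]
    linarith
  have kα := key e i hi hei
  have kβ := key g j hj hgj
  rw [← hα] at kα
  rw [← hβ] at kβ
  have hterm : ∀ u ∈ N, ((e u : ℝ) * (flipP (e u) - if u = i then α else 0) +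
      (g u : ℝ) * (flipP (g u) - if u = j then β else 0) -
      min ((flipP (e u) : ℝ) - if u = i then α else 0)
        ((flipP (g u) : ℝ) - if u = j then β else 0)) ≤
      (pairWeight (e u) (g u) : ℝ) - 1507 + ((if u = i then α * (1 - e i) else 0) +
        (if u = j then β * (1 - g j) else 0)) := by
    intro u hu
    have h : ((e u * flipP (e u) + g u * flipP (g u) + 1507 : ℕ) : ℝ) ≤
      ((pairWeight (e u) (g u) + min (flipP (e u)) (flipP (g u)) : ℕ) : ℝ) := by
      exact_mod_cast pair_bound (he u hu) (hg u hu)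
    push_cast at h
    have hm : min (flipP (e u) : ℝ) (flipP (g u)) ≤
        min ((flipP (e u) : ℝ) - if u = i then α else 0)
        ((flipP (g u) : ℝ) - if u = j then β else 0) + ((if u = i then α else 0) +
          if u = j then β else 0) := by
      have hx : 0 ≤ (if u = i then α else 0) := by split_ifs <;> simp [hα0]
      have hy : 0 ≤ (if u = j then β else 0) := by split_ifs <;> simp [hβ0]
      generalize (if u = i then α else 0) = x at hx ⊢
      generalize (if u = j then β else 0) = y at hy ⊢
      rcases min_choice ((flipP (e u) : ℝ) - x) ((flipP (g u) : ℝ) - y) with h | h <;> rw [h]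
      · linarith [min_le_left (flipP (e u) : ℝ) (flipP (g u))]
      · linarith [min_le_right (flipP (e u) : ℝ) (flipP (g u))]
    have e1 : (if u = i then α * (1 - (e i : ℝ)) else 0) =
        (if u = i then α else 0) - e u * (if u = i then α else 0) := by
      split_ifs with h
      · subst h; ring
      · ring
    have e2 : (if u = j then β * (1 - (g j : ℝ)) else 0) =
        (if u = j then β else 0) - g u * (if u = j then β else 0) := by
      split_ifs with h
      · subst h; ring
      · ring
    rw [e1, e2]
    linarith
  have hsum := sum_le_sum hterm
  rw [sum_add_distrib, sum_add_distrib, sum_ite_eq' N i, sum_ite_eq' N j, if_pos hi, if_pos hj,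
    sum_sub_distrib (fun u => (pairWeight (e u) (g u) : ℝ)), sum_const, nsmul_eq_mul] at hsum
  have hN' : (3 : ℝ) ≤ N.card := by exact_mod_cast hN
  have he1 : (1 : ℝ) ≤ e i := by exact_mod_cast hei
  have hg1 : (1 : ℝ) ≤ g j := by exact_mod_cast hgj
  unfold classCost
  nlinarith [mul_nonneg hα0 (sub_nonneg.2 he1), mul_nonneg hβ0 (sub_nonneg.2 hg1)]

lemma classCost_le_of_card_one (he : ∀ u ∈ N, e u ≤ 7) (hg : ∀ u ∈ N, g u ≤ 7)
    (hi : i ∈ N) (hj : j ∈ N) (hei : 1 ≤ e i) (hgj : 1 ≤ g j) (hN : N.card = 1) :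
    classCost N e g i j (flipP (1 + ∑ u ∈ N, e u)) (flipP (1 + ∑ u ∈ N, g u)) ≤
      ∑ u ∈ N, (pairWeight (e u) (g u) : ℝ) - 3000 := by
  obtain ⟨u, rfl⟩ := card_eq_one.1 hN
  rw [mem_singleton] at hi hj
  subst hj
  subst hi
  have h := card_one_bound (he i (by simp)) (hg i (by simp)) hei hgj
  have a1 : flipP (1 + e i) ≤ flipP (e i) := flipP_anti hei (by omega)
  have a2 : flipP (1 + g i) ≤ flipP (g i) := flipP_anti hgj (by omega)
  have h' := (Nat.cast_le (α := ℝ)).2 h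
  push_cast [Nat.cast_sub a1, Nat.cast_sub a2, Nat.cast_min] at h'
  simp only [classCost, sum_singleton, if_true]
  linarith

lemma classCost_le_of_card_two (he : ∀ u ∈ N, e u ≤ 7) (hg : ∀ u ∈ N, g u ≤ 7)
    (hi : i ∈ N) (hj : j ∈ N) (hei : 1 ≤ e i) (hgj : 1 ≤ g j) (hN : N.card = 2)
    (him : ∀ u ∈ N, e u ≤ e i) (hjm : ∀ u ∈ N, g u ≤ g j) :
    classCost N e g i j (flipP (1 + ∑ u ∈ N, e u)) (flipP (1 + ∑ u ∈ N, g u)) ≤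
      ∑ u ∈ N, (pairWeight (e u) (g u) : ℝ) - 3000 := by
  obtain ⟨u, hu⟩ := card_eq_one.1 (show (N.erase i).card = 1 by rw [card_erase_of_mem hi, hN])
  have hui : u ∈ N.erase i := by rw [hu]; simp
  have hne : i ≠ u := (ne_of_mem_erase hui).symm
  have huN := mem_of_mem_erase hui
  have hNe : N = {i, u} := by rw [← insert_erase hi, hu]
  have hsum : ∀ f : ι → ℕ, ∑ x ∈ N, f x = f i + f u := fun f => by rw [hNe, sum_pair hne]
  have hsumR : ∀ f : ι → ℝ, ∑ x ∈ N, f x = f i + f u := fun f => by rw [hNe, sum_pair hne]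
  have a1 : flipP (1 + (e i + e u)) ≤ flipP (e i) := flipP_anti hei (by omega)
  simp only [classCost, hsum, hsumR]
  have hj' : j = i ∨ j = u := by simpa [hNe] using hj
  rcases hj' with rfl | rfl
  · have a2 : flipP (1 + (g j + g u)) ≤ flipP (g j) := flipP_anti hgj (by omega)
    have h := test_two (he j hi) (hg j hj) hei hgj (him u huN) (hjm u huN)
    simp only [testTwo, Bool.and_eq_true, bmin_eq] at h
    have h' := (Nat.cast_le (α := ℝ)).2 (Nat.le_of_ble_eq_true h.1)
    push_cast [Nat.cast_sub a1, Nat.cast_sub a2, Nat.cast_min] at h'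
    simp only [if_true, hne.symm, if_false, sub_zero]
    linarith
  · have a2 : flipP (1 + (g i + g j)) ≤ flipP (g j) := flipP_anti hgj (by omega)
    have h := test_two (he i hi) (hg j hj) hei hgj (him j huN) (hjm i hi)
    simp only [testTwo, Bool.and_eq_true, bmin_eq] at h
    have h' := (Nat.cast_le (α := ℝ)).2 (Nat.le_of_ble_eq_true h.2)
    push_cast [Nat.cast_sub a1, Nat.cast_sub a2, Nat.cast_min] at h'
    simp only [if_true, hne.symm, hne, if_false, sub_zero]
    linarith

lemma classCost_le (he : ∀ u ∈ N, e u ≤ 7) (hg : ∀ u ∈ N, g u ≤ 7)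
    (hi : i ∈ N) (hj : j ∈ N) (hei : 1 ≤ e i) (hgj : 1 ≤ g j)
    (him : ∀ u ∈ N, e u ≤ e i) (hjm : ∀ u ∈ N, g u ≤ g j) :
    classCost N e g i j (flipP (1 + ∑ u ∈ N, e u)) (flipP (1 + ∑ u ∈ N, g u)) ≤
      ∑ u ∈ N, (pairWeight (e u) (g u) : ℝ) - 3000 := by
  have h0 : 0 < N.card := card_pos.2 ⟨i, hi⟩
  rcases (by omega : N.card = 1 ∨ N.card = 2 ∨ 3 ≤ N.card) with h | h | h
  · exact classCost_le_of_card_one he hg hi hj hei hgj h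
  · exact classCost_le_of_card_two he hg hi hj hei hgj h him hjm
  · exact classCost_le_of_three_le he hg hi hj hei hgj h

end Numeric

section Rates

variable {V : Type*} [Fintype V] {q : ℕ}

/-- Interchanging `a` and `b` on `S` respects the lists. -/
def Flippable (L : V → Finset (Fin q)) (a b : Fin q) (S : Finset V) : Prop :=
  ∀ x ∈ S, a ∈ L x ∧ b ∈ L x

/-- The rate at which a cluster is flipped. -/
noncomputable def flipRate (L : V → Finset (Fin q)) (a b : Fin q) (S : Finset V) : ℝ :=
  if Flippable L a b S then (flipP S.card : ℝ) else 0

/-- The colorings respecting the lists. -/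
def InLists (L : V → Finset (Fin q)) (σ : V → Fin q) : Prop := ∀ x, σ x ∈ L x

/-- `h` is Lipschitz for the Hamming metric. -/
def HammingLip (L : V → Finset (Fin q)) (h : (V → Fin q) → ℝ) : Prop :=
  ∀ σ τ, InLists L σ → InLists L τ → ∀ S : Finset V, (∀ x, x ∉ S → σ x = τ x) →
    h σ - h τ ≤ S.card

/-- Size of a cluster, truncated at `7`, which also stands for clusters that cannot be flipped. -/
noncomputable def capSize (L : V → Finset (Fin q)) (a b : Fin q) (S : Finset V) : ℕ :=
  if Flippable L a b S ∧ S.card ≤ 6 then S.card else 7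

variable {G : SimpleGraph V} {L : V → Finset (Fin q)} {W : Finset V} {σ τ : V → Fin q}
  {a b c : Fin q} {S T : Finset V} {x y v : V} {h : (V → Fin q) → ℝ}

lemma flipRate_eq : flipRate L a b S = flipP (capSize L a b S) := by
  unfold flipRate capSize
  by_cases h1 : Flippable L a b S
  · by_cases h2 : S.card ≤ 6
    · simp [h1, h2]
    · simp only [h1, h2, and_false, if_true, if_false]
      rw [flipP_of_ge (by omega), flipP_of_ge le_rfl]
  · simp [h1, flipP]

lemma Flippable.symm (h : Flippable L a b S) : Flippable L b a S := fun x hx => (h x hx).symm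

lemma flipRate_comm : flipRate L a b S = flipRate L b a S := by
  unfold flipRate
  have : Flippable L a b S ↔ Flippable L b a S := ⟨Flippable.symm, Flippable.symm⟩
  rw [if_congr this rfl rfl]

lemma flipRate_nonneg : 0 ≤ flipRate L a b S := by
  rw [flipRate_eq]; positivity

lemma flipRate_le : flipRate L a b S ≤ 3000 := by
  rw [flipRate_eq]; exact_mod_cast flipP_le _

lemma flippable_of_flipRate_ne (h : flipRate L a b S ≠ 0) : Flippable L a b S := by
  by_contra hc; exact h (by simp [flipRate, hc])

lemma flipRate_mul_card_le : flipRate L a b S * S.card ≤ 3000 := by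
  unfold flipRate
  split_ifs
  · rw [mul_comm]; exact_mod_cast mul_flipP_le _
  · simp

lemma flipRate_mul_card_sub_le (h : 2 ≤ S.card) : flipRate L a b S * (S.card - 2) ≤ 576 := by
  unfold flipRate
  split_ifs
  · obtain ⟨k, hk⟩ := Nat.exists_eq_add_of_le h
    have := @mul_flipP_add_le k
    rw [hk, mul_comm]
    push_cast
    rw [show ((2 : ℝ) + k - 2) = k by ring, add_comm 2 k]
    exact_mod_cast this
  · simp

lemma capSize_le : capSize L a b S ≤ 7 := by
  unfold capSize; split_ifs with h <;> omega

lemma capSize_pos (h : S.Nonempty) : 1 ≤ capSize L a b S := by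
  unfold capSize; split_ifs
  · exact card_pos.2 h
  · omega

lemma capSize_of_lt (h : capSize L a b S ≤ 6) : Flippable L a b S ∧ S.card = capSize L a b S := by
  unfold capSize at h ⊢
  split_ifs at h ⊢ with h1
  · exact ⟨h1.1, rfl⟩
  · omega

lemma InLists.swap (hσ : InLists L σ) (hf : Flippable L a b S) : InLists L (swapOn a b S σ) := by
  intro x
  by_cases hx : x ∈ S
  · rw [swapOn_of_mem hx, Equiv.swap_apply_def]
    split_ifs
    · exact (hf x hx).2
    · exact (hf x hx).1
    · exact hσ x
  · rw [swapOn_of_notMem hx]; exact hσ x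

lemma InLists.swap_of_rate (hσ : InLists L σ) (hf : flipRate L a b S ≠ 0) :
    InLists L (swapOn a b S σ) := hσ.swap (flippable_of_flipRate_ne hf)

lemma flipRate_mul_abs_le (hh : HammingLip L h) (hσ : InLists L σ) :
    flipRate L a b S * |h (swapOn a b S σ) - h σ| ≤ flipRate L a b S * S.card := by
  by_cases h0 : flipRate L a b S = 0
  · simp [h0]
  · have hs := hσ.swap_of_rate h0
    refine mul_le_mul_of_nonneg_left (abs_sub_le_iff.2 ⟨?_, ?_⟩) flipRate_nonneg
    · exact hh _ _ hs hσ S fun x hx => swapOn_of_notMem hx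
    · exact hh _ _ hσ hs S fun x hx => (swapOn_of_notMem hx).symm

/-- The neighbours of `v` of color `c`. -/
noncomputable def colorNbrs (G : SimpleGraph V) (σ : V → Fin q) (v : V) (c : Fin q) : Finset V :=
  univ.filter fun u => G.Adj v u ∧ σ u = c

lemma mem_colorNbrs {u : V} : u ∈ colorNbrs G σ v c ↔ G.Adj v u ∧ σ u = c := by
  simp [colorNbrs]

/-- A chosen `c`-colored neighbour of `v` inside a cluster. -/
noncomputable def nbrRep (G : SimpleGraph V) (σ : V → Fin q) (v : V) (c : Fin q) (S : Finset V) :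
    V := if h : Meets G σ v c S then h.choose else v

lemma nbrRep_spec (h : Meets G σ v c S) :
    nbrRep G σ v c S ∈ S ∧ nbrRep G σ v c S ∈ colorNbrs G σ v c := by
  unfold nbrRep
  rw [dif_pos h, mem_colorNbrs]
  exact h.choose_spec

/-- The cluster of `u` when `v` is removed. -/
noncomputable def offCluster (G : SimpleGraph V) (σ : V → Fin q) (v : V) (a c : Fin q) (u : V) :
    Finset V := reachSet (biGraph G (univ.erase v) σ a c) u

/-- Capped cluster sizes, counted once per cluster. -/
noncomputable def nbrSize (G : SimpleGraph V) (L : V → Finset (Fin q)) (σ : V → Fin q) (v : V)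
    (a c : Fin q) (u : V) : ℕ :=
  if nbrRep G σ v c (offCluster G σ v a c u) = u then capSize L a c (offCluster G σ v a c u) else 0

lemma offCluster_mem {u : V} (hu : u ∈ colorNbrs G σ v c) :
    offCluster G σ v a c u ∈ touching G σ v a c c := by
  rw [mem_colorNbrs] at hu
  have huv : u ≠ v := hu.1.ne'
  refine mem_filter.2 ⟨reachSet_mem_clusters (by simp [huv]) (Or.inr hu.2), u,
    self_mem_reachSet _ _, hu⟩

lemma self_mem_offCluster {u : V} : u ∈ offCluster G σ v a c u := self_mem_reachSet _ _

lemma sum_touching (φ : Finset V → ℝ) :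
    ∑ S ∈ touching G σ v a c c, φ S = ∑ u ∈ colorNbrs G σ v c,
      if nbrRep G σ v c (offCluster G σ v a c u) = u then φ (offCluster G σ v a c u) else 0 := by
  rw [← sum_filter]
  have key : ∀ S ∈ touching G σ v a c c, offCluster G σ v a c (nbrRep G σ v c S) = S := by
    intro S hS
    obtain ⟨h1, h2⟩ := mem_filter.1 hS
    exact (clusters_eq_reachSet h1 (nbrRep_spec h2).1).symm
  refine sum_bij' (fun S _ => nbrRep G σ v c S) (fun u _ => offCluster G σ v a c u) ?_ ?_ ?_ ?_ ?_
  · intro S hS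
    rw [mem_filter, key S hS]
    exact ⟨(nbrRep_spec (mem_filter.1 hS).2).2, rfl⟩
  · intro u hu
    exact offCluster_mem (mem_filter.1 hu).1
  · exact key
  · intro u hu
    exact (mem_filter.1 hu).2
  · intro S hS
    rw [key S hS]

lemma exists_nbrSize_pos {u : V} (hu : u ∈ colorNbrs G σ v c) :
    ∃ i ∈ colorNbrs G σ v c, 1 ≤ nbrSize G L σ v a c i ∧
      ∀ j ∈ colorNbrs G σ v c, nbrSize G L σ v a c j ≤ nbrSize G L σ v a c i := by
  obtain ⟨i, hi, him⟩ := exists_max_image (colorNbrs G σ v c) (nbrSize G L σ v a c) ⟨u, hu⟩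
  refine ⟨i, hi, ?_, him⟩
  have hS := offCluster_mem (a := a) hu
  obtain ⟨h1, h2⟩ := mem_filter.1 hS
  have h3 := nbrRep_spec h2
  refine le_trans ?_ (him _ h3.2)
  have h4 : offCluster G σ v a c (nbrRep G σ v c (offCluster G σ v a c u)) =
    offCluster G σ v a c u := (clusters_eq_reachSet h1 h3.1).symm
  unfold nbrSize
  rw [h4, if_pos rfl]
  exact capSize_pos ⟨u, self_mem_offCluster⟩

lemma nbrSize_le {u : V} : nbrSize G L σ v a c u ≤ 7 := by
  unfold nbrSize; split_ifs
  · exact capSize_le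
  · omega

lemma sum_touching_capSize :
    ∑ S ∈ touching G σ v a c c, capSize L a c S = ∑ u ∈ colorNbrs G σ v c, nbrSize G L σ v a c u := by
  have := sum_touching (G := G) (σ := σ) (v := v) (a := a) (c := c) (fun S => (capSize L a c S : ℝ))
  have h2 : ∀ u, (if nbrRep G σ v c (offCluster G σ v a c u) = u then
    (capSize L a c (offCluster G σ v a c u) : ℝ) else 0) = (nbrSize G L σ v a c u : ℝ) := by
    intro u; unfold nbrSize; split_ifs <;> simp
  simp only [h2] at this
  exact_mod_cast this

lemma flipRate_bigCluster (ha : a ∈ L v) :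
    flipRate L a c (bigCluster G σ v a c) =
      if c ∈ L v then (flipP (1 + ∑ u ∈ colorNbrs G σ v c, nbrSize G L σ v a c u) : ℝ) else 0 := by
  split_ifs with hc
  · rw [← sum_touching_capSize]
    by_cases hall : ∀ S ∈ touching G σ v a c c, capSize L a c S ≤ 6
    · have h1 : Flippable L a c (bigCluster G σ v a c) := by
        intro x hx
        simp only [bigCluster, mem_insert, mem_biUnion, id] at hx
        rcases hx with rfl | ⟨S, hS, hx⟩
        · exact ⟨ha, hc⟩
        · exact (capSize_of_lt (hall S hS)).1 x hx
      unfold flipRate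
      rw [if_pos h1, card_bigCluster]
      congr 3
      exact sum_congr rfl fun S hS => (capSize_of_lt (hall S hS)).2
    · push Not at hall
      obtain ⟨S, hS, h7⟩ := hall
      have h1 : 7 ≤ ∑ S ∈ touching G σ v a c c, capSize L a c S :=
        le_trans h7 (single_le_sum (f := fun S => capSize L a c S) (fun _ _ => Nat.zero_le _) hS)
      rw [flipP_of_ge (by omega : 7 ≤ 1 + ∑ S ∈ touching G σ v a c c, capSize L a c S)]
      unfold flipRate
      split_ifs with hf
      · have hSA : S ⊆ bigCluster G σ v a c := by
          intro x hx
          simp only [bigCluster, mem_insert, mem_biUnion, id]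
          exact Or.inr ⟨S, hS, hx⟩
        have hfS : Flippable L a c S := fun x hx => hf x (hSA hx)
        have : 7 ≤ S.card := by
          by_contra hlt
          have : capSize L a c S = S.card := by
            unfold capSize; rw [if_pos ⟨hfS, by omega⟩]
          omega
        rw [flipP_of_ge (this.trans (card_le_card hSA))]
      · simp
  · unfold flipRate
    rw [if_neg]
    intro hf
    exact hc (hf v self_mem_bigCluster).2

lemma card_bigCluster_of_rate (hr : flipRate L a c (bigCluster G σ v a c) ≠ 0) :
    ((bigCluster G σ v a c).card : ℝ) = 1 + ∑ u ∈ colorNbrs G σ v c, (nbrSize G L σ v a c u : ℝ) := by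
  have hf := flippable_of_flipRate_ne hr
  have hall : ∀ S ∈ touching G σ v a c c, S.card = capSize L a c S := by
    intro S hS
    have hSA : S ⊆ bigCluster G σ v a c := by
      intro x hx
      simp only [bigCluster, mem_insert, mem_biUnion, id]
      exact Or.inr ⟨S, hS, hx⟩
    have h6 : (bigCluster G σ v a c).card ≤ 6 := by
      by_contra hlt
      apply hr
      unfold flipRate
      rw [if_pos hf, flipP_of_ge (by omega)]; simp
    unfold capSize
    rw [if_pos ⟨fun x hx => hf x (hSA hx), (card_le_card hSA).trans h6⟩]
  rw [card_bigCluster, sum_congr rfl hall, sum_touching_capSize]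
  push_cast
  rfl

lemma pair_move_le {p p' e g x y δ : ℝ} (hp : 0 ≤ p) (hp' : 0 ≤ p') (hx : p ≠ 0 → -x ≤ e)
    (hy : p' ≠ 0 → y ≤ g) (hxy : p ≠ 0 → p' ≠ 0 → y - x ≤ e + g - δ) :
    -(p * x) + p' * y ≤ e * p + g * p' - min p p' + min p p' * (1 - δ) := by
  have hx' : -(p * x) ≤ p * e := by
    rcases eq_or_ne p 0 with h | h
    · simp [h]
    · nlinarith [hx h]
  have hy' : p' * y ≤ p' * g := by
    rcases eq_or_ne p' 0 with h | h
    · simp [h]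
    · nlinarith [hy h]
  rcases eq_or_ne p 0 with h | h
  · subst h; rw [min_eq_left hp']; nlinarith
  rcases eq_or_ne p' 0 with h' | h'
  · subst h'; rw [min_eq_right hp]; nlinarith
  have h1 := hx h
  have h2 := hy h'
  have h3 := hxy h h'
  rcases le_total p p' with hle | hle
  · rw [min_eq_left hle]; nlinarith
  · rw [min_eq_right hle]; nlinarith

lemma class_move_le {ι : Type*} {N : Finset ι} {e g : ι → ℕ} {i j : ι} (hi : i ∈ N) (hj : j ∈ N)
    {α β δ X Y : ℝ} {x y : ι → ℝ} (hα : 0 ≤ α) (hβ : 0 ≤ β) (hαi : α ≤ flipP (e i))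
    (hβj : β ≤ flipP (g j))
    (hx : ∀ u ∈ N, flipP (e u) ≠ 0 → -(x u) ≤ e u)
    (hy : ∀ u ∈ N, flipP (g u) ≠ 0 → y u ≤ g u)
    (hxy : ∀ u ∈ N, flipP (e u) ≠ 0 → flipP (g u) ≠ 0 → y u - x u ≤ e u + g u - δ)
    (hX : α * (X - x i) ≤ α * (∑ u ∈ N, (e u : ℝ) - e i + 1 - δ))
    (hY : β * (y j - Y) ≤ β * (∑ u ∈ N, (g u : ℝ) - g j + 1 - δ)) :
    ∃ w, 0 ≤ w ∧ w ≤ β + 3000 * N.card ∧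
      α * X - ∑ u ∈ N, flipP (e u) * x u - β * Y + ∑ u ∈ N, flipP (g u) * y u ≤
        classCost N e g i j α β + w * (1 - δ) := by
  set Q : ι → ℝ := fun u => (flipP (e u) : ℝ) - if u = i then α else 0 with hQ
  set R : ι → ℝ := fun u => (flipP (g u) : ℝ) - if u = j then β else 0 with hR
  have hQ0 : ∀ u, 0 ≤ Q u := by
    intro u; simp only [hQ]; split_ifs with h
    · subst h; linarith
    · simp
  have hR0 : ∀ u, 0 ≤ R u := by
    intro u; simp only [hR]; split_ifs with h
    · subst h; linarith
    · simp
  have hQne : ∀ u, Q u ≠ 0 → flipP (e u) ≠ 0 := by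
    intro u h1 h2
    have := hQ0 u
    apply h1
    simp only [hQ, h2, Nat.cast_zero] at this ⊢
    split_ifs at this ⊢ <;> linarith
  have hRne : ∀ u, R u ≠ 0 → flipP (g u) ≠ 0 := by
    intro u h1 h2
    have := hR0 u
    apply h1
    simp only [hR, h2, Nat.cast_zero] at this ⊢
    split_ifs at this ⊢ <;> linarith
  refine ⟨α + β + ∑ u ∈ N, min (Q u) (R u), ?_, ?_, ?_⟩
  · have : 0 ≤ ∑ u ∈ N, min (Q u) (R u) := sum_nonneg fun u _ => le_min (hQ0 u) (hR0 u)
    linarith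
  · have : ∑ u ∈ N, min (Q u) (R u) ≤ ∑ u ∈ N, ((3000 : ℝ) - if u = i then α else 0) := by
      refine sum_le_sum fun u _ => (min_le_left _ _).trans ?_
      simp only [hQ]
      have : (flipP (e u) : ℝ) ≤ 3000 := by exact_mod_cast flipP_le _
      linarith
    rw [sum_sub_distrib, sum_const, nsmul_eq_mul, sum_ite_eq' N i, if_pos hi] at this
    linarith
  · have hsum := sum_le_sum fun u hu => pair_move_le (δ := δ) (hQ0 u) (hR0 u)
      (fun h => hx u hu (hQne u h)) (fun h => hy u hu (hRne u h))
      (fun h h' => hxy u hu (hQne u h) (hRne u h'))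
    have e1 : ∑ u ∈ N, (-(Q u * x u) + R u * y u) =
        -∑ u ∈ N, flipP (e u) * x u + ∑ u ∈ N, flipP (g u) * y u + α * x i - β * y j := by
      have f1 : ∀ u ∈ N, -(Q u * x u) + R u * y u = -((flipP (e u) : ℝ) * x u) +
          flipP (g u) * y u + (if u = i then α * x i else 0) - (if u = j then β * y j else 0) := by
        intro u _
        simp only [hQ, hR]
        split_ifs with h1 h2 h2 <;> (try subst h1) <;> (try subst h2) <;> ring
      rw [sum_congr rfl f1, sum_sub_distrib, sum_add_distrib, sum_add_distrib,
        sum_ite_eq' N i, sum_ite_eq' N j, if_pos hi, if_pos hj, sum_neg_distrib]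
    have e2 : ∑ u ∈ N, ((e u : ℝ) * Q u + g u * R u - min (Q u) (R u) +
        min (Q u) (R u) * (1 - δ)) = ∑ u ∈ N, ((e u : ℝ) * Q u + g u * R u - min (Q u) (R u)) +
        (∑ u ∈ N, min (Q u) (R u)) * (1 - δ) := by
      rw [sum_add_distrib, sum_mul]
    rw [e1, e2] at hsum
    unfold classCost
    linarith

end Rates

section FreeColors

variable {V : Type*} [Fintype V] {q : ℕ} {G : SimpleGraph V} {L : V → Finset (Fin q)}
  {W : Finset V} {σ τ : V → Fin q} {a b c : Fin q} {S T : Finset V} {x y u v : V}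
  {h : (V → Fin q) → ℝ}

/-- The neighbours of `u` other than `v` with a color in `{a, b}`. -/
noncomputable def blockers (G : SimpleGraph V) (σ : V → Fin q) (v : V) (a b : Fin q) (u : V) :
    Finset V := univ.filter fun w => G.Adj u w ∧ w ≠ v ∧ (σ w = a ∨ σ w = b)

/-- `u` has exactly one blocker, and that blocker is not frozen. -/
def OneBlocker (G : SimpleGraph V) (L : V → Finset (Fin q)) (σ : V → Fin q) (v : V) (a b : Fin q)
    (u : V) : Prop := ∃ w, blockers G σ v a b u = {w} ∧ 2 ≤ (L w).card

/-- The weight charged to a neighbour `u` of `v`. -/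
noncomputable def nbrWeight (G : SimpleGraph V) (L : V → Finset (Fin q)) (σ : V → Fin q) (v : V)
    (a b : Fin q) (u : V) : ℝ :=
  if blockers G σ v a b u = ∅ then 5200 else if OneBlocker G L σ v a b u then 5505 else 5497

lemma mem_blockers {w : V} :
    w ∈ blockers G σ v a b u ↔ G.Adj u w ∧ w ≠ v ∧ (σ w = a ∨ σ w = b) := by
  simp [blockers]

/-- `σ` and `τ` agree except possibly at `v`. -/
def AgreeOff (v : V) (σ τ : V → Fin q) : Prop := ∀ x, x ≠ v → σ x = τ x

lemma AgreeOff.symm (hst : AgreeOff v σ τ) : AgreeOff v τ σ := fun x hx => (hst x hx).symm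

lemma blockers_congr (hst : AgreeOff v σ τ) :
    blockers G σ v a b u = blockers G τ v b a u := by
  ext w
  simp only [mem_blockers]
  refine and_congr_right fun _ => and_congr_right fun hw => ?_
  rw [hst w hw]; tauto

lemma colorNbrs_congr (hst : AgreeOff v σ τ) : colorNbrs G σ v c = colorNbrs G τ v c := by
  ext w
  simp only [mem_colorNbrs]
  refine and_congr_right fun hw => ?_
  rw [hst w hw.ne']

lemma clusters_erase_congr (hst : AgreeOff v σ τ) :
    clusters G (univ.erase v) σ a b = clusters G (univ.erase v) τ a b :=
  clusters_congr fun x hx => hst x (ne_of_mem_erase hx)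

lemma touching_congr (hst : AgreeOff v σ τ) : touching G σ v a b c = touching G τ v a b c := by
  unfold touching
  rw [clusters_erase_congr hst]
  refine filter_congr fun S _ => exists_congr fun w => and_congr_right fun _ =>
    and_congr_right fun hw => ?_
  rw [hst w hw.ne']

lemma offCluster_eq_singleton (hb : blockers G σ v a b u = ∅) (hu : σ u = c) (hca : c ≠ a) :
    offCluster G σ v a c u = {u} := by
  refine reachSet_eq_singleton fun y hy => ?_
  have hyv : y ≠ v := by simpa using hy.2.2.1
  have : y ∈ blockers G σ v a b u := by
    rw [mem_blockers]
    refine ⟨hy.1, hyv, Or.inl ?_⟩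
    rcases hy.2.2.2 with h1 | h1
    · exact absurd (hu.symm.trans h1.1) hca
    · exact h1.2
  simp [hb] at this

lemma nbrSize_of_no_blockers (hb : blockers G σ v a b u = ∅) (hu : u ∈ colorNbrs G σ v c)
    (hca : c ≠ a) : nbrSize G L σ v a c u = 1 ∨ nbrSize G L σ v a c u = 7 := by
  have huc := mem_colorNbrs.1 hu
  have h1 := offCluster_eq_singleton hb huc.2 hca
  have hm : Meets G σ v c {u} := ⟨u, by simp, huc⟩
  have h2 : nbrRep G σ v c {u} = u := by simpa using (nbrRep_spec hm).1
  unfold nbrSize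
  rw [h1, if_pos h2]
  unfold capSize
  split_ifs <;> simp

lemma oneBlocker_of_sizes (hst : AgreeOff v σ τ) (hu : u ∈ colorNbrs G σ v c) (hca : c ≠ a)
    (hcb : c ≠ b) (he : nbrSize G L σ v a c u = 2) (hg : nbrSize G L τ v b c u = 1) :
    OneBlocker G L σ v a b u := by
  have huc := mem_colorNbrs.1 hu
  have huv : u ≠ v := huc.1.ne'
  have he' : capSize L a c (offCluster G σ v a c u) = 2 := by
    unfold nbrSize at he; split_ifs at he; exact he
  have hg' : capSize L b c (offCluster G τ v b c u) = 1 := by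
    unfold nbrSize at hg; split_ifs at hg; exact hg
  have hC := capSize_of_lt (L := L) (a := a) (b := c) (S := offCluster G σ v a c u) (by omega)
  have hD := capSize_of_lt (L := L) (a := b) (b := c) (S := offCluster G τ v b c u) (by omega)
  rw [he'] at hC
  rw [hg'] at hD
  have hne : ∃ w, (biGraph G (univ.erase v) σ a c).Adj u w := by
    by_contra hcon
    push Not at hcon
    have := reachSet_eq_singleton hcon
    have h2 := hC.2
    unfold offCluster at h2
    rw [this] at h2
    simp at h2
  obtain ⟨w, hw⟩ := hne
  have hCm := (mem_filter.1 (offCluster_mem (a := a) hu)).1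
  have hDm := (mem_filter.1 (offCluster_mem (a := b) (colorNbrs_congr hst ▸ hu))).1
  have hwC : w ∈ offCluster G σ v a c u := clusters_closed hCm self_mem_offCluster hw
  refine ⟨w, ?_, ?_⟩
  · ext z
    rw [mem_singleton]
    constructor
    · intro hz
      obtain ⟨hz1, hz2, hz3⟩ := mem_blockers.1 hz
      rcases hz3 with hz3 | hz3
      · have hzC : z ∈ offCluster G σ v a c u := clusters_closed hCm self_mem_offCluster
          ⟨hz1, by simp [huv], by simp [hz2], Or.inr ⟨huc.2, hz3⟩⟩
        by_contra hzw
        have h3 : ({u, w, z} : Finset V) ⊆ offCluster G σ v a c u := by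
          intro t ht
          simp only [mem_insert, mem_singleton] at ht
          rcases ht with rfl | rfl | rfl
          · exact self_mem_offCluster
          · exact hwC
          · exact hzC
        have h4 := card_le_card h3
        rw [hC.2, card_eq_three.2 ⟨u, w, z, hw.1.ne, hz1.ne, fun h => hzw h.symm, rfl⟩] at h4
        omega
      · have hzD : z ∈ offCluster G τ v b c u := clusters_closed hDm self_mem_offCluster
          ⟨hz1, by simp [huv], by simp [hz2], Or.inr ⟨by rw [← hst u huv]; exact huc.2, by
            rw [← hst z hz2]; exact hz3⟩⟩
        have h3 : ({u, z} : Finset V) ⊆ offCluster G τ v b c u := by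
          intro t ht
          simp only [mem_insert, mem_singleton] at ht
          rcases ht with rfl | rfl
          · exact self_mem_offCluster
          · exact hzD
        have h4 := card_le_card h3
        rw [hD.2, card_pair hz1.ne] at h4
        omega
    · rintro rfl
      rw [mem_blockers]
      refine ⟨hw.1, by simpa using hw.2.2.1, Or.inl ?_⟩
      rcases hw.2.2.2 with h1 | h1
      · exact absurd (huc.2.symm.trans h1.1) hca
      · exact h1.2
  · have := hC.1 w hwC
    exact one_lt_card.2 ⟨a, this.1, c, this.2, hca.symm⟩

lemma pairWeight_cases (e g : ℕ) : pairWeight e g ≤ 5497 ∨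
    (pairWeight e g = 5505 ∧ ((e = 1 ∧ g = 2) ∨ (e = 2 ∧ g = 1))) := by
  unfold pairWeight
  cases h1 : ((e.beq 1 || e.beq 7) && (g.beq 1 || g.beq 7))
  · cases h2 : ((e.beq 1 && g.beq 2) || (e.beq 2 && g.beq 1))
    · left; simp
    · right
      simp only [Bool.or_eq_true, Bool.and_eq_true, Nat.beq_eq] at h2
      exact ⟨by simp, h2⟩
  · left; simp

lemma pairWeight_le_nbrWeight (hst : AgreeOff v σ τ) (hu : u ∈ colorNbrs G σ v c) (hca : c ≠ a)
    (hcb : c ≠ b) : (pairWeight (nbrSize G L σ v a c u) (nbrSize G L τ v b c u) : ℝ) ≤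
      nbrWeight G L σ v a b u := by
  unfold nbrWeight
  have hu' : u ∈ colorNbrs G τ v c := colorNbrs_congr hst ▸ hu
  split_ifs with h1 h2
  · have e1 := nbrSize_of_no_blockers (L := L) h1 hu hca
    have e2 := nbrSize_of_no_blockers (L := L) ((blockers_congr hst).symm.trans h1) hu' hcb
    rcases e1 with e1 | e1 <;> rcases e2 with e2 | e2 <;> rw [e1, e2] <;> norm_num [pairWeight]
  · rcases pairWeight_cases (nbrSize G L σ v a c u) (nbrSize G L τ v b c u) with h | h
    · exact_mod_cast h.trans (by norm_num)
    · rw [h.1]; norm_num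
  · rcases pairWeight_cases (nbrSize G L σ v a c u) (nbrSize G L τ v b c u) with h | h
    · exact_mod_cast h
    · exfalso
      apply h2
      rcases h.2 with h | h
      · have := oneBlocker_of_sizes hst.symm hu' hcb hca h.2 h.1
        obtain ⟨w, hw, hw'⟩ := this
        exact ⟨w, by rw [blockers_congr hst]; exact hw, hw'⟩
      · exact oneBlocker_of_sizes hst hu hca hcb h.1 h.2

lemma touching_subset_bigCluster (hS : S ∈ touching G σ v a c c) : S ⊆ bigCluster G σ v a c := by
  intro x hx
  simp only [bigCluster, mem_insert, mem_biUnion, id]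
  exact Or.inr ⟨S, hS, hx⟩

lemma notMem_of_touching (hS : S ∈ touching G σ v a b c) : v ∉ S :=
  not_mem_of_mem_clusters_erase (mem_filter.1 hS).1

/-- Flipping the cluster of `v` in `σ` against flipping one of its pieces in `τ`. -/
lemma big_vs_piece (hh : HammingLip L h) (hσ : InLists L σ) (hτ : InLists L τ)
    (hst : AgreeOff v σ τ) (hS : S ∈ touching G σ v a c c)
    (hf : Flippable L a c (bigCluster G σ v a c)) :
    h (swapOn a c (bigCluster G σ v a c) σ) - h (swapOn a c S τ) ≤
      (bigCluster G σ v a c).card - S.card ∧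
    h (swapOn a c S τ) - h (swapOn a c (bigCluster G σ v a c) σ) ≤
      (bigCluster G σ v a c).card - S.card := by
  have hsub := touching_subset_bigCluster hS
  have h1 := hσ.swap hf
  have h2 := hτ.swap (fun x hx => hf x (hsub hx))
  have hcard : ((bigCluster G σ v a c \ S).card : ℝ) =
      (bigCluster G σ v a c).card - S.card := by
    rw [card_sdiff_of_subset hsub, Nat.cast_sub (card_le_card hsub)]
  have hag : ∀ x, x ∉ bigCluster G σ v a c \ S →
      swapOn a c (bigCluster G σ v a c) σ x = swapOn a c S τ x := by
    intro x hx
    by_cases hxS : x ∈ S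
    · have hxv : x ≠ v := fun hxv => notMem_of_touching hS (hxv ▸ hxS)
      rw [swapOn_of_mem hxS, swapOn_of_mem (hsub hxS), hst x hxv]
    · have hxA : x ∉ bigCluster G σ v a c := by
        intro hxA; exact hx (mem_sdiff.2 ⟨hxA, hxS⟩)
      have hxv : x ≠ v := fun hxv => hxA (hxv ▸ self_mem_bigCluster)
      rw [swapOn_of_notMem hxS, swapOn_of_notMem hxA, hst x hxv]
  rw [← hcard]
  exact ⟨hh _ _ h1 h2 _ hag, hh _ _ h2 h1 _ fun x hx => (hag x hx).symm⟩

/-- The uncoupled part of the drift for the color pairs `{σ v, c}` and `{τ v, c}`. -/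
noncomputable def freeColorDrift (G : SimpleGraph V) (L : V → Finset (Fin q))
    (h : (V → Fin q) → ℝ) (σ τ : V → Fin q) (v : V) (a b c : Fin q) : ℝ :=
  flipRate L a c (bigCluster G σ v a c) * (h (swapOn a c (bigCluster G σ v a c) σ) - h σ) -
    ∑ S ∈ touching G σ v a c c, flipRate L a c S * (h (swapOn a c S τ) - h τ) -
    flipRate L b c (bigCluster G τ v b c) * (h (swapOn b c (bigCluster G τ v b c) τ) - h τ) +
    ∑ S ∈ touching G τ v b c c, flipRate L b c S * (h (swapOn b c S σ) - h σ)

lemma rate_sum_touching (φ : Finset V → ℝ) :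
    ∑ S ∈ touching G σ v a c c, flipRate L a c S * φ S =
      ∑ u ∈ colorNbrs G σ v c, flipP (nbrSize G L σ v a c u) * φ (offCluster G σ v a c u) := by
  rw [sum_touching]
  refine sum_congr rfl fun u _ => ?_
  unfold nbrSize
  split_ifs
  · rw [flipRate_eq]
  · simp [flipP]

lemma nbrSize_flippable (hu : flipP (nbrSize G L σ v a c u) ≠ 0) :
    Flippable L a c (offCluster G σ v a c u) ∧
      (offCluster G σ v a c u).card = nbrSize G L σ v a c u := by
  have h6 : nbrSize G L σ v a c u ≤ 6 := by
    by_contra hlt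
    exact hu (flipP_of_ge (by omega))
  have : nbrSize G L σ v a c u = capSize L a c (offCluster G σ v a c u) := by
    unfold nbrSize at hu ⊢
    split_ifs at hu ⊢
    · rfl
    · simp [flipP] at hu
  rw [this] at h6 ⊢
  exact capSize_of_lt h6

lemma big_move_bound (hh : HammingLip L h) (hσ : InLists L σ) (hτ : InLists L τ)
    (hst : AgreeOff v σ τ) {i : V} (hi : i ∈ colorNbrs G σ v c)
    (hi1 : 1 ≤ nbrSize G L σ v a c i)
    (hr : flipRate L a c (bigCluster G σ v a c) ≠ 0) :
    h (swapOn a c (bigCluster G σ v a c) σ) - h (swapOn a c (offCluster G σ v a c i) τ) ≤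
      ∑ u ∈ colorNbrs G σ v c, (nbrSize G L σ v a c u : ℝ) - nbrSize G L σ v a c i + 1 ∧
    h (swapOn a c (offCluster G σ v a c i) τ) - h (swapOn a c (bigCluster G σ v a c) σ) ≤
      ∑ u ∈ colorNbrs G σ v c, (nbrSize G L σ v a c u : ℝ) - nbrSize G L σ v a c i + 1 := by
  have hf := flippable_of_flipRate_ne hr
  have h1 := big_vs_piece hh hσ hτ hst (offCluster_mem hi) hf
  have h2 := card_bigCluster_of_rate hr
  have hca : capSize L a c (offCluster G σ v a c i) = nbrSize G L σ v a c i := by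
    unfold nbrSize at hi1 ⊢
    split_ifs at hi1 ⊢
    · rfl
    · omega
  have h3 : nbrSize G L σ v a c i ≤ (offCluster G σ v a c i).card := by
    rw [← hca]
    unfold capSize
    split_ifs with h4
    · exact le_rfl
    · have hfl : Flippable L a c (offCluster G σ v a c i) := fun x hx =>
        hf x (touching_subset_bigCluster (offCluster_mem hi) hx)
      by_contra hlt
      exact h4 ⟨hfl, by omega⟩
  have h3' : (nbrSize G L σ v a c i : ℝ) ≤ (offCluster G σ v a c i).card := by exact_mod_cast h3
  constructor <;> linarith [h1.1, h1.2]

lemma piece_move_bound (hh : HammingLip L h) (hσ : InLists L σ) (hτ : InLists L τ)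
    (hst : AgreeOff v σ τ) (he : flipP (nbrSize G L σ v a c u) ≠ 0)
    (hg : flipP (nbrSize G L τ v b c u) ≠ 0) :
    h (swapOn b c (offCluster G τ v b c u) σ) - h (swapOn a c (offCluster G σ v a c u) τ) ≤
      (nbrSize G L σ v a c u : ℝ) + nbrSize G L τ v b c u := by
  obtain ⟨h1, h2⟩ := nbrSize_flippable he
  obtain ⟨h3, h4⟩ := nbrSize_flippable hg
  rw [← h2, ← h4]
  set C := offCluster G σ v a c u
  set D := offCluster G τ v b c u
  have hcard : (insert v (C ∪ D)).card ≤ C.card + D.card := by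
    have h5 : 1 ≤ (C ∩ D).card :=
      card_pos.2 ⟨u, mem_inter.2 ⟨self_mem_offCluster, self_mem_offCluster⟩⟩
    have h6 := card_union_add_card_inter C D
    have h7 := card_insert_le v (C ∪ D)
    omega
  refine (hh _ _ (hσ.swap h3) (hτ.swap h1) (insert v (C ∪ D)) ?_).trans (by exact_mod_cast hcard)
  intro x hx
  simp only [mem_insert, mem_union, not_or] at hx
  rw [swapOn_of_notMem hx.2.1, swapOn_of_notMem hx.2.2, hst x hx.1]

lemma card_bound_of_flip (hh : HammingLip L h) (hτ : InLists L τ)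
    (he : flipP (nbrSize G L σ v a c u) ≠ 0) :
    |h (swapOn a c (offCluster G σ v a c u) τ) - h τ| ≤ nbrSize G L σ v a c u := by
  obtain ⟨h1, h2⟩ := nbrSize_flippable he
  rw [← h2]
  have hs := hτ.swap h1
  exact abs_sub_le_iff.2 ⟨hh _ _ hs hτ _ fun x hx => swapOn_of_notMem hx,
    hh _ _ hτ hs _ fun x hx => (swapOn_of_notMem hx).symm⟩

lemma touching_eq_empty (hN : colorNbrs G σ v c = ∅) : touching G σ v a b c = ∅ := by
  unfold touching
  rw [filter_eq_empty_iff]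
  rintro S - ⟨w, -, hw⟩
  have := mem_colorNbrs.2 hw
  simp [hN] at this

lemma bigCluster_eq_singleton (hN : colorNbrs G σ v c = ∅) : bigCluster G σ v a c = {v} := by
  simp [bigCluster, touching_eq_empty hN]

lemma freeColorDrift_le (hh : HammingLip L h) (hσ : InLists L σ) (hτ : InLists L τ)
    (hst : AgreeOff v σ τ) (hσv : σ v = a) (hτv : τ v = b) (hca : c ≠ a) (hcb : c ≠ b)  :
    ∃ w : ℝ, 0 ≤ w ∧ w ≤ 3000 * ((if c ∈ L v then 1 else 0) + (colorNbrs G σ v c).card) ∧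
      freeColorDrift G L h σ τ v a b c ≤ ∑ u ∈ colorNbrs G σ v c, nbrWeight G L σ v a b u -
        (if c ∈ L v then 3000 else 0) + w * (1 - (h σ - h τ)) := by
  have haL : a ∈ L v := hσv ▸ hσ v
  have hbL : b ∈ L v := hτv ▸ hτ v
  have hN := colorNbrs_congr (G := G) (c := c) hst
  rcases (colorNbrs G σ v c).eq_empty_or_nonempty with h0 | ⟨u0, hu0⟩
  · refine ⟨if c ∈ L v then 3000 else 0, by split_ifs <;> norm_num, ?_, ?_⟩
    · rw [h0]; split_ifs <;> simp
    · have h0' : colorNbrs G τ v c = ∅ := hN ▸ h0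
      unfold freeColorDrift
      rw [flipRate_bigCluster haL, flipRate_bigCluster hbL, touching_eq_empty h0,
        touching_eq_empty h0', bigCluster_eq_singleton h0, bigCluster_eq_singleton h0', h0, h0']
      have : swapOn a c {v} σ = swapOn b c {v} τ := by
        ext x
        by_cases hx : x = v
        · subst hx
          rw [swapOn_of_mem (by simp), swapOn_of_mem (by simp), hσv, hτv]
          simp
        · rw [swapOn_of_notMem (by simp [hx]), swapOn_of_notMem (by simp [hx]), hst x hx]
      rw [this]
      simp only [sum_empty, add_zero, sub_zero]
      split_ifs
      · simp only [flipP]; push_cast; linarith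
      · simp
  · set e : V → ℕ := nbrSize G L σ v a c with he
    set g : V → ℕ := nbrSize G L τ v b c with hg
    obtain ⟨i, hi, hei, him⟩ := exists_nbrSize_pos (L := L) (a := a) hu0
    obtain ⟨j, hj, hgj, hjm⟩ := exists_nbrSize_pos (L := L) (a := b) (hN ▸ hu0)
    rw [← hN] at hj hjm
    set N := colorNbrs G σ v c with hNdef
    set α : ℝ := flipRate L a c (bigCluster G σ v a c) with hα
    set β : ℝ := flipRate L b c (bigCluster G τ v b c) with hβ
    have hα' := flipRate_bigCluster (G := G) (σ := σ) (c := c) haL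
    have hβ' := flipRate_bigCluster (G := G) (σ := τ) (c := c) hbL
    rw [← hN] at hβ'
    rw [← hα, ← hNdef, ← he] at hα'
    rw [← hβ, ← hg] at hβ'
    have hsumi : e i ≤ ∑ u ∈ N, e u := single_le_sum (f := e) (fun _ _ => Nat.zero_le _) hi
    have hsumj : g j ≤ ∑ u ∈ N, g u := single_le_sum (f := g) (fun _ _ => Nat.zero_le _) hj
    have hαi : α ≤ flipP (e i) := by
      rw [hα']; split_ifs
      · exact_mod_cast flipP_anti hei (hsumi.trans (Nat.le_add_left _ _))
      · positivity
    have hβj : β ≤ flipP (g j) := by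
      rw [hβ']; split_ifs
      · exact_mod_cast flipP_anti hgj (hsumj.trans (Nat.le_add_left _ _))
      · positivity
    obtain ⟨w, hw0, hw1, hw⟩ := class_move_le (N := N) (e := e) (g := g) (i := i) (j := j)
      hi hj (α := α) (β := β) (δ := h σ - h τ)
      (X := h (swapOn a c (bigCluster G σ v a c) σ) - h σ)
      (Y := h (swapOn b c (bigCluster G τ v b c) τ) - h τ)
      (x := fun u => h (swapOn a c (offCluster G σ v a c u) τ) - h τ)
      (y := fun u => h (swapOn b c (offCluster G τ v b c u) σ) - h σ)
      flipRate_nonneg flipRate_nonneg hαi hβj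
      (fun u _ hne => by
        have := (abs_sub_le_iff.1 (card_bound_of_flip hh hτ hne)).2
        linarith)
      (fun u _ hne => (abs_sub_le_iff.1 (card_bound_of_flip hh hσ hne)).1)
      (fun u _ hne hne' => by
        have := piece_move_bound hh hσ hτ hst hne hne'
        linarith)
      (by
        rcases eq_or_ne α 0 with h0 | h0
        · rw [h0]; simp
        · refine mul_le_mul_of_nonneg_left ?_ flipRate_nonneg
          have := (big_move_bound hh hσ hτ hst hi hei h0).1
          linarith)
      (by
        rcases eq_or_ne β 0 with h0 | h0
        · rw [h0]; simp
        · refine mul_le_mul_of_nonneg_left ?_ flipRate_nonneg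
          have := (big_move_bound hh hτ hσ hst.symm (hN ▸ hj) hgj h0).2
          rw [← hN] at this
          linarith)
    refine ⟨w, hw0, hw1.trans ?_, ?_⟩
    · have : β ≤ 3000 * (if c ∈ L v then 1 else 0) := by
        rw [hβ']
        split_ifs
        · have : (flipP (1 + ∑ u ∈ N, g u) : ℝ) ≤ 3000 := by exact_mod_cast flipP_le _
          linarith
        · simp
      linarith
    · unfold freeColorDrift
      rw [rate_sum_touching, rate_sum_touching, ← hN]
      refine hw.trans (add_le_add ?_ le_rfl)
      have hwt : ∑ u ∈ N, (pairWeight (e u) (g u) : ℝ) ≤ ∑ u ∈ N, nbrWeight G L σ v a b u :=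
        sum_le_sum fun u hu => pairWeight_le_nbrWeight hst hu hca hcb
      by_cases hc : c ∈ L v
      · rw [if_pos hc] at hα' hβ' ⊢
        rw [hα', hβ']
        have := classCost_le (N := N) (e := e) (g := g) (fun _ _ => nbrSize_le)
          (fun _ _ => nbrSize_le) hi hj hei hgj him hjm
        linarith
      · rw [if_neg hc] at hα' hβ' ⊢
        rw [hα', hβ']
        have := classCost_zero_le (N := N) (e := e) (g := g) (i := i) (j := j)
          (fun _ _ => nbrSize_le) (fun _ _ => nbrSize_le)
        linarith

end FreeColors

section SpecialPair

variable {V : Type*} [Fintype V] {q : ℕ} {G : SimpleGraph V} {L : V → Finset (Fin q)}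
  {W : Finset V} {σ τ : V → Fin q} {a b c : Fin q} {S T : Finset V} {x y u v : V}
  {h : (V → Fin q) → ℝ}

/-- The uncoupled part of the drift for the pair `{σ v, τ v}` that belongs to the cluster of `v`
in `σ`. -/
noncomputable def sideDrift (G : SimpleGraph V) (L : V → Finset (Fin q))
    (h : (V → Fin q) → ℝ) (σ τ : V → Fin q) (v : V) (a b : Fin q) : ℝ :=
  flipRate L a b (bigCluster G σ v a b) * (h (swapOn a b (bigCluster G σ v a b) σ) - h σ) -
    ∑ S ∈ touching G σ v a b b \ touching G σ v a b a, flipRate L a b S * (h (swapOn a b S τ) - h τ)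

lemma card_touching_le : (touching G σ v a c c).card ≤ (colorNbrs G σ v c).card := by
  have h1 := sum_touching (G := G) (σ := σ) (v := v) (a := a) (c := c) (fun _ => 1)
  simp only [sum_const, nsmul_eq_mul, mul_one] at h1
  have h2 : ∑ u ∈ colorNbrs G σ v c, (if nbrRep G σ v c (offCluster G σ v a c u) = u then (1 : ℝ)
      else 0) ≤ ∑ u ∈ colorNbrs G σ v c, 1 := sum_le_sum fun u _ => by split_ifs <;> norm_num
  rw [← h1, sum_const, nsmul_eq_mul, mul_one] at h2
  exact_mod_cast h2

lemma swapOn_bigCluster_apply_self (hσv : σ v = a) :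
    swapOn a b (bigCluster G σ v a b) σ v = b := by
  rw [swapOn_of_mem self_mem_bigCluster, hσv, Equiv.swap_apply_left]

lemma big_uncoupled_le (hh : HammingLip L h) (hσ : InLists L σ) (hτ : InLists L τ)
    (hst : AgreeOff v σ τ) (hσv : σ v = a) (hτv : τ v = b) :
    flipRate L a b (bigCluster G σ v a b) * (h (swapOn a b (bigCluster G σ v a b) σ) - h σ) ≤
      flipRate L a b (bigCluster G σ v a b) *
        ((bigCluster G σ v a b).card - 1 - (h σ - h τ)) := by
  rcases eq_or_ne (flipRate L a b (bigCluster G σ v a b)) 0 with h0 | h0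
  · simp [h0]
  · refine mul_le_mul_of_nonneg_left ?_ flipRate_nonneg
    have h1 := hh _ _ (hσ.swap_of_rate h0) hτ ((bigCluster G σ v a b).erase v) (by
      intro x hx
      by_cases hxv : x = v
      · subst hxv; rw [swapOn_bigCluster_apply_self hσv, hτv]
      · rw [swapOn_of_notMem (fun hxA => hx (mem_erase.2 ⟨hxv, hxA⟩)), hst x hxv])
    rw [card_erase_of_mem self_mem_bigCluster, Nat.cast_sub
      (card_pos.2 ⟨v, self_mem_bigCluster⟩)] at h1
    push_cast at h1
    linarith

lemma neg_flip_le (hh : HammingLip L h) (hτ : InLists L τ) :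
    -(flipRate L a b S * (h (swapOn a b S τ) - h τ)) ≤ flipRate L a b S * S.card := by
  have h1 := flipRate_mul_abs_le (S := S) (a := a) (b := b) hh hτ
  have h2 := mul_le_mul_of_nonneg_left (neg_le_abs (h (swapOn a b S τ) - h τ))
    (flipRate_nonneg (L := L) (a := a) (b := b) (S := S))
  linarith

lemma one_step_cost (k : ℕ) : ((flipP k : ℝ) - flipP (1 + k)) * k - flipP (1 + k) ≤ 2200 := by
  by_cases hk : 7 ≤ k
  · rw [flipP_of_ge hk, flipP_of_ge (by omega)]; norm_num
  · interval_cases k <;> norm_num [flipP]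

lemma flippable_bigCluster_iff (ha : a ∈ L v) (hb : b ∈ L v)
    (hS : touching G σ v a b b = {S}) :
    Flippable L a b (bigCluster G σ v a b) ↔ Flippable L a b S := by
  have : bigCluster G σ v a b = insert v S := by simp [bigCluster, hS]
  rw [this]
  constructor
  · intro hf x hx; exact hf x (mem_insert_of_mem hx)
  · intro hf x hx
    rcases mem_insert.1 hx with rfl | hx
    · exact ⟨ha, hb⟩
    · exact hf x hx

lemma sideDrift_le (hh : HammingLip L h) (hσ : InLists L σ) (hτ : InLists L τ)
    (hst : AgreeOff v σ τ) (hσv : σ v = a) (hτv : τ v = b) :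
    ∃ w : ℝ, 0 ≤ w ∧ w ≤ 3000 ∧
      sideDrift G L h σ τ v a b ≤ 5200 * (colorNbrs G σ v b).card - 3000 +
        w * (1 - (h σ - h τ)) := by
  have haL : a ∈ L v := hσv ▸ hσ v
  have hbL : b ∈ L v := hτv ▸ hτ v
  rcases (colorNbrs G σ v b).eq_empty_or_nonempty with h0 | ⟨u0, hu0⟩
  · refine ⟨3000, by norm_num, le_rfl, ?_⟩
    unfold sideDrift
    rw [bigCluster_eq_singleton h0, touching_eq_empty h0, h0]
    have h1 : swapOn a b {v} σ = τ := by
      ext x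
      by_cases hx : x = v
      · subst hx; rw [swapOn_of_mem (by simp), hσv, Equiv.swap_apply_left, hτv]
      · rw [swapOn_of_notMem (by simp [hx]), hst x hx]
    have h2 : flipRate L a b {v} = 3000 := by
      unfold flipRate
      rw [if_pos (by intro x hx; rw [mem_singleton.1 hx]; exact ⟨haL, hbL⟩)]
      simp [flipP]
    rw [h1, h2]
    simp
    linarith
  set A := bigCluster G σ v a b with hA
  have hα0 : 0 ≤ flipRate L a b A := flipRate_nonneg
  have hcard2 : 2 ≤ A.card := by
    rw [hA, card_bigCluster]
    have h1 := offCluster_mem (a := a) hu0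
    have h2 : 1 ≤ (offCluster G σ v a b u0).card := card_pos.2 ⟨u0, self_mem_offCluster⟩
    have h3 := single_le_sum (f := fun S : Finset V => S.card) (fun _ _ => Nat.zero_le _) h1
    omega
  have hunc := big_uncoupled_le hh hσ hτ hst hσv hτv (G := G)
  rw [← hA] at hunc
  have h576 := flipRate_mul_card_sub_le (L := L) (a := a) (b := b) hcard2
  have hm1 : 1 ≤ (colorNbrs G σ v b).card := card_pos.2 ⟨u0, hu0⟩
  by_cases hm2 : 2 ≤ (colorNbrs G σ v b).card
  · refine ⟨flipRate L a b A, hα0, flipRate_le, ?_⟩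
    unfold sideDrift
    have hsum : -∑ S ∈ touching G σ v a b b \ touching G σ v a b a,
        flipRate L a b S * (h (swapOn a b S τ) - h τ) ≤ 3000 * (colorNbrs G σ v b).card := by
      rw [← sum_neg_distrib]
      refine (sum_le_sum fun S _ => (neg_flip_le hh hτ).trans flipRate_mul_card_le).trans ?_
      rw [sum_const, nsmul_eq_mul, mul_comm]
      have : (touching G σ v a b b \ touching G σ v a b a).card ≤ (colorNbrs G σ v b).card :=
        (card_le_card sdiff_subset).trans card_touching_le
      have : ((touching G σ v a b b \ touching G σ v a b a).card : ℝ) ≤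
        (colorNbrs G σ v b).card := by exact_mod_cast this
      linarith
    have hm2' : (2 : ℝ) ≤ (colorNbrs G σ v b).card := by exact_mod_cast hm2
    rw [← hA]
    linarith
  · have hm : (colorNbrs G σ v b).card = 1 := by omega
    have hT1 : (touching G σ v a b b).card = 1 := by
      have h1 := card_touching_le (G := G) (σ := σ) (v := v) (a := a) (c := b)
      have h2 : 1 ≤ (touching G σ v a b b).card := card_pos.2 ⟨_, offCluster_mem hu0⟩
      omega
    obtain ⟨C, hC⟩ := card_eq_one.1 hT1
    have hCm : C ∈ touching G σ v a b b := by rw [hC]; simp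
    refine ⟨flipRate L a b A, hα0, flipRate_le, ?_⟩
    unfold sideDrift
    rw [← hA, hm]
    by_cases hCa : C ∈ touching G σ v a b a
    · have : touching G σ v a b b \ touching G σ v a b a = ∅ := by
        rw [hC]; simpa using hCa
      rw [this, sum_empty]
      push_cast
      linarith
    · have : touching G σ v a b b \ touching G σ v a b a = {C} := by
        rw [hC]; exact sdiff_eq_self_of_disjoint (by simpa using hCa)
      rw [this, sum_singleton]
      have hiff := flippable_bigCluster_iff haL hbL hC
      rw [← hA] at hiff
      by_cases hf : Flippable L a b C
      · have hAC : A = insert v C := by rw [hA, bigCluster, hC]; simp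
        have hAcard : A.card = 1 + C.card := by
          rw [hAC, card_insert_of_notMem (notMem_of_touching hCm), add_comm]
        have hsw : swapOn a b A σ = swapOn a b C τ := by
          ext x
          by_cases hx : x = v
          · subst hx
            rw [hA, swapOn_bigCluster_apply_self hσv, swapOn_of_notMem (notMem_of_touching hCm),
              hτv]
          · by_cases hxC : x ∈ C
            · rw [swapOn_of_mem hxC, swapOn_of_mem (by rw [hAC]; simp [hxC]), hst x hx]
            · rw [swapOn_of_notMem hxC, swapOn_of_notMem (by rw [hAC]; simp [hxC, hx]), hst x hx]
        have hrA : flipRate L a b A = flipP (1 + C.card) := by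
          unfold flipRate; rw [if_pos (hiff.2 hf), hAcard]
        have hrC : flipRate L a b C = flipP C.card := by unfold flipRate; rw [if_pos hf]
        have hCpos : 1 ≤ C.card := card_pos.2 (clusters_nonempty (mem_filter.1 hCm).1)
        have hle : (flipP (1 + C.card) : ℝ) ≤ flipP C.card := by
          exact_mod_cast flipP_anti hCpos (by omega)
        have hLip := hh _ _ hτ (hτ.swap hf) C fun x hx => (swapOn_of_notMem hx).symm
        have h1 := one_step_cost C.card
        rw [hsw, hrA, hrC]
        push_cast
        nlinarith [mul_le_mul_of_nonneg_left hLip (sub_nonneg.2 hle)]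
      · have hrC : flipRate L a b C = 0 := by unfold flipRate; rw [if_neg hf]
        have hrA : flipRate L a b A = 0 := by unfold flipRate; rw [if_neg (fun h => hf (hiff.1 h))]
        rw [hrA, hrC]
        norm_num

end SpecialPair

section Drift

variable {V : Type*} [Fintype V] {q : ℕ} {G : SimpleGraph V} {L : V → Finset (Fin q)}
  {W : Finset V} {σ τ : V → Fin q} {a b c : Fin q} {S T : Finset V} {x y u v : V}
  {h : (V → Fin q) → ℝ}

/-- The contribution of one pair of colors to the generator of the flip dynamics. -/
noncomputable def pairGen (G : SimpleGraph V) (L : V → Finset (Fin q)) (h : (V → Fin q) → ℝ)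
    (σ : V → Fin q) (a b : Fin q) : ℝ :=
  ∑ S ∈ clusters G univ σ a b, flipRate L a b S * (h (swapOn a b S σ) - h σ)

/-- The generator of the flip dynamics. -/
noncomputable def flipGen (G : SimpleGraph V) (L : V → Finset (Fin q)) (h : (V → Fin q) → ℝ)
    (σ : V → Fin q) : ℝ :=
  ∑ a, ∑ b, if a = b then 0 else pairGen G L h σ a b

/-- Clusters avoiding `v` that `σ` and `τ` share. -/
noncomputable def commonClusters (G : SimpleGraph V) (σ τ : V → Fin q) (v : V) (a b : Fin q) :
    Finset (Finset V) :=
  (clusters G univ σ a b ∩ clusters G univ τ a b).filter fun S => v ∉ S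

/-- The part of the drift coming from identical moves. -/
noncomputable def commonDrift (G : SimpleGraph V) (L : V → Finset (Fin q))
    (h : (V → Fin q) → ℝ) (σ τ : V → Fin q) (v : V) (a b : Fin q) : ℝ :=
  ∑ S ∈ commonClusters G σ τ v a b,
    flipRate L a b S * ((h (swapOn a b S σ) - h (swapOn a b S τ)) - (h σ - h τ))

/-- The remaining part of the drift. -/
noncomputable def specDrift (G : SimpleGraph V) (L : V → Finset (Fin q))
    (h : (V → Fin q) → ℝ) (σ τ : V → Fin q) (v : V) (a b : Fin q) : ℝ :=
  pairGen G L h σ a b - pairGen G L h τ a b - commonDrift G L h σ τ v a b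

lemma pairGen_comm : pairGen G L h σ a b = pairGen G L h σ b a := by
  unfold pairGen
  rw [clusters_comm]
  exact sum_congr rfl fun S _ => by rw [flipRate_comm, swapOn_comm]

lemma commonDrift_comm : commonDrift G L h σ τ v a b = commonDrift G L h σ τ v b a := by
  unfold commonDrift commonClusters
  rw [clusters_comm, clusters_comm (σ := τ)]
  exact sum_congr rfl fun S _ => by rw [flipRate_comm, swapOn_comm, swapOn_comm (σ := τ)]

lemma specDrift_comm : specDrift G L h σ τ v a b = specDrift G L h σ τ v b a := by
  unfold specDrift
  rw [pairGen_comm, pairGen_comm (σ := τ), commonDrift_comm]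

lemma specDrift_antisymm : specDrift G L h σ τ v a b = -specDrift G L h τ σ v a b := by
  unfold specDrift commonDrift commonClusters
  rw [inter_comm]
  have : ∀ s : Finset (Finset V), ∑ S ∈ s,
      flipRate L a b S * (h (swapOn a b S σ) - h (swapOn a b S τ) - (h σ - h τ)) =
      -∑ S ∈ s, flipRate L a b S * (h (swapOn a b S τ) - h (swapOn a b S σ) - (h τ - h σ)) := by
    intro s
    rw [← sum_neg_distrib]
    exact sum_congr rfl fun S _ => by ring
  rw [this]
  ring

lemma bigCluster_notMem {s : Finset (Finset V)} :
    bigCluster G σ v a b ∉ clusters G (univ.erase v) σ a b \ s :=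
  fun h => bigCluster_not_mem (mem_sdiff.1 h).1

lemma touching_subset : touching G σ v a b c ⊆ clusters G (univ.erase v) σ a b :=
  filter_subset _ _

lemma specDrift_eq_zero (hst : AgreeOff v σ τ) (h1 : ¬ (σ v = a ∨ σ v = b))
    (h2 : ¬ (τ v = a ∨ τ v = b)) : specDrift G L h σ τ v a b = 0 := by
  unfold specDrift commonDrift commonClusters pairGen
  rw [clusters_erase_of_not h1, clusters_erase_of_not h2, ← clusters_erase_congr hst, inter_self,
    filter_true_of_mem fun S hS => not_mem_of_mem_clusters_erase hS, ← sum_sub_distrib,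
    ← sum_sub_distrib]
  exact sum_eq_zero fun S _ => by ring

lemma specDrift_eq_half (hst : AgreeOff v σ τ) (hσv : σ v = a) (hac : a ≠ c)
    (h2 : ¬ (τ v = a ∨ τ v = c)) : specDrift G L h σ τ v a c =
      flipRate L a c (bigCluster G σ v a c) * (h (swapOn a c (bigCluster G σ v a c) σ) - h σ) -
      ∑ S ∈ touching G σ v a c c, flipRate L a c S * (h (swapOn a c S τ) - h τ) := by
  unfold specDrift commonDrift commonClusters pairGen
  rw [clusters_erase_of_not h2, ← clusters_erase_congr hst, clusters_eq_insert hσv hac]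
  have hcom : ((insert (bigCluster G σ v a c) (clusters G (univ.erase v) σ a c \
      touching G σ v a c c)) ∩ clusters G (univ.erase v) σ a c).filter (fun S => v ∉ S) =
      clusters G (univ.erase v) σ a c \ touching G σ v a c c := by
    ext S
    simp only [mem_filter, mem_inter, mem_insert, mem_sdiff]
    constructor
    · rintro ⟨⟨h3 | h3, h4⟩, h5⟩
      · rw [h3] at h4; exact absurd h4 bigCluster_not_mem
      · exact h3
    · rintro h3
      exact ⟨⟨Or.inr h3, h3.1⟩, not_mem_of_mem_clusters_erase h3.1⟩
  rw [hcom, sum_insert bigCluster_notMem, ← sum_sdiff (touching_subset (G := G) (σ := σ) (v := v)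
    (a := a) (b := c) (c := c))]
  have : ∑ S ∈ clusters G (univ.erase v) σ a c \ touching G σ v a c c,
      flipRate L a c S * (h (swapOn a c S σ) - h (swapOn a c S τ) - (h σ - h τ)) =
      ∑ S ∈ clusters G (univ.erase v) σ a c \ touching G σ v a c c,
        flipRate L a c S * (h (swapOn a c S σ) - h σ) -
      ∑ S ∈ clusters G (univ.erase v) σ a c \ touching G σ v a c c,
        flipRate L a c S * (h (swapOn a c S τ) - h τ) := by
    rw [← sum_sub_distrib]
    exact sum_congr rfl fun S _ => by ring
  rw [this]
  ring

lemma specDrift_free (hst : AgreeOff v σ τ) (hσv : σ v = a) (hτv : τ v = b) (hab : a ≠ b)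
    (hca : c ≠ a) (hcb : c ≠ b) :
    specDrift G L h σ τ v a c + specDrift G L h σ τ v b c = freeColorDrift G L h σ τ v a b c := by
  rw [specDrift_eq_half hst hσv hca.symm (by rw [hτv]; tauto), specDrift_antisymm (a := b),
    specDrift_eq_half hst.symm hτv hcb.symm (by rw [hσv]; tauto)]
  unfold freeColorDrift
  ring

lemma specDrift_special (hst : AgreeOff v σ τ) (hσv : σ v = a) (hτv : τ v = b) (hab : a ≠ b) :
    specDrift G L h σ τ v a b = sideDrift G L h σ τ v a b + sideDrift G L (-h) τ σ v b a := by
  have hB : clusters G univ τ a b = insert (bigCluster G τ v b a)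
      (clusters G (univ.erase v) σ a b \ touching G σ v a b a) := by
    rw [clusters_comm, clusters_eq_insert hτv hab.symm, ← clusters_erase_congr hst, clusters_comm,
      ← touching_congr hst]
    congr 2
    unfold touching
    rw [clusters_comm]
  have hAB : ∀ s : Finset (Finset V), ((insert (bigCluster G σ v a b) (clusters G (univ.erase v) σ a b \
      touching G σ v a b b)) ∩ (insert (bigCluster G τ v b a)
      (clusters G (univ.erase v) σ a b \ touching G σ v a b a))).filter (fun S => v ∉ S) =
      (clusters G (univ.erase v) σ a b \ touching G σ v a b b) \ touching G σ v a b a := by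
    intro _
    ext S
    simp only [mem_filter, mem_inter, mem_insert, mem_sdiff]
    constructor
    · rintro ⟨⟨h3 | h3, h4 | h4⟩, h5⟩
      · rw [h3] at h5; exact absurd self_mem_bigCluster h5
      · rw [h3] at h5; exact absurd self_mem_bigCluster h5
      · rw [h4] at h5; exact absurd self_mem_bigCluster h5
      · exact ⟨h3, h4.2⟩
    · rintro h3
      exact ⟨⟨Or.inr h3.1, Or.inr ⟨h3.1.1, h3.2⟩⟩, not_mem_of_mem_clusters_erase h3.1.1⟩
  have hBm : bigCluster G τ v b a ∉ clusters G (univ.erase v) σ a b \ touching G σ v a b a :=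
    fun h => not_mem_of_mem_clusters_erase (mem_sdiff.1 h).1 self_mem_bigCluster
  have ht : touching G τ v b a a \ touching G τ v b a b =
      touching G σ v a b a \ touching G σ v a b b := by
    rw [← touching_congr hst, ← touching_congr hst]
    unfold touching
    rw [clusters_comm]
  have key : ∀ (B P Q : Finset (Finset V)) (hP : P ⊆ B) (hQ : Q ⊆ B) (f : Finset V → ℝ),
      ∑ S ∈ B \ P, f S = ∑ S ∈ (B \ P) \ Q, f S + ∑ S ∈ Q \ P, f S := by
    intro B P Q hP hQ f
    rw [← sum_union]
    · congr 1
      ext S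
      simp only [mem_sdiff, mem_union]
      constructor
      · rintro ⟨h1, h2⟩
        by_cases h3 : S ∈ Q <;> tauto
      · rintro (h1 | h1)
        · exact h1.1
        · exact ⟨hQ h1.1, h1.2⟩
    · rw [disjoint_left]
      intro S h1 h2
      exact (mem_sdiff.1 h1).2 (mem_sdiff.1 h2).1
  unfold specDrift commonDrift commonClusters pairGen
  rw [hB, clusters_eq_insert hσv hab, hAB ∅, sum_insert bigCluster_notMem, sum_insert hBm,
    key _ _ _ touching_subset (touching_subset (c := a)),
    key _ _ _ (touching_subset (c := a)) (touching_subset (c := b)), sdiff_right_comm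
      (clusters G (univ.erase v) σ a b) (touching G σ v a b a)]
  have : ∀ s : Finset (Finset V), ∑ S ∈ s,
      flipRate L a b S * (h (swapOn a b S σ) - h (swapOn a b S τ) - (h σ - h τ)) =
      ∑ S ∈ s, flipRate L a b S * (h (swapOn a b S σ) - h σ) -
      ∑ S ∈ s, flipRate L a b S * (h (swapOn a b S τ) - h τ) := by
    intro s
    rw [← sum_sub_distrib]
    exact sum_congr rfl fun S _ => by ring
  rw [this]
  unfold sideDrift
  rw [ht]
  have e1 : ∑ S ∈ touching G σ v a b a \ touching G σ v a b b, flipRate L b a S *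
      ((-h) (swapOn b a S σ) - (-h) σ) = -∑ S ∈ touching G σ v a b a \ touching G σ v a b b,
        flipRate L a b S * (h (swapOn a b S σ) - h σ) := by
    rw [← sum_neg_distrib]
    refine sum_congr rfl fun S _ => ?_
    rw [flipRate_comm, swapOn_comm]
    simp only [Pi.neg_apply]
    ring
  rw [e1, flipRate_comm (a := b), swapOn_comm (a := b)]
  simp only [Pi.neg_apply]
  ring

end Drift

section TotalDrift

variable {V : Type*} [Fintype V] {q : ℕ} {G : SimpleGraph V} {L : V → Finset (Fin q)}
  {W : Finset V} {σ τ : V → Fin q} {a b c : Fin q} {S T : Finset V} {x y u v : V}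
  {h : (V → Fin q) → ℝ}

/-- The colors other than `a` and `b`. -/
noncomputable def otherColors (a b : Fin q) : Finset (Fin q) := univ.filter fun c => c ≠ a ∧ c ≠ b

lemma mem_otherColors : c ∈ otherColors a b ↔ c ≠ a ∧ c ≠ b := by simp [otherColors]

lemma sum_split_colors (hab : a ≠ b) (g : Fin q → ℝ) :
    ∑ c, g c = g a + g b + ∑ c ∈ otherColors a b, g c := by
  have h1 : otherColors a b = (univ.erase a).erase b := by
    ext c; simp only [mem_otherColors, mem_erase, mem_univ, and_true]; tauto
  rw [h1, ← add_sum_erase univ g (mem_univ a), ← add_sum_erase (univ.erase a) g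
    (mem_erase.2 ⟨hab.symm, mem_univ b⟩)]
  ring

lemma sum_pairs_of_symm (hab : a ≠ b) {F : Fin q → Fin q → ℝ} (hs : ∀ x y, F x y = F y x)
    (h0 : ∀ x ∈ otherColors a b, ∀ y ∈ otherColors a b, F x y = 0) :
    ∑ x, ∑ y, (if x = y then 0 else F x y) =
      2 * F a b + 2 * ∑ c ∈ otherColors a b, (F a c + F b c) := by
  have h1 : ∀ c ∈ otherColors a b, ∑ y, (if c = y then 0 else F c y) = F a c + F b c := by
    intro c hc
    have hc' := mem_otherColors.1 hc
    rw [sum_split_colors hab, if_neg hc'.1, if_neg hc'.2,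
      sum_eq_zero (s := otherColors a b) fun y hy => by rw [h0 c hc y hy]; simp, hs c a, hs c b,
      add_zero]
  rw [sum_split_colors hab, sum_congr rfl h1, sum_split_colors hab, if_pos rfl, if_neg hab,
    sum_split_colors (a := a) (b := b) hab, if_pos rfl, if_neg hab.symm, hs b a, sum_add_distrib,
    sum_congr rfl fun c hc => if_neg (mem_otherColors.1 hc).1.symm,
    sum_congr (g := fun c => F b c) rfl fun c hc => if_neg (mem_otherColors.1 hc).2.symm]
  ring

/-- The neighbourhood of `v`. -/
noncomputable def nbrs (G : SimpleGraph V) (v : V) : Finset V := univ.filter fun u => G.Adj v u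

lemma mem_nbrs : u ∈ nbrs G v ↔ G.Adj v u := by simp [nbrs]

lemma sum_colorNbrs (f : V → ℝ) : ∑ c, ∑ u ∈ colorNbrs G σ v c, f u = ∑ u ∈ nbrs G v, f u := by
  rw [← sum_fiberwise (nbrs G v) σ]
  refine sum_congr rfl fun c _ => sum_congr ?_ fun _ _ => rfl
  ext u; simp [mem_colorNbrs, mem_nbrs]

/-- The neighbours of `v` without blockers. -/
noncomputable def goodNbrs (G : SimpleGraph V) (σ : V → Fin q) (v : V) (a b : Fin q) : Finset V :=
  (nbrs G v).filter fun u => blockers G σ v a b u = ∅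

/-- The neighbours of `v` with a single unfrozen blocker. -/
noncomputable def oneNbrs (G : SimpleGraph V) (L : V → Finset (Fin q)) (σ : V → Fin q) (v : V)
    (a b : Fin q) : Finset V := (nbrs G v).filter fun u => OneBlocker G L σ v a b u

lemma OneBlocker.ne_empty (h : OneBlocker G L σ v a b u) : blockers G σ v a b u ≠ ∅ := by
  obtain ⟨w, hw, -⟩ := h
  rw [hw]; exact singleton_ne_empty w

lemma sum_nbrWeight : ∑ u ∈ nbrs G v, nbrWeight G L σ v a b u = 5497 * (nbrs G v).card -
    297 * (goodNbrs G σ v a b).card + 8 * (oneNbrs G L σ v a b).card := by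
  have h1 : ∀ u, nbrWeight G L σ v a b u = 5497 - 297 * (if blockers G σ v a b u = ∅ then 1 else 0)
      + 8 * (if OneBlocker G L σ v a b u then 1 else 0) := by
    intro u
    unfold nbrWeight
    by_cases h1 : blockers G σ v a b u = ∅
    · have : ¬ OneBlocker G L σ v a b u := fun h => h.ne_empty h1
      simp [h1, this]; norm_num
    · by_cases h2 : OneBlocker G L σ v a b u
      · simp [h1, h2]; norm_num
      · simp [h1, h2]
  simp only [h1, sum_add_distrib, sum_sub_distrib, ← mul_sum, sum_boole, goodNbrs, oneNbrs,
    sum_const, nsmul_eq_mul]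
  ring

lemma le_nbrWeight : 5200 ≤ nbrWeight G L σ v a b u := by
  unfold nbrWeight; split_ifs <;> norm_num

lemma card_colorNbrs_le_sum :
    5200 * ((colorNbrs G σ v c).card : ℝ) ≤ ∑ u ∈ colorNbrs G σ v c, nbrWeight G L σ v a b u := by
  rw [mul_comm, ← nsmul_eq_mul, ← sum_const]
  exact sum_le_sum fun _ _ => le_nbrWeight

lemma HammingLip.neg (hh : HammingLip L h) : HammingLip L (-h) := fun σ τ hσ hτ S hS => by
  have := hh τ σ hτ hσ S fun x hx => (hS x hx).symm
  simp only [Pi.neg_apply]; linarith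

lemma sum_specDrift_le (hh : HammingLip L h) (hσ : InLists L σ) (hτ : InLists L τ)
    (hst : AgreeOff v σ τ) (hne : σ v ≠ τ v) :
    ∃ w : ℝ, 0 ≤ w ∧ w ≤ 6000 * ((L v).card + (nbrs G v).card) ∧
      ∑ x, ∑ y, (if x = y then 0 else specDrift G L h σ τ v x y) ≤
        2 * (5497 * (nbrs G v).card - 297 * (goodNbrs G σ v (σ v) (τ v)).card +
          8 * (oneNbrs G L σ v (σ v) (τ v)).card - 3000 * (L v).card) +
        w * (1 - (h σ - h τ)) := by
  obtain ⟨a, ha⟩ : ∃ a, σ v = a := ⟨_, rfl⟩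
  obtain ⟨b, hb⟩ : ∃ b, τ v = b := ⟨_, rfl⟩
  rw [ha, hb] at hne ⊢
  have haL : a ∈ L v := ha ▸ hσ v
  have hbL : b ∈ L v := hb ▸ hτ v
  rw [sum_pairs_of_symm hne (fun x y => specDrift_comm) (fun x hx y hy => by
    rw [mem_otherColors] at hx hy
    exact specDrift_eq_zero hst (by rw [ha]; tauto) (by rw [hb]; tauto)),
    sum_congr rfl (fun c hc => specDrift_free hst ha hb hne (mem_otherColors.1 hc).1
      (mem_otherColors.1 hc).2), specDrift_special hst ha hb hne]
  obtain ⟨w1, hw1, hw1', hd1⟩ := sideDrift_le (G := G) hh hσ hτ hst ha hb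
  obtain ⟨w2, hw2, hw2', hd2⟩ := sideDrift_le (G := G) hh.neg hτ hσ hst.symm hb ha
  have hf : ∀ c, ∃ w : ℝ, c ∈ otherColors a b → 0 ≤ w ∧
      w ≤ 3000 * ((if c ∈ L v then 1 else 0) + (colorNbrs G σ v c).card) ∧
      freeColorDrift G L h σ τ v a b c ≤ ∑ u ∈ colorNbrs G σ v c, nbrWeight G L σ v a b u -
        (if c ∈ L v then 3000 else 0) + w * (1 - (h σ - h τ)) := by
    intro c
    by_cases hc : c ∈ otherColors a b
    · obtain ⟨w, hw⟩ := freeColorDrift_le (G := G) hh hσ hτ hst ha hb (mem_otherColors.1 hc).1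
        (mem_otherColors.1 hc).2
      exact ⟨w, fun _ => hw⟩
    · exact ⟨0, fun h => absurd h hc⟩
  choose w hw using hf
  have hL : ((L v).card : ℝ) = 2 + ∑ c ∈ otherColors a b, if c ∈ L v then (1 : ℝ) else 0 := by
    have := sum_split_colors hne fun c => if c ∈ L v then (1 : ℝ) else 0
    rw [if_pos haL, if_pos hbL, sum_boole] at this
    simp only [filter_univ_mem] at this
    linarith
  have hN : ((nbrs G v).card : ℝ) = (colorNbrs G σ v a).card + (colorNbrs G σ v b).card +
      ∑ c ∈ otherColors a b, ((colorNbrs G σ v c).card : ℝ) := by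
    have := sum_split_colors hne fun c => ∑ u ∈ colorNbrs G σ v c, (1 : ℝ)
    rw [sum_colorNbrs] at this
    simpa using this
  have hS := sum_colorNbrs (G := G) (σ := σ) (v := v) (nbrWeight G L σ v a b)
  rw [sum_nbrWeight, sum_split_colors hne] at hS
  have ca := card_colorNbrs_le_sum (G := G) (L := L) (σ := σ) (v := v) (a := a) (b := b) (c := a)
  have cb := card_colorNbrs_le_sum (G := G) (L := L) (σ := σ) (v := v) (a := a) (b := b) (c := b)
  have hsum := sum_le_sum fun c (hc : c ∈ otherColors a b) => (hw c hc).2.2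
  rw [sum_add_distrib, sum_sub_distrib, ← sum_mul] at hsum
  have hwle := sum_le_sum fun c (hc : c ∈ otherColors a b) => (hw c hc).2.1
  rw [← mul_sum, sum_add_distrib] at hwle
  have hw0 := sum_nonneg fun c (hc : c ∈ otherColors a b) => (hw c hc).1
  have h3 : ∑ c ∈ otherColors a b, (if c ∈ L v then (3000 : ℝ) else 0) =
      3000 * ∑ c ∈ otherColors a b, if c ∈ L v then (1 : ℝ) else 0 := by
    rw [mul_sum]; exact sum_congr rfl fun c _ => by split_ifs <;> norm_num
  rw [h3] at hsum
  refine ⟨2 * (w1 + w2 + ∑ c ∈ otherColors a b, w c), by positivity, ?_, ?_⟩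
  · have : (0 : ℝ) ≤ (colorNbrs G σ v a).card + (colorNbrs G σ v b).card := by positivity
    linarith
  · have e : ((colorNbrs G τ v a).card : ℝ) = (colorNbrs G σ v a).card := by
      rw [colorNbrs_congr hst]
    rw [e] at hd2
    simp only [Pi.neg_apply] at hd2
    have e2 : 2 * (w1 + w2 + ∑ c ∈ otherColors a b, w c) * (1 - (h σ - h τ)) =
      2 * (w1 * (1 - (h σ - h τ))) + 2 * (w2 * (1 - (- h τ - - h σ))) +
        2 * ((∑ c ∈ otherColors a b, w c) * (1 - (h σ - h τ))) := by ring
    rw [e2]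
    linarith

end TotalDrift

section CommonMoves

variable {V : Type*} [Fintype V] {q : ℕ} {G : SimpleGraph V} {L : V → Finset (Fin q)}
  {W : Finset V} {σ τ : V → Fin q} {a b c : Fin q} {S T : Finset V} {x y u v w : V}
  {h : (V → Fin q) → ℝ} {m : Fin q × Fin q × Finset V}

/-- The moves shared by two colorings differing at `v`. -/
noncomputable def commonMoves (G : SimpleGraph V) (σ τ : V → Fin q) (v : V) :
    Finset (Fin q × Fin q × Finset V) :=
  univ.filter fun m => m.1 ≠ m.2.1 ∧ m.2.2 ∈ commonClusters G σ τ v m.1 m.2.1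

/-- The rate of a move. -/
noncomputable def moveRate (L : V → Finset (Fin q)) (m : Fin q × Fin q × Finset V) : ℝ :=
  flipRate L m.1 m.2.1 m.2.2

/-- The outcome of a move. -/
noncomputable def moveTo (m : Fin q × Fin q × Finset V) (σ : V → Fin q) : V → Fin q :=
  swapOn m.1 m.2.1 m.2.2 σ

lemma moveRate_nonneg : 0 ≤ moveRate L m := flipRate_nonneg

lemma mem_commonMoves : m ∈ commonMoves G σ τ v ↔
    m.1 ≠ m.2.1 ∧ m.2.2 ∈ clusters G univ σ m.1 m.2.1 ∧ m.2.2 ∈ clusters G univ τ m.1 m.2.1 ∧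
      v ∉ m.2.2 := by
  simp [commonMoves, commonClusters, and_assoc]

lemma sum_commonMoves (f : Fin q → Fin q → Finset V → ℝ) :
    ∑ m ∈ commonMoves G σ τ v, f m.1 m.2.1 m.2.2 =
      ∑ x, ∑ y, if x = y then 0 else ∑ S ∈ commonClusters G σ τ v x y, f x y S := by
  unfold commonMoves
  rw [sum_filter, Fintype.sum_prod_type]
  refine sum_congr rfl fun x _ => ?_
  rw [Fintype.sum_prod_type]
  refine sum_congr rfl fun y _ => ?_
  by_cases hxy : x = y
  · simp [hxy]
  · simp only [hxy, ne_eq, not_false_eq_true, true_and, if_false]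
    rw [← sum_filter]
    exact sum_congr (by ext S; simp) fun _ _ => rfl

lemma sum_moveRate_mem_le (w : V) (P : Fin q → Fin q → Prop)
    [∀ x y, Decidable (P x y)] :
    ∑ m ∈ commonMoves G σ τ v, (if w ∈ m.2.2 ∧ P m.1 m.2.1 then moveRate L m else 0) ≤
      ∑ x, ∑ y, if P x y then 3000 else 0 := by
  have := sum_commonMoves (G := G) (σ := σ) (τ := τ) (v := v)
    (fun x y S => if w ∈ S ∧ P x y then flipRate L x y S else 0)
  unfold moveRate
  rw [this]
  refine sum_le_sum fun x _ => sum_le_sum fun y _ => ?_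
  by_cases hxy : x = y
  · rw [if_pos hxy]; split_ifs <;> norm_num
  rw [if_neg hxy]
  by_cases hP : P x y
  · simp only [hP, and_true, if_true]
    rw [← sum_filter]
    have hc : ((commonClusters G σ τ v x y).filter (w ∈ ·)).card ≤ 1 := by
      rw [card_le_one]
      intro S hS T hT
      simp only [commonClusters, mem_filter, mem_inter] at hS hT
      exact clusters_eq_of_mem hS.1.1.1 hT.1.1.1 hS.2 hT.2
    calc _ ≤ ∑ S ∈ (commonClusters G σ τ v x y).filter (w ∈ ·), (3000 : ℝ) :=
          sum_le_sum fun _ _ => flipRate_le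
      _ ≤ 3000 := by
          rw [sum_const, nsmul_eq_mul]
          have : (((commonClusters G σ τ v x y).filter (w ∈ ·)).card : ℝ) ≤ 1 := by
            exact_mod_cast hc
          linarith
  · simp [hP]

lemma sum_moveRate_le :
    ∑ m ∈ commonMoves G σ τ v, moveRate L m ≤ 3000 * q ^ 2 * Fintype.card V := by
  unfold moveRate
  rw [sum_commonMoves (fun x y S => flipRate L x y S)]
  calc _ ≤ ∑ x : Fin q, ∑ y : Fin q, (3000 * Fintype.card V : ℝ) := by
        refine sum_le_sum fun x _ => sum_le_sum fun y _ => ?_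
        split_ifs
        · positivity
        · calc _ ≤ ∑ S ∈ commonClusters G σ τ v x y, (3000 : ℝ) :=
                sum_le_sum fun _ _ => flipRate_le
            _ ≤ _ := by
              rw [sum_const, nsmul_eq_mul, mul_comm]
              refine mul_le_mul_of_nonneg_left ?_ (by norm_num)
              have h1 : (commonClusters G σ τ v x y).card ≤ (clusters G univ σ x y).card :=
                card_le_card ((filter_subset _ _).trans inter_subset_left)
              have h2 : (clusters G univ σ x y).card ≤ Fintype.card V :=
                card_image_le.trans (card_le_univ _)
              exact_mod_cast h1.trans h2
    _ = _ := by simp; ring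

lemma AgreeOff.move (hst : AgreeOff v σ τ) : AgreeOff v (moveTo m σ) (moveTo m τ) := by
  intro x hx
  unfold moveTo
  by_cases h : x ∈ m.2.2
  · rw [swapOn_of_mem h, swapOn_of_mem h, hst x hx]
  · rw [swapOn_of_notMem h, swapOn_of_notMem h, hst x hx]

/-- Colors available for recoloring `w` without touching `{a, b}` or the neighbours of `w`. -/
noncomputable def freeColors (G : SimpleGraph V) (L : V → Finset (Fin q)) (σ : V → Fin q) (a b : Fin q)
    (w : V) : Finset (Fin q) :=
  (L w).filter fun c => c ≠ a ∧ c ≠ b ∧ ∀ z, G.Adj w z → σ z ≠ c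

lemma card_freeColors : (L w).card ≤ (freeColors G L σ a b w).card + 2 + (nbrs G w).card := by
  have h1 : L w ⊆ freeColors G L σ a b w ∪ {a, b} ∪ (nbrs G w).image σ := by
    intro c hc
    simp only [freeColors, mem_union, mem_filter, mem_insert, mem_singleton, mem_image, mem_nbrs]
    by_contra hcon
    push Not at hcon
    exact hcon.1.1 hc hcon.1.2.1 hcon.1.2.2 |>.elim fun z hz => hcon.2 z hz.1 hz.2
  calc _ ≤ _ := card_le_card h1
    _ ≤ _ := card_union_le _ _
    _ ≤ _ := Nat.add_le_add ((card_union_le _ _).trans (Nat.add_le_add_left card_le_two _))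
      card_image_le

lemma singleton_mem_clusters (hσw : σ w = a) (hc : ∀ z, G.Adj w z → σ z ≠ c) (hac : a ≠ c) :
    {w} ∈ clusters G univ σ a c := by
  have : reachSet (biGraph G univ σ a c) w = {w} := by
    apply reachSet_eq_singleton
    intro z hz
    simp only [biGraph] at hz
    rcases hz.2.2.2 with h1 | h1
    · exact hc z hz.1 h1.2
    · exact hac (hσw ▸ h1.1)
  rw [← this]
  exact reachSet_mem_clusters (mem_univ _) (Or.inl hσw)

lemma moveRate_singleton (ha : a ∈ L w) (hc : c ∈ L w) : flipRate L a c {w} = 3000 := by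
  unfold flipRate
  rw [if_pos (by intro x hx; rw [mem_singleton.1 hx]; exact ⟨ha, hc⟩)]
  simp [flipP]

lemma gain_le (hσ : InLists L σ) (hst : AgreeOff v σ τ) (hne : σ v ≠ τ v)
    (hu : blockers G σ v (σ v) (τ v) u = {w}) :
    6000 * ((freeColors G L σ (σ v) (τ v) w).card : ℝ) ≤ ∑ m ∈ commonMoves G σ τ v,
      moveRate L m * (if blockers G (moveTo m σ) v (σ v) (τ v) u = ∅ then 1 else 0) := by
  set F := freeColors G L σ (σ v) (τ v) w with hF
  have hw : w ∈ blockers G σ v (σ v) (τ v) u := by rw [hu]; simp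
  rw [mem_blockers] at hw
  obtain ⟨hadj, hwv, hwc⟩ := hw
  have hFp : ∀ c ∈ F, c ∈ L w ∧ c ≠ σ v ∧ c ≠ τ v ∧ (∀ z, G.Adj w z → σ z ≠ c) ∧ σ w ≠ c := by
    intro c hc
    rw [hF] at hc
    simp only [freeColors, mem_filter] at hc
    refine ⟨hc.1, hc.2.1, hc.2.2.1, hc.2.2.2, ?_⟩
    rcases hwc with h1 | h1 <;> rw [h1]
    · exact hc.2.1.symm
    · exact hc.2.2.1.symm
  have hclσ : ∀ c ∈ F, {w} ∈ clusters G univ σ (σ w) c := fun c hc =>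
    singleton_mem_clusters rfl (hFp c hc).2.2.2.1 (hFp c hc).2.2.2.2
  have hclτ : ∀ c ∈ F, {w} ∈ clusters G univ τ (σ w) c := fun c hc =>
    singleton_mem_clusters (hst w hwv).symm (fun z hz => by
      by_cases hzv : z = v
      · rw [hzv]; exact (hFp c hc).2.2.1.symm
      · rw [← hst z hzv]; exact (hFp c hc).2.2.2.1 z hz) (hFp c hc).2.2.2.2
  have hgood : ∀ c ∈ F, blockers G (swapOn (σ w) c {w} σ) v (σ v) (τ v) u = ∅ := by
    intro c hc
    rw [eq_empty_iff_forall_notMem]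
    intro z hz
    rw [mem_blockers] at hz
    obtain ⟨hz1, hz2, hz3⟩ := hz
    by_cases hzw : z = w
    · subst hzw
      rw [swapOn_of_mem (mem_singleton_self _), Equiv.swap_apply_left] at hz3
      have := hFp c hc
      tauto
    · rw [swapOn_of_notMem (by simpa using hzw)] at hz3
      have : z ∈ blockers G σ v (σ v) (τ v) u := mem_blockers.2 ⟨hz1, hz2, hz3⟩
      rw [hu, mem_singleton] at this
      exact hzw this
  let f1 : Fin q → Fin q × Fin q × Finset V := fun c => (σ w, c, {w})
  let f2 : Fin q → Fin q × Fin q × Finset V := fun c => (c, σ w, {w})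
  have hi1 : Set.InjOn f1 F := fun c _ c' _ h => by simpa [f1] using h
  have hi2 : Set.InjOn f2 F := fun c _ c' _ h => by simpa [f2] using h
  have hdis : Disjoint (F.image f1) (F.image f2) := by
    rw [disjoint_left]
    intro m hm1 hm2
    obtain ⟨c, hc, rfl⟩ := mem_image.1 hm1
    obtain ⟨c', hc', h'⟩ := mem_image.1 hm2
    simp only [f1, f2, Prod.mk.injEq] at h'
    exact (hFp c' hc').2.2.2.2 h'.1.symm
  have hsub : F.image f1 ∪ F.image f2 ⊆ commonMoves G σ τ v := by
    intro m hm
    rcases mem_union.1 hm with hm | hm <;> obtain ⟨c, hc, rfl⟩ := mem_image.1 hm <;>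
      rw [mem_commonMoves]
    · exact ⟨(hFp c hc).2.2.2.2, hclσ c hc, hclτ c hc, by simpa [f1] using hwv.symm⟩
    · refine ⟨(hFp c hc).2.2.2.2.symm, ?_, ?_, by simpa [f2] using hwv.symm⟩
      · rw [clusters_comm]; exact hclσ c hc
      · rw [clusters_comm]; exact hclτ c hc
  refine le_trans (le_of_eq ?_) (sum_le_sum_of_subset_of_nonneg hsub fun m _ _ =>
    mul_nonneg moveRate_nonneg (by split_ifs <;> norm_num))
  rw [sum_union hdis, sum_image hi1, sum_image hi2]
  have e1 : ∀ c ∈ F, moveRate L (f1 c) * (if blockers G (moveTo (f1 c) σ) v (σ v) (τ v) u = ∅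
      then (1 : ℝ) else 0) = 3000 := by
    intro c hc
    have : moveRate L (f1 c) = 3000 := moveRate_singleton (hσ w) (hFp c hc).1
    have h0 : blockers G (moveTo (f1 c) σ) v (σ v) (τ v) u = ∅ := hgood c hc
    rw [this, if_pos h0, mul_one]
  have e2 : ∀ c ∈ F, moveRate L (f2 c) * (if blockers G (moveTo (f2 c) σ) v (σ v) (τ v) u = ∅
      then (1 : ℝ) else 0) = 3000 := by
    intro c hc
    have : moveRate L (f2 c) = 3000 := moveRate_singleton (hFp c hc).1 (hσ w)
    have h' : moveTo (f2 c) σ = moveTo (f1 c) σ := swapOn_comm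
    have h0 : blockers G (moveTo (f1 c) σ) v (σ v) (τ v) u = ∅ := hgood c hc
    rw [this, h', if_pos h0, mul_one]
  rw [sum_congr rfl e1, sum_congr rfl e2]
  simp only [sum_const, nsmul_eq_mul]
  ring

lemma loss_le (hu : blockers G σ v a b u = ∅) :
    ∑ m ∈ commonMoves G σ τ v, moveRate L m *
      (1 - (if blockers G (moveTo m σ) v a b u = ∅ then 1 else 0)) ≤
      12000 * ((nbrs G u).card : ℝ) := by
  have key : ∀ m ∈ commonMoves G σ τ v, moveRate L m *
      (1 - (if blockers G (moveTo m σ) v a b u = ∅ then 1 else 0)) ≤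
      ∑ w ∈ nbrs G u, if w ∈ m.2.2 ∧ ((m.1 = σ w ∧ (m.2.1 = a ∨ m.2.1 = b)) ∨
        (m.2.1 = σ w ∧ (m.1 = a ∨ m.1 = b))) then moveRate L m else 0 := by
    intro m hm
    have hnn : ∀ w ∈ nbrs G u, 0 ≤ if w ∈ m.2.2 ∧ ((m.1 = σ w ∧ (m.2.1 = a ∨ m.2.1 = b)) ∨
        (m.2.1 = σ w ∧ (m.1 = a ∨ m.1 = b))) then moveRate L m else 0 := fun w _ => by
      split_ifs
      · exact moveRate_nonneg
      · exact le_rfl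
    split_ifs with hb
    · simp only [sub_self, mul_zero]
      exact sum_nonneg hnn
    · obtain ⟨w, hw⟩ := nonempty_iff_ne_empty.2 hb
      rw [mem_blockers] at hw
      obtain ⟨h1, h2, h3⟩ := hw
      have hw0 : w ∉ blockers G σ v a b u := by rw [hu]; simp
      rw [mem_blockers] at hw0
      have hnc : ¬ (σ w = a ∨ σ w = b) := fun h => hw0 ⟨h1, h2, h⟩
      have hwm : w ∈ m.2.2 := by
        by_contra hc
        unfold moveTo at h3
        rw [swapOn_of_notMem hc] at h3
        exact hnc h3
      have hcol := (clusters_colored (mem_commonMoves.1 hm).2.1 hwm).2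
      refine le_trans (le_of_eq ?_) (single_le_sum hnn (mem_nbrs.2 h1))
      rw [if_pos, sub_zero, mul_one]
      refine ⟨hwm, ?_⟩
      unfold moveTo at h3
      rw [swapOn_of_mem hwm] at h3
      rcases hcol with h4 | h4 <;> rw [h4] at h3
      · rw [Equiv.swap_apply_left] at h3
        exact Or.inl ⟨h4.symm, h3⟩
      · rw [Equiv.swap_apply_right] at h3
        exact Or.inr ⟨h4.symm, h3⟩
  refine (sum_le_sum key).trans ?_
  rw [sum_comm]
  calc _ ≤ ∑ w ∈ nbrs G u, (12000 : ℝ) := by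
        refine sum_le_sum fun w _ => ?_
        refine (sum_moveRate_mem_le w (fun x y => (x = σ w ∧ (y = a ∨ y = b)) ∨
          (y = σ w ∧ (x = a ∨ x = b)))).trans ?_
        have : ∀ x y : Fin q, (if (x = σ w ∧ (y = a ∨ y = b)) ∨ (y = σ w ∧ (x = a ∨ x = b))
            then (3000 : ℝ) else 0) ≤ (if x = σ w then if y = a then 3000 else 0 else 0) +
              (if x = σ w then if y = b then 3000 else 0 else 0) +
              (if x = a then if y = σ w then 3000 else 0 else 0) +
              (if x = b then if y = σ w then 3000 else 0 else 0) := by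
          intro x y
          split_ifs <;> first | (exfalso; tauto) | norm_num
        refine (sum_le_sum fun x _ => sum_le_sum fun y _ => this x y).trans ?_
        simp only [sum_add_distrib]
        have h4 : ∀ p r : Fin q, ∑ x : Fin q, ∑ y : Fin q,
            (if x = p then if y = r then (3000 : ℝ) else 0 else 0) = 3000 := by
          intro p r
          rw [sum_eq_single p (fun x _ hx => by simp [hx]) (by simp)]
          simp
        rw [h4, h4, h4, h4]; norm_num
    _ = _ := by rw [sum_const, nsmul_eq_mul, mul_comm]

lemma card_goodNbrs : ((goodNbrs G σ v a b).card : ℝ) =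
    ∑ u ∈ nbrs G v, if blockers G σ v a b u = ∅ then (1 : ℝ) else 0 := by
  simp [goodNbrs]

lemma sum_goodNbrs_change_le {Δ : ℕ} {g : ℝ} (hσ : InLists L σ) (hst : AgreeOff v σ τ)
    (hne : σ v ≠ τ v) (hΔ : ∀ u, (nbrs G u).card ≤ Δ)
    (hg : ∀ w, 2 ≤ (L w).card → g + 2 + Δ ≤ (L w).card) :
    ∑ m ∈ commonMoves G σ τ v, moveRate L m * (((goodNbrs G σ v (σ v) (τ v)).card : ℝ) -
      (goodNbrs G (moveTo m σ) v (σ v) (τ v)).card) ≤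
      12000 * Δ * (goodNbrs G σ v (σ v) (τ v)).card - 6000 * g * (oneNbrs G L σ v (σ v) (τ v)).card := by
  simp only [card_goodNbrs, ← sum_sub_distrib, mul_sum]
  rw [sum_comm]
  have h1 : ((oneNbrs G L σ v (σ v) (τ v)).card : ℝ) =
      ∑ u ∈ nbrs G v, if OneBlocker G L σ v (σ v) (τ v) u then (1 : ℝ) else 0 := by
    simp [oneNbrs]
  rw [h1, mul_sum, ← sum_sub_distrib]
  refine sum_le_sum fun u _ => ?_
  by_cases hu : blockers G σ v (σ v) (τ v) u = ∅
  · have hu' : ¬ OneBlocker G L σ v (σ v) (τ v) u := fun h => h.ne_empty hu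
    simp only [if_pos hu, if_neg hu']
    refine (loss_le hu).trans ?_
    have : ((nbrs G u).card : ℝ) ≤ Δ := by exact_mod_cast hΔ u
    linarith
  · simp only [if_neg hu]
    by_cases hu' : OneBlocker G L σ v (σ v) (τ v) u
    · obtain ⟨w, hw, hLw⟩ := id hu'
      have h2 := gain_le (G := G) hσ hst hne hw
      have h3 := card_freeColors (G := G) (L := L) (σ := σ) (a := σ v) (b := τ v) (w := w)
      have h4 : ((L w).card : ℝ) ≤ (freeColors G L σ (σ v) (τ v) w).card + 2 + Δ := by
        exact_mod_cast h3.trans (Nat.add_le_add_left (hΔ w) _)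
      have h5 := hg w hLw
      simp only [if_pos hu', zero_sub, mul_neg, sum_neg_distrib]
      linarith
    · simp only [if_neg hu', zero_sub, mul_neg, sum_neg_distrib, mul_zero, sub_zero]
      refine neg_nonpos.2 (sum_nonneg fun m _ => mul_nonneg moveRate_nonneg ?_)
      split_ifs <;> norm_num

end CommonMoves

section Contraction

variable {V : Type*} [Fintype V] {q : ℕ} {G : SimpleGraph V} {L : V → Finset (Fin q)}
  {W : Finset V} {σ τ : V → Fin q} {a b c : Fin q} {S T : Finset V} {x y u v w : V}
  {h : (V → Fin q) → ℝ} {m : Fin q × Fin q × Finset V} {Δ : ℕ}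

/-- Instances whose unfrozen vertices have long lists. -/
structure LongLists (Δ : ℕ) (G : SimpleGraph V) (L : V → Finset (Fin q)) : Prop where
  deg_le : ∀ v, (nbrs G v).card ≤ Δ
  card_list : ∀ v, (L v).card = 1 ∨
    ((11 / 6 - 1 / 10000) * (Δ : ℝ) ≤ (L v).card ∧ Δ + 2 ≤ (L v).card)

/-- The discount given to unblocked neighbours in the metric. -/
noncomputable def discount (Δ : ℕ) : ℝ := if 6 ≤ Δ then 1 / (100 * Δ) else 0

lemma discount_nonneg : 0 ≤ discount Δ := by unfold discount; split_ifs <;> positivity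

lemma discount_mul_le (hN : S.card ≤ Δ) : discount Δ * S.card ≤ 1 / 100 := by
  unfold discount
  split_ifs with h
  · have h0 : (0 : ℝ) < Δ := by exact_mod_cast (by omega : 0 < Δ)
    have h1 : (S.card : ℝ) ≤ Δ := by exact_mod_cast hN
    rw [div_mul_eq_mul_div, div_le_div_iff₀ (by positivity) (by norm_num)]
    linarith
  · norm_num

/-- The length of the edge between two colorings that differ at `v`. -/
noncomputable def edgeDist (Δ : ℕ) (G : SimpleGraph V) (σ τ : V → Fin q) (v : V) : ℝ :=
  1 - discount Δ * (goodNbrs G σ v (σ v) (τ v)).card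

/-- Functions that are Lipschitz with constant `K` along edges. -/
def EdgeLip (Δ : ℕ) (G : SimpleGraph V) (L : V → Finset (Fin q)) (K : ℝ)
    (h : (V → Fin q) → ℝ) : Prop :=
  ∀ v σ τ, InLists L σ → InLists L τ → AgreeOff v σ τ → σ v ≠ τ v →
    h σ - h τ ≤ K * edgeDist Δ G σ τ v

lemma edgeDist_le_one : edgeDist Δ G σ τ v ≤ 1 := by
  unfold edgeDist
  have := discount_nonneg (Δ := Δ)
  have : 0 ≤ discount Δ * (goodNbrs G σ v (σ v) (τ v)).card := by positivity
  linarith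

lemma LongLists.half_le_edgeDist (hL : LongLists Δ G L) : 99 / 100 ≤ edgeDist Δ G σ τ v := by
  have := discount_mul_le (S := goodNbrs G σ v (σ v) (τ v))
    ((card_le_card (filter_subset _ _)).trans (hL.deg_le v))
  unfold edgeDist
  linarith

lemma EdgeLip.hammingLip (hh : EdgeLip Δ G L 1 h) : HammingLip L h := by
  intro σ τ hσ hτ S hS
  induction S using Finset.induction_on generalizing σ with
  | empty =>
    have : σ = τ := funext fun x => hS x (notMem_empty x)
    simp [this]
  | insert v S hv ih =>
    have hσ' : InLists L (Function.update σ v (τ v)) := by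
      intro x
      by_cases hx : x = v
      · subst hx; simpa using hτ x
      · simpa [Function.update_of_ne hx] using hσ x
    have h1 := ih (Function.update σ v (τ v)) hσ' (by
      intro x hx
      by_cases hxv : x = v
      · subst hxv; simp
      · rw [Function.update_of_ne hxv]; exact hS x (by simp [hxv, hx]))
    have h2 : h σ - h (Function.update σ v (τ v)) ≤ 1 := by
      by_cases he : σ v = τ v
      · rw [← he, Function.update_eq_self]; norm_num
      · have := hh v σ (Function.update σ v (τ v)) hσ hσ'
          (fun x hx => (Function.update_of_ne hx _ _).symm) (by simpa using he)
        exact this.trans (by rw [one_mul]; exact edgeDist_le_one)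
    rw [card_insert_of_notMem hv]; push_cast; linarith

lemma flipGen_sub :
    flipGen G L h σ - flipGen G L h τ = (∑ m ∈ commonMoves G σ τ v, moveRate L m *
      ((h (moveTo m σ) - h (moveTo m τ)) - (h σ - h τ))) +
      ∑ x, ∑ y, (if x = y then 0 else specDrift G L h σ τ v x y) := by
  unfold moveRate moveTo
  rw [sum_commonMoves (fun x y S => flipRate L x y S *
    ((h (swapOn x y S σ) - h (swapOn x y S τ)) - (h σ - h τ)))]
  unfold flipGen
  simp only [← sum_sub_distrib, ← sum_add_distrib]
  refine sum_congr rfl fun x _ => sum_congr rfl fun y _ => ?_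
  split_ifs
  · simp
  · unfold specDrift commonDrift; ring

lemma InLists.move (hσ : InLists L σ) (hm : moveRate L m ≠ 0) : InLists L (moveTo m σ) :=
  hσ.swap_of_rate hm

/-- The arithmetic behind the contraction for large degrees. -/
lemma drift_arith_large {D d N M l g R : ℝ} (hD : 6 ≤ D) (hd : d ≤ D) (hd0 : 0 ≤ d) (hN : 0 ≤ N)
    (hNd : N ≤ d) (hM : 0 ≤ M) (hl : (11 / 6 - 1 / 10000) * D ≤ l) (hg : D / 3 ≤ g)
    (hR : R ≤ 6000 * (l + d)) :
    2 * (5497 * d - 297 * N + 8 * M - 3000 * l) + R * (1 / (100 * D) * N) +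
      1 / (100 * D) * (12000 * D * N - 6000 * g * M) ≤ -1 := by
  have hD0 : 0 < D := by linarith
  obtain ⟨r, hr⟩ : ∃ r, r = N / D := ⟨_, rfl⟩
  have hrD : N = r * D := by rw [hr]; field_simp
  have hr0 : 0 ≤ r := by rw [hr]; positivity
  have hr1 : r ≤ 1 := by rw [hr, div_le_one hD0]; linarith
  have e1 : R * (1 / (100 * D) * N) = R * r / 100 := by rw [hrD]; field_simp
  have e2 : 1 / (100 * D) * (12000 * D * N - 6000 * g * M) = 120 * N - 60 * (g / D) * M := by
    field_simp; ring
  have hgD : 1 / 3 ≤ g / D := by rw [le_div_iff₀ hD0]; linarith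
  have h1 : R * r ≤ 6000 * (l + d) * r := mul_le_mul_of_nonneg_right hR hr0
  have h2 : M * (1 / 3) ≤ M * (g / D) := mul_le_mul_of_nonneg_left hgD hM
  have h3 : ((11 / 6 - 1 / 10000) * D) * (6000 - 60 * r) ≤ l * (6000 - 60 * r) :=
    mul_le_mul_of_nonneg_right hl (by linarith)
  have h4 : d * r ≤ D * r := mul_le_mul_of_nonneg_right hd hr0
  have h5 : 0 ≤ r * D := by positivity
  rw [e1, e2]
  nlinarith

lemma drift_arith_small {Δ d N M l : ℕ} (hΔ : Δ < 6) (hd : d ≤ Δ) (hM : M ≤ d)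
    (hl : (11 / 6 - 1 / 10000) * (Δ : ℝ) ≤ l) (hl2 : Δ + 2 ≤ l) :
    2 * (5497 * (d : ℝ) - 297 * N + 8 * M - 3000 * l) ≤ -1 := by
  have h1 : 5505 * Δ + 1 ≤ 3000 * l := by
    interval_cases Δ
    · omega
    · omega
    · omega
    · have : (5 : ℝ) < l := by push_cast at hl; linarith
      have : 5 < l := by exact_mod_cast this
      omega
    · have : (7 : ℝ) < l := by push_cast at hl; linarith
      have : 7 < l := by exact_mod_cast this
      omega
    · have : (9 : ℝ) < l := by push_cast at hl; linarith
      have : 9 < l := by exact_mod_cast this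
      omega
  have h2 : (5505 * Δ + 1 : ℝ) ≤ 3000 * l := by exact_mod_cast h1
  have h3 : (d : ℝ) ≤ Δ := by exact_mod_cast hd
  have h4 : (M : ℝ) ≤ d := by exact_mod_cast hM
  have h5 : (0 : ℝ) ≤ N := by positivity
  have h6 : (0 : ℝ) ≤ d := by positivity
  linarith

/-- Bound on the total rate of the moves at a pair of colorings. -/
noncomputable def rateBound (q Δ n : ℕ) : ℝ := 6000 * (q + Δ) + 3000 * q ^ 2 * n

/-- The flip dynamics contracts edges. -/
theorem flipGen_sub_le (hL : LongLists Δ G L) (hh : EdgeLip Δ G L 1 h) (hσ : InLists L σ)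
    (hτ : InLists L τ) (hst : AgreeOff v σ τ) (hne : σ v ≠ τ v) :
    flipGen G L h σ - flipGen G L h τ ≤ -1 +
      rateBound q Δ (Fintype.card V) * (edgeDist Δ G σ τ v - (h σ - h τ)) := by
  obtain ⟨w, hw0, hw1, hw⟩ := sum_specDrift_le (G := G) hh.hammingLip hσ hτ hst hne
  set N := (goodNbrs G σ v (σ v) (τ v)).card with hN
  set M := (oneNbrs G L σ v (σ v) (τ v)).card with hM
  set θ := discount Δ with hθ
  set d := edgeDist Δ G σ τ v with hd
  set R := ∑ m ∈ commonMoves G σ τ v, moveRate L m with hR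
  have hθ0 : 0 ≤ θ := discount_nonneg
  have hdN : d = 1 - θ * N := rfl
  have hdeg := hL.deg_le v
  have hNd : N ≤ (nbrs G v).card := card_le_card (filter_subset _ _)
  have hMd : M ≤ (nbrs G v).card := card_le_card (filter_subset _ _)
  have hδ : 0 ≤ d - (h σ - h τ) := by
    have := hh v σ τ hσ hτ hst hne
    rw [one_mul] at this; linarith
  have hlv : (11 / 6 - 1 / 10000) * (Δ : ℝ) ≤ (L v).card ∧ Δ + 2 ≤ (L v).card := by
    refine (hL.card_list v).resolve_left fun h1 => ?_
    obtain ⟨c, hc⟩ := card_eq_one.1 h1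
    have h2 := hσ v
    have h3 := hτ v
    rw [hc, mem_singleton] at h2 h3
    exact hne (h2.trans h3.symm)
  have hcommon : ∑ m ∈ commonMoves G σ τ v, moveRate L m *
      ((h (moveTo m σ) - h (moveTo m τ)) - (h σ - h τ)) ≤
      θ * ∑ m ∈ commonMoves G σ τ v, moveRate L m * ((N : ℝ) -
        (goodNbrs G (moveTo m σ) v (σ v) (τ v)).card) + R * (d - (h σ - h τ)) := by
    rw [mul_sum, hR, sum_mul, ← sum_add_distrib]
    refine sum_le_sum fun m hm => ?_
    rcases eq_or_ne (moveRate L m) 0 with h0 | h0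
    · simp [h0]
    have hv := (mem_commonMoves.1 hm).2.2.2
    have e1 : moveTo m σ v = σ v := swapOn_of_notMem hv
    have e2 : moveTo m τ v = τ v := swapOn_of_notMem hv
    have h1 := hh v (moveTo m σ) (moveTo m τ) (hσ.move h0) (hτ.move h0) hst.move
      (by rw [e1, e2]; exact hne)
    unfold edgeDist at h1
    rw [one_mul, e1, e2, ← hθ] at h1
    have h2 := mul_le_mul_of_nonneg_left h1 (moveRate_nonneg (L := L) (m := m))
    rw [hdN]
    linarith
  have hRle : R ≤ 3000 * q ^ 2 * Fintype.card V := sum_moveRate_le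
  have hLq : ((L v).card : ℝ) ≤ q := by
    have := card_le_univ (L v)
    rw [Fintype.card_fin] at this
    exact_mod_cast this
  have hdegR : ((nbrs G v).card : ℝ) ≤ Δ := by exact_mod_cast hdeg
  have hW : (w + R) * (d - (h σ - h τ)) ≤
      rateBound q Δ (Fintype.card V) * (d - (h σ - h τ)) := by
    refine mul_le_mul_of_nonneg_right ?_ hδ
    unfold rateBound
    linarith
  have h1δ : 1 - (h σ - h τ) = (d - (h σ - h τ)) + θ * N := by rw [hdN]; ring
  rw [h1δ] at hw
  rw [flipGen_sub (v := v)]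
  suffices hs : 2 * (5497 * ((nbrs G v).card : ℝ) - 297 * N + 8 * M - 3000 * (L v).card) +
      w * (θ * N) + θ * ∑ m ∈ commonMoves G σ τ v, moveRate L m * ((N : ℝ) -
        (goodNbrs G (moveTo m σ) v (σ v) (τ v)).card) ≤ -1 by linarith
  by_cases hΔ : 6 ≤ Δ
  · have hD : (6 : ℝ) ≤ Δ := by exact_mod_cast hΔ
    have hch := sum_goodNbrs_change_le (G := G) (Δ := Δ) (g := (Δ : ℝ) / 3) hσ hst hne hL.deg_le (by
      intro x hx
      rcases hL.card_list x with h1 | h1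
      · omega
      · linarith [h1.1])
    have hθe : θ = 1 / (100 * (Δ : ℝ)) := if_pos hΔ
    have h2 := drift_arith_large (D := Δ) (d := (nbrs G v).card) (N := N) (M := M)
      (l := (L v).card) (g := (Δ : ℝ) / 3) (R := w) hD hdegR (by positivity) (by positivity)
      (by exact_mod_cast hNd) (by positivity) hlv.1 le_rfl hw1
    have h3 := mul_le_mul_of_nonneg_left hch hθ0
    rw [← hθe] at h2
    linarith
  · have hθe : θ = 0 := if_neg hΔ
    rw [hθe]
    have := drift_arith_small (N := N) (by omega) hdeg hMd hlv.1 hlv.2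
    linarith

/-- One step of the discretized flip dynamics. -/
noncomputable def flipStep (G : SimpleGraph V) (L : V → Finset (Fin q)) (t : ℝ)
    (h : (V → Fin q) → ℝ) : (V → Fin q) → ℝ := fun σ => h σ + t * flipGen G L h σ

lemma flipGen_smul (r : ℝ) : flipGen G L (fun σ => r * h σ) σ = r * flipGen G L h σ := by
  unfold flipGen pairGen
  simp only [mul_sum (s := univ)]
  refine sum_congr rfl fun x _ => sum_congr rfl fun y _ => ?_
  split_ifs
  · simp
  · rw [mul_sum]
    exact sum_congr rfl fun S _ => by ring

theorem EdgeLip.flipStep {K t : ℝ} (hL : LongLists Δ G L) (hK : 0 < K) (hh : EdgeLip Δ G L K h)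
    (ht : 0 ≤ t) (htW : t * rateBound q Δ (Fintype.card V) ≤ 1) :
    EdgeLip Δ G L (K * (1 - t)) (flipStep G L t h) := by
  intro v σ τ hσ hτ hst hne
  have hh1 : EdgeLip Δ G L 1 (fun σ => K⁻¹ * h σ) := by
    intro v σ τ hσ hτ hst hne
    have := hh v σ τ hσ hτ hst hne
    rw [← mul_sub, one_mul, inv_mul_le_iff₀ hK]
    exact this
  have h1 := flipGen_sub_le hL hh1 hσ hτ hst hne
  have h2 := hh1 v σ τ hσ hτ hst hne
  simp only [flipGen_smul] at h1 h2
  rw [← mul_sub] at h1 h2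
  rw [← mul_sub] at h1
  have hd1 : edgeDist Δ G σ τ v ≤ 1 := edgeDist_le_one
  unfold ListColoringMixing.flipStep
  set A := h σ - h τ with hA
  set B := flipGen G L h σ - flipGen G L h τ with hB
  set d := edgeDist Δ G σ τ v
  have e : h σ + t * flipGen G L h σ - (h τ + t * flipGen G L h τ) = A + t * B := by
    rw [hA, hB]; ring
  rw [e, mul_assoc, ← inv_mul_le_iff₀ hK]
  have h3 := mul_le_mul_of_nonneg_left h1 ht
  have h4 : t * rateBound q Δ (Fintype.card V) * (d - K⁻¹ * A) ≤ d - K⁻¹ * A := by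
    refine mul_le_of_le_one_left ?_ htW
    linarith
  have h5 : t * d ≤ t * 1 := mul_le_mul_of_nonneg_left hd1 ht
  linarith

end Contraction

section Reversibility

variable {V : Type*} [Fintype V] {q : ℕ} {G : SimpleGraph V} {L : V → Finset (Fin q)}
  {σ τ : V → Fin q} {a b c : Fin q} {S T : Finset V} {x y u v w i : V}
  {h : (V → Fin q) → ℝ} {m : Fin q × Fin q × Finset V} {Δ : ℕ} {A : Finset (V → Fin q)}

/-- The proper list colorings. -/
noncomputable def proper (G : SimpleGraph V) (L : V → Finset (Fin q)) : Finset (V → Fin q) :=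
  univ.filter fun σ => InLists L σ ∧ ∀ u v, G.Adj u v → σ u ≠ σ v

lemma mem_proper : σ ∈ proper G L ↔ InLists L σ ∧ ∀ u v, G.Adj u v → σ u ≠ σ v := by
  simp [proper]

lemma swapOn_apply_mem_iff (x : V) :
    (swapOn a b S σ x = a ∨ swapOn a b S σ x = b) ↔ (σ x = a ∨ σ x = b) := by
  by_cases hx : x ∈ S
  · rw [swapOn_of_mem hx]
    rcases eq_or_ne (σ x) a with h1 | h1
    · simp [h1]
    · rcases eq_or_ne (σ x) b with h2 | h2
      · simp [h2]
      · rw [Equiv.swap_apply_of_ne_of_ne h1 h2]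
  · rw [swapOn_of_notMem hx]

lemma swapOn_swapOn : swapOn a b S (swapOn a b S σ) = σ := by
  ext x
  by_cases hx : x ∈ S
  · rw [swapOn_of_mem hx, swapOn_of_mem hx, Equiv.swap_apply_self]
  · rw [swapOn_of_notMem hx, swapOn_of_notMem hx]

lemma not_mem_of_adj_cluster (hσ : ∀ u v, G.Adj u v → σ u ≠ σ v) (hS : S ∈ clusters G univ σ a b)
    (hu : u ∈ S) (hv : v ∉ S) (huv : G.Adj u v) : σ v ≠ a ∧ σ v ≠ b := by
  have h1 := (clusters_colored hS hu).2
  have h2 := hσ u v huv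
  by_contra hc
  have h3 : σ v = a ∨ σ v = b := by tauto
  refine hv (clusters_closed hS hu ⟨huv, mem_univ _, mem_univ _, ?_⟩)
  rcases h1 with h1 | h1 <;> rcases h3 with h3 | h3 <;> simp_all

lemma swapOn_proper (hσ : ∀ u v, G.Adj u v → σ u ≠ σ v) (hS : S ∈ clusters G univ σ a b) :
    ∀ u v, G.Adj u v → swapOn a b S σ u ≠ swapOn a b S σ v := by
  have key : ∀ u v, G.Adj u v → u ∈ S → v ∉ S → swapOn a b S σ u ≠ swapOn a b S σ v := by
    intro u v huv hu hv he
    have h1 := not_mem_of_adj_cluster hσ hS hu hv huv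
    have h2 := (swapOn_apply_mem_iff (S := S) u).2 (clusters_colored hS hu).2
    rw [he, swapOn_of_notMem hv] at h2
    tauto
  intro u v huv
  by_cases hu : u ∈ S <;> by_cases hv : v ∈ S
  · rw [swapOn_of_mem hu, swapOn_of_mem hv]
    exact fun he => hσ u v huv (Equiv.injective _ he)
  · exact key u v huv hu hv
  · exact (key v u huv.symm hv hu).symm
  · rw [swapOn_of_notMem hu, swapOn_of_notMem hv]
    exact hσ u v huv

lemma clusters_swapOn (hσ : ∀ u v, G.Adj u v → σ u ≠ σ v) (hS : S ∈ clusters G univ σ a b) :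
    clusters G univ (swapOn a b S σ) a b = clusters G univ σ a b := by
  have hτ := swapOn_proper hσ hS
  have hadj : ∀ σ' : V → Fin q, (∀ u v, G.Adj u v → σ' u ≠ σ' v) → ∀ u v,
      (biGraph G univ σ' a b).Adj u v ↔ G.Adj u v ∧ (σ' u = a ∨ σ' u = b) ∧
        (σ' v = a ∨ σ' v = b) := by
    intro σ' hσ' u v
    simp only [biGraph, mem_univ, true_and]
    refine and_congr_right fun huv => ?_
    have := hσ' u v huv
    constructor
    · tauto
    · rintro ⟨h1 | h1, h2 | h2⟩ <;> simp_all
  have hG : biGraph G univ (swapOn a b S σ) a b = biGraph G univ σ a b := by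
    ext u v
    rw [hadj _ hτ, hadj _ hσ, swapOn_apply_mem_iff, swapOn_apply_mem_iff]
  unfold clusters
  rw [hG]
  congr 1
  ext x
  simp only [mem_filter, swapOn_apply_mem_iff]

/-- The moves available at a coloring. -/
noncomputable def movesAt (G : SimpleGraph V) (σ : V → Fin q) : Finset (Fin q × Fin q × Finset V) :=
  univ.filter fun m => m.1 ≠ m.2.1 ∧ m.2.2 ∈ clusters G univ σ m.1 m.2.1

lemma mem_movesAt : m ∈ movesAt G σ ↔ m.1 ≠ m.2.1 ∧ m.2.2 ∈ clusters G univ σ m.1 m.2.1 := by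
  simp [movesAt]

lemma sum_movesAt (f : Fin q → Fin q → Finset V → ℝ) :
    ∑ m ∈ movesAt G σ, f m.1 m.2.1 m.2.2 =
      ∑ x, ∑ y, if x = y then 0 else ∑ S ∈ clusters G univ σ x y, f x y S := by
  unfold movesAt
  rw [sum_filter, Fintype.sum_prod_type]
  refine sum_congr rfl fun x _ => ?_
  rw [Fintype.sum_prod_type]
  refine sum_congr rfl fun y _ => ?_
  by_cases hxy : x = y
  · simp [hxy]
  · simp only [hxy, ne_eq, not_false_eq_true, true_and, if_false]
    rw [← sum_filter]
    exact sum_congr (by ext S; simp) fun _ _ => rfl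

lemma flipGen_eq_sum_movesAt : flipGen G L h σ =
    ∑ m ∈ movesAt G σ, moveRate L m * (h (moveTo m σ) - h σ) :=
  (sum_movesAt (fun x y S => flipRate L x y S * (h (swapOn x y S σ) - h σ))).symm

lemma moveTo_mem_proper (hσ : σ ∈ proper G L) (hm : m ∈ movesAt G σ) (hr : moveRate L m ≠ 0) :
    moveTo m σ ∈ proper G L := by
  rw [mem_proper] at hσ ⊢
  exact ⟨hσ.1.move hr, swapOn_proper hσ.2 (mem_movesAt.1 hm).2⟩

lemma movesAt_moveTo (hσ : σ ∈ proper G L) (hm : m ∈ movesAt G σ) : m ∈ movesAt G (moveTo m σ) := by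
  rw [mem_movesAt] at hm ⊢
  refine ⟨hm.1, ?_⟩
  unfold moveTo
  rw [clusters_swapOn (mem_proper.1 hσ).2 hm.2]
  exact hm.2

/-- Moves between elements of `A` cancel. -/
lemma sum_flipGen_eq (hA : A ⊆ proper G L) : ∑ σ ∈ A, flipGen G L h σ =
    ∑ σ ∈ A, ∑ m ∈ movesAt G σ, if moveTo m σ ∈ A then 0 else
      moveRate L m * (h (moveTo m σ) - h σ) := by
  rw [← sub_eq_zero, ← sum_sub_distrib]
  simp only [flipGen_eq_sum_movesAt, ← sum_sub_distrib]
  rw [sum_sigma']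
  refine (sum_filter_ne_zero _).symm.trans ?_
  refine sum_involution (fun p _ => ⟨moveTo p.2 p.1, p.2⟩) ?_ ?_ ?_ ?_
  · rintro ⟨σ, m⟩ hp
    simp only [mem_filter, mem_sigma] at hp
    obtain ⟨⟨hσ, hm⟩, hne⟩ := hp
    have hin : moveTo m σ ∈ A := by
      by_contra hc
      exact hne (by rw [if_neg hc, sub_self])
    have he : moveTo m (moveTo m σ) = σ := swapOn_swapOn
    simp only [he, if_pos hin, if_pos hσ]
    ring
  · rintro ⟨σ, m⟩ hp hne he
    simp only [Sigma.mk.injEq, heq_eq_eq, and_true] at he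
    apply hne
    simp only [he, sub_self, mul_zero, ite_self]
  · rintro ⟨σ, m⟩ hp
    simp only [mem_filter, mem_sigma] at hp ⊢
    obtain ⟨⟨hσ, hm⟩, hne⟩ := hp
    have hin : moveTo m σ ∈ A := by
      by_contra hc
      exact hne (by rw [if_neg hc, sub_self])
    have he : moveTo m (moveTo m σ) = σ := swapOn_swapOn
    refine ⟨⟨hin, movesAt_moveTo (hA hσ) hm⟩, ?_⟩
    rw [if_pos hin] at hne
    rw [he, if_pos hσ]
    intro h0
    apply hne
    linarith
  · rintro ⟨σ, m⟩ hp
    have he : moveTo m (moveTo m σ) = σ := swapOn_swapOn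
    simp only [he]

lemma sum_flipGen_proper : ∑ σ ∈ proper G L, flipGen G L h σ = 0 := by
  rw [sum_flipGen_eq (Subset.refl _)]
  refine sum_eq_zero fun σ hσ => sum_eq_zero fun m hm => ?_
  split_ifs with h1
  · rfl
  · have : moveRate L m = 0 := by
      by_contra h0
      exact h1 (moveTo_mem_proper hσ hm h0)
    rw [this, zero_mul]

lemma abs_sum_flipGen_le (hh : HammingLip L h) (hA : A ⊆ proper G L)
    (hAi : ∀ σ ∈ A, ∀ τ ∈ proper G L, τ i = σ i → τ ∈ A) :
    |∑ σ ∈ A, flipGen G L h σ| ≤ 6000 * q * A.card := by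
  rw [sum_flipGen_eq hA]
  refine (abs_sum_le_sum_abs _ _).trans ?_
  rw [mul_comm, ← nsmul_eq_mul, ← sum_const]
  refine sum_le_sum fun σ hσ => (abs_sum_le_sum_abs _ _).trans ?_
  have hσp := hA hσ
  have hσL := (mem_proper.1 hσp).1
  calc _ ≤ ∑ m ∈ movesAt G σ, if i ∈ m.2.2 then (3000 : ℝ) else 0 := by
        refine sum_le_sum fun m hm => ?_
        split_ifs with h1 h2 h2
        · norm_num
        · simp
        · rw [abs_mul, abs_of_nonneg moveRate_nonneg]
          exact (flipRate_mul_abs_le hh hσL).trans flipRate_mul_card_le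
        · have : moveRate L m = 0 := by
            by_contra h0
            exact h1 (hAi σ hσ _ (moveTo_mem_proper hσp hm h0) (swapOn_of_notMem h2))
          simp [this]
    _ = ∑ x, ∑ y, if x = y then 0 else ∑ S ∈ clusters G univ σ x y,
          if i ∈ S then (3000 : ℝ) else 0 := sum_movesAt (fun _ _ S => if i ∈ S then (3000 : ℝ) else 0)
    _ ≤ ∑ x, ∑ y, ((if x = σ i then (3000 : ℝ) else 0) + (if y = σ i then (3000 : ℝ) else 0)) := by
        refine sum_le_sum fun x _ => sum_le_sum fun y _ => ?_
        split_ifs with hxy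
        any_goals norm_num
        all_goals
          rw [← sum_filter, sum_const, nsmul_eq_mul]
          have hc : ((clusters G univ σ x y).filter (i ∈ ·)).card ≤ 1 := by
            rw [card_le_one]
            intro S hS T hT
            rw [mem_filter] at hS hT
            exact clusters_eq_of_mem hS.1 hT.1 hS.2 hT.2
          have hc' : (((clusters G univ σ x y).filter (i ∈ ·)).card : ℝ) ≤ 1 := by exact_mod_cast hc
          first
          | linarith
          | skip
        have he : (clusters G univ σ x y).filter (i ∈ ·) = ∅ := by
          rw [filter_eq_empty_iff]
          intro S hS hiS
          rcases (clusters_colored hS hiS).2 with h | h <;> exact absurd h.symm ‹_›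
        rw [he]; simp
    _ = 6000 * q := by
        simp [sum_add_distrib]
        ring

end Reversibility

section Influence

variable {V : Type*} [Fintype V] {q : ℕ} {G : SimpleGraph V} {L : V → Finset (Fin q)}
  {σ τ : V → Fin q} {a b c : Fin q} {S T : Finset V} {x y u v w i : V}
  {h : (V → Fin q) → ℝ} {Δ : ℕ} {A P : Finset (V → Fin q)} {K t : ℝ}

/-- The deviation of the sum over `A` from its share of the sum over `P`. -/
noncomputable def deviation (A P : Finset (V → Fin q)) (h : (V → Fin q) → ℝ) : ℝ :=
  ∑ σ ∈ A, h σ - A.card / P.card * ∑ σ ∈ P, h σ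

lemma EdgeLip.hammingLip_inv (hK : 0 < K) (hh : EdgeLip Δ G L K h) :
    HammingLip L (fun σ => K⁻¹ * h σ) := by
  refine EdgeLip.hammingLip (Δ := Δ) (G := G) fun v σ τ hσ hτ hst hne => ?_
  have := hh v σ τ hσ hτ hst hne
  rw [← mul_sub, one_mul, inv_mul_le_iff₀ hK]
  exact this

lemma abs_deviation_le_card (hK : 0 < K) (hh : EdgeLip Δ G L K h) (hA : A ⊆ proper G L) :
    |deviation A (proper G L) h| ≤ A.card * (K * Fintype.card V) := by
  set P := proper G L with hP
  rcases A.eq_empty_or_nonempty with h0 | ⟨σ0, hσ0⟩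
  · simp [deviation, h0]
  have hN : (0 : ℝ) < P.card := by exact_mod_cast card_pos.2 ⟨σ0, hA hσ0⟩
  have hH := hh.hammingLip_inv hK
  have h2 : ∀ σ ∈ P, ∀ τ ∈ P, h σ - h τ ≤ K * Fintype.card V := by
    intro σ hσ τ hτ
    have := hH σ τ (mem_proper.1 hσ).1 (mem_proper.1 hτ).1 univ (fun x hx => absurd (mem_univ x) hx)
    rw [← mul_sub, inv_mul_le_iff₀ hK] at this
    simpa using this
  have h1 : deviation A P h = ∑ σ ∈ A, (∑ τ ∈ P, (h σ - h τ)) / P.card := by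
    unfold deviation
    simp only [sum_sub_distrib, sum_const, nsmul_eq_mul, sub_div]
    rw [mul_div_assoc']
    congr 1
    · exact sum_congr rfl fun σ _ => by field_simp
    · ring
  rw [h1]
  refine (abs_sum_le_sum_abs _ _).trans ?_
  rw [← nsmul_eq_mul, ← sum_const]
  refine sum_le_sum fun σ hσ => ?_
  rw [abs_div, abs_of_pos hN, div_le_iff₀ hN]
  refine (abs_sum_le_sum_abs _ _).trans ?_
  rw [mul_comm _ (P.card : ℝ), ← nsmul_eq_mul, ← sum_const]
  refine sum_le_sum fun τ hτ => abs_le.2 ⟨?_, h2 σ (hA hσ) τ hτ⟩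
  linarith [h2 τ hτ σ (hA hσ)]

lemma deviation_flipStep : deviation A (proper G L) (flipStep G L t h) =
    deviation A (proper G L) h + t * ∑ σ ∈ A, flipGen G L h σ := by
  unfold deviation flipStep
  simp only [sum_add_distrib, ← mul_sum, sum_flipGen_proper]
  ring

lemma abs_deviation_le_aux (hL : LongLists Δ G L) (ht : 0 ≤ t) (ht1 : t < 1)
    (htW : t * rateBound q Δ (Fintype.card V) ≤ 1) (hA : A ⊆ proper G L)
    (hAi : ∀ σ ∈ A, ∀ τ ∈ proper G L, τ i = σ i → τ ∈ A) (k : ℕ) :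
    ∀ (K : ℝ) (h : (V → Fin q) → ℝ), 0 < K → EdgeLip Δ G L K h →
      |deviation A (proper G L) h| ≤ A.card * (6000 * q * K + K * (1 - t) ^ k * Fintype.card V) := by
  induction k with
  | zero =>
    intro K h hK hh
    refine (abs_deviation_le_card hK hh hA).trans ?_
    refine mul_le_mul_of_nonneg_left ?_ (by positivity)
    have : 0 ≤ 6000 * (q : ℝ) * K := by positivity
    simpa using this
  | succ k ih =>
    intro K h hK hh
    have h1 := ih (K * (1 - t)) (flipStep G L t h) (mul_pos hK (by linarith))
      (hh.flipStep hL hK ht htW)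
    rw [deviation_flipStep] at h1
    have h2 := abs_sum_flipGen_le (hh.hammingLip_inv hK) hA hAi
    simp only [flipGen_smul] at h2
    rw [← mul_sum, abs_mul, abs_of_pos (inv_pos.2 hK), inv_mul_le_iff₀ hK] at h2
    have h3 := mul_le_mul_of_nonneg_left h2 ht
    have h4 : |deviation A (proper G L) h| ≤ |deviation A (proper G L) h +
        t * ∑ σ ∈ A, flipGen G L h σ| + t * |∑ σ ∈ A, flipGen G L h σ| := by
      rw [← abs_of_nonneg ht, ← abs_mul, abs_of_nonneg ht]
      have := abs_sub (deviation A (proper G L) h + t * ∑ σ ∈ A, flipGen G L h σ)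
        (t * ∑ σ ∈ A, flipGen G L h σ)
      simpa using this
    refine h4.trans ((add_le_add h1 h3).trans (le_of_eq ?_))
    ring

lemma rateBound_nonneg {n : ℕ} : 0 ≤ rateBound q Δ n := by unfold rateBound; positivity

/-- Conditioning on the color of a single vertex moves Lipschitz expectations by a constant. -/
theorem abs_deviation_le (hL : LongLists Δ G L) (hA : A ⊆ proper G L)
    (hAi : ∀ σ ∈ A, ∀ τ ∈ proper G L, τ i = σ i → τ ∈ A) (hK : 0 < K)
    (hh : EdgeLip Δ G L K h) :
    |deviation A (proper G L) h| ≤ 6000 * q * K * A.card := by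
  have hW := rateBound_nonneg (q := q) (Δ := Δ) (n := Fintype.card V)
  set t := 1 / (rateBound q Δ (Fintype.card V) + 2) with ht
  have ht0 : 0 < t := by positivity
  have ht1 : t < 1 := by rw [ht, div_lt_one (by linarith)]; linarith
  have htW : t * rateBound q Δ (Fintype.card V) ≤ 1 := by
    rw [ht, div_mul_eq_mul_div, div_le_one (by linarith)]; linarith
  have h1 := fun k => abs_deviation_le_aux hL ht0.le ht1 htW hA hAi k K h hK hh
  have h2 : Filter.Tendsto (fun k : ℕ => A.card * (6000 * q * K + K * (1 - t) ^ k *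
      Fintype.card V)) Filter.atTop (nhds (A.card * (6000 * q * K + K * 0 * Fintype.card V))) := by
    refine Filter.Tendsto.const_mul _ (Filter.Tendsto.const_add _ (Filter.Tendsto.mul_const _
      (Filter.Tendsto.const_mul _ ?_)))
    exact tendsto_pow_atTop_nhds_zero_of_lt_one (by linarith) (by linarith)
  have h3 := ge_of_tendsto' h2 h1
  refine h3.trans (le_of_eq ?_)
  ring

lemma edgeLip_sum (hL : LongLists Δ G L) {s : V → Fin q → ℝ} (hs : ∀ j d, |s j d| ≤ 1) :
    EdgeLip Δ G L 4 (fun σ => ∑ j, s j (σ j)) := by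
  intro v σ τ hσ hτ hst hne
  rw [← sum_sub_distrib, sum_eq_single v (fun j _ hj => by rw [hst j hj, sub_self]) (by simp)]
  have h1 := hL.half_le_edgeDist (σ := σ) (τ := τ) (v := v)
  have h2 := abs_le.1 (hs v (σ v))
  have h3 := abs_le.1 (hs v (τ v))
  linarith [h2.2, h3.1]

/-- Number of colorings in `P` with given colors at `i` and `j`. -/
noncomputable def pairCount (P : Finset (V → Fin q)) (p r : V × Fin q) : ℝ :=
  (P.filter fun σ => σ p.1 = p.2 ∧ σ r.1 = r.2).card

/-- Number of colorings in `P` with a given color at a vertex. -/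
noncomputable def colorCount (P : Finset (V → Fin q)) (p : V × Fin q) : ℝ :=
  (P.filter fun σ => σ p.1 = p.2).card

lemma pairCount_comm (p r : V × Fin q) : pairCount P p r = pairCount P r p := by
  unfold pairCount; simp only [and_comm]

/-- Unnormalized covariance between two colour events. -/
noncomputable def pairCov (P : Finset (V → Fin q)) (p r : V × Fin q) : ℝ :=
  pairCount P p r - colorCount P p * colorCount P r / P.card

lemma pairCov_comm (p r : V × Fin q) : pairCov P p r = pairCov P r p := by
  unfold pairCov; rw [pairCount_comm, mul_comm (colorCount P p)]

lemma sum_apply_eq_sum_colorCount (s : V → Fin q → ℝ) (A : Finset (V → Fin q)) :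
    ∑ σ ∈ A, ∑ j, s j (σ j) = ∑ r : V × Fin q, s r.1 r.2 * colorCount A r := by
  rw [sum_comm, Fintype.sum_prod_type]
  refine sum_congr rfl fun j _ => ?_
  rw [← sum_fiberwise A (fun σ => σ j)]
  refine sum_congr rfl fun d _ => ?_
  rw [sum_congr rfl fun σ hσ => by rw [(mem_filter.1 hσ).2], sum_const, nsmul_eq_mul, mul_comm]
  rfl

lemma sum_abs_pairCov_le (hL : LongLists Δ G L) (p : V × Fin q) :
    ∑ r, |pairCov (proper G L) p r| ≤ 24000 * q * colorCount (proper G L) p := by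
  set P := proper G L with hP
  set A := P.filter fun σ => σ p.1 = p.2 with hA
  set s : V → Fin q → ℝ := fun j d => SignType.sign (pairCov P p (j, d)) with hs
  have hs1 : ∀ j d, |s j d| ≤ 1 := by
    intro j d
    simp only [hs]
    rcases SignType.trichotomy (SignType.sign (pairCov P p (j, d))) with h | h | h <;> simp [h]
  have h1 := abs_deviation_le (A := A) (i := p.1) hL (filter_subset _ _) (by
    intro σ hσ τ hτ he
    rw [hA, mem_filter] at hσ ⊢
    exact ⟨hτ, he.trans hσ.2⟩) (by norm_num : (0 : ℝ) < 4) (edgeLip_sum hL hs1)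
  have h2 : deviation A P (fun σ => ∑ j, s j (σ j)) = ∑ r, |pairCov P p r| := by
    unfold deviation
    rw [sum_apply_eq_sum_colorCount, sum_apply_eq_sum_colorCount, mul_sum, ← sum_sub_distrib]
    refine sum_congr rfl fun r _ => ?_
    have e1 : colorCount A r = pairCount P p r := by
      unfold colorCount pairCount
      rw [hA, filter_filter]
    have e2 : (A.card : ℝ) = colorCount P p := rfl
    rw [e1, e2, ← sign_mul_self (pairCov P p r)]
    change s r.1 r.2 * _ - _ = s r.1 r.2 * _
    unfold pairCov
    ring
  rw [h2] at h1
  refine (le_abs_self _).trans (h1.trans (le_of_eq ?_))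
  have e2 : (A.card : ℝ) = colorCount P p := rfl
  rw [e2]; ring

/-- Spectral independence. -/
theorem sum_sq_sum_le (hL : LongLists Δ G L) (g : V → Fin q → ℝ)
    (hg : ∀ i, ∑ σ ∈ proper G L, g i (σ i) = 0) :
    ∑ σ ∈ proper G L, (∑ i, g i (σ i)) ^ 2 ≤
      24000 * q * ∑ i, ∑ σ ∈ proper G L, g i (σ i) ^ 2 := by
  set P := proper G L with hP
  have hprod : ∀ σ : V → Fin q, (∑ i, g i (σ i)) ^ 2 = ∑ p : V × Fin q, ∑ r : V × Fin q,
      g p.1 p.2 * g r.1 r.2 * (if σ p.1 = p.2 ∧ σ r.1 = r.2 then 1 else 0) := by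
    intro σ
    have e : ∑ i, g i (σ i) = ∑ p : V × Fin q, if σ p.1 = p.2 then g p.1 p.2 else 0 := by
      rw [Fintype.sum_prod_type]
      refine sum_congr rfl fun i _ => ?_
      simp
    rw [e, sq, sum_mul_sum]
    refine sum_congr rfl fun p _ => sum_congr rfl fun r _ => ?_
    split_ifs <;> simp_all
  have h0 : ∑ p : V × Fin q, g p.1 p.2 * colorCount P p = 0 := by
    rw [← sum_apply_eq_sum_colorCount, sum_comm]
    exact sum_eq_zero fun i _ => hg i
  have h1 : ∑ σ ∈ P, (∑ i, g i (σ i)) ^ 2 =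
      ∑ p : V × Fin q, ∑ r : V × Fin q, g p.1 p.2 * g r.1 r.2 * pairCov P p r := by
    have e1 : ∑ σ ∈ P, (∑ i, g i (σ i)) ^ 2 =
        ∑ p : V × Fin q, ∑ r : V × Fin q, g p.1 p.2 * g r.1 r.2 * pairCount P p r := by
      simp only [hprod]
      rw [sum_comm]
      refine sum_congr rfl fun p _ => ?_
      rw [sum_comm]
      refine sum_congr rfl fun r _ => ?_
      rw [← mul_sum, sum_boole]
      rfl
    have e2 : ∑ p : V × Fin q, ∑ r : V × Fin q, g p.1 p.2 * g r.1 r.2 *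
        (colorCount P p * colorCount P r / P.card) = 0 := by
      have : ∀ p r : V × Fin q, g p.1 p.2 * g r.1 r.2 * (colorCount P p * colorCount P r / P.card) =
          (g p.1 p.2 * colorCount P p / P.card) * (g r.1 r.2 * colorCount P r) := fun p r => by ring
      simp only [this, ← mul_sum, h0, mul_zero, sum_const_zero]
    unfold pairCov
    simp only [mul_sub, sum_sub_distrib]
    rw [e1, e2, sub_zero]
  have hsq : ∑ i, ∑ σ ∈ P, g i (σ i) ^ 2 = ∑ p : V × Fin q, g p.1 p.2 ^ 2 * colorCount P p := by
    rw [sum_comm]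
    exact sum_apply_eq_sum_colorCount (fun i d => g i d ^ 2) P
  rw [h1, hsq]
  have hle : ∀ p r : V × Fin q, g p.1 p.2 * g r.1 r.2 * pairCov P p r ≤
      (g p.1 p.2 ^ 2 * |pairCov P p r| + g r.1 r.2 ^ 2 * |pairCov P r p|) / 2 := by
    intro p r
    rw [pairCov_comm r p]
    have h2 : g p.1 p.2 * g r.1 r.2 * pairCov P p r ≤
        |g p.1 p.2 * g r.1 r.2| * |pairCov P p r| := by
      rw [← abs_mul]; exact le_abs_self _
    have h3 : |g p.1 p.2 * g r.1 r.2| ≤ (g p.1 p.2 ^ 2 + g r.1 r.2 ^ 2) / 2 := by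
      rw [abs_le]
      constructor <;> nlinarith [sq_nonneg (g p.1 p.2 + g r.1 r.2), sq_nonneg (g p.1 p.2 - g r.1 r.2)]
    have h4 := mul_le_mul_of_nonneg_right h3 (abs_nonneg (pairCov P p r))
    linarith
  refine (sum_le_sum fun p _ => sum_le_sum fun r _ => hle p r).trans ?_
  have e3 : ∑ p : V × Fin q, ∑ r : V × Fin q,
      (g p.1 p.2 ^ 2 * |pairCov P p r| + g r.1 r.2 ^ 2 * |pairCov P r p|) / 2 =
      ∑ p : V × Fin q, g p.1 p.2 ^ 2 * ∑ r, |pairCov P p r| := by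
    simp only [add_div, sum_add_distrib]
    rw [sum_comm (f := fun p r : V × Fin q => g r.1 r.2 ^ 2 * |pairCov P r p| / 2),
      ← sum_add_distrib]
    refine sum_congr rfl fun p _ => ?_
    rw [← sum_add_distrib, mul_sum]
    exact sum_congr rfl fun r _ => by ring
  rw [e3, mul_sum]
  refine sum_le_sum fun p _ => ?_
  have := mul_le_mul_of_nonneg_left (sum_abs_pairCov_le hL p) (sq_nonneg (g p.1 p.2))
  linarith

end Influence

section Averages

variable {V : Type*} [Fintype V] {q : ℕ} {σ τ : V → Fin q} {P : Finset (V → Fin q)}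
  {f g : (V → Fin q) → ℝ} {Λ Λ' Λ₁ Λ₂ Λ₃ : Finset V} {R : ℝ}

/-- The members of `P` agreeing with `σ` on `Λ`. -/
noncomputable def fib (P : Finset (V → Fin q)) (Λ : Finset V) (σ : V → Fin q) :
    Finset (V → Fin q) := P.filter fun τ => ∀ v ∈ Λ, τ v = σ v

lemma mem_fib : τ ∈ fib P Λ σ ↔ τ ∈ P ∧ ∀ v ∈ Λ, τ v = σ v := by simp [fib]

lemma self_mem_fib (hσ : σ ∈ P) : σ ∈ fib P Λ σ := mem_fib.2 ⟨hσ, fun _ _ => rfl⟩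

lemma fib_congr (h : ∀ v ∈ Λ, τ v = σ v) : fib P Λ τ = fib P Λ σ := by
  ext ρ
  rw [mem_fib, mem_fib]
  exact and_congr_right fun _ => forall₂_congr fun v hv => by rw [h v hv]

lemma fib_anti (h : Λ ⊆ Λ') : fib P Λ' σ ⊆ fib P Λ σ := fun τ hτ => by
  rw [mem_fib] at hτ ⊢
  exact ⟨hτ.1, fun v hv => hτ.2 v (h hv)⟩

lemma fib_card_pos (hσ : σ ∈ P) : (0 : ℝ) < (fib P Λ σ).card := by
  exact_mod_cast card_pos.2 ⟨σ, self_mem_fib hσ⟩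

/-- The conditional expectation of `f` given the coordinates in `Λ`. -/
noncomputable def avg (P : Finset (V → Fin q)) (Λ : Finset V) (f : (V → Fin q) → ℝ)
    (σ : V → Fin q) : ℝ := (∑ τ ∈ fib P Λ σ, f τ) / (fib P Λ σ).card

lemma avg_congr (h : ∀ v ∈ Λ, τ v = σ v) : avg P Λ f τ = avg P Λ f σ := by
  unfold avg; rw [fib_congr h]

lemma avg_pos (hf : ∀ σ, 0 < f σ) (hσ : σ ∈ P) : 0 < avg P Λ f σ :=
  div_pos (sum_pos (fun _ _ => hf _) ⟨σ, self_mem_fib hσ⟩) (fib_card_pos hσ)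

lemma avg_univ (hσ : σ ∈ P) : avg P univ f σ = f σ := by
  have : fib P univ σ = {σ} := by
    ext τ
    rw [mem_fib, mem_singleton]
    constructor
    · exact fun h => funext fun v => h.2 v (mem_univ v)
    · rintro rfl; exact ⟨hσ, fun _ _ => rfl⟩
  unfold avg; rw [this]; simp

lemma fib_empty : fib P ∅ σ = P := by ext; simp [mem_fib]

lemma sum_mul_avg : ∑ σ ∈ P, g σ * avg P Λ f σ = ∑ σ ∈ P, avg P Λ g σ * f σ := by
  have h1 : ∀ g f : (V → Fin q) → ℝ, ∑ σ ∈ P, g σ * avg P Λ f σ = ∑ σ ∈ P, ∑ τ ∈ P,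
      if ∀ v ∈ Λ, τ v = σ v then g σ * f τ / (fib P Λ σ).card else 0 := by
    intro g f
    refine sum_congr rfl fun σ _ => ?_
    unfold avg
    rw [← sum_filter, mul_div_assoc', mul_sum, sum_div]
    rfl
  simp only [mul_comm (avg P Λ g _)]
  rw [h1, h1, sum_comm]
  refine sum_congr rfl fun σ _ => sum_congr rfl fun τ _ => ?_
  by_cases h : ∀ v ∈ Λ, σ v = τ v
  · rw [if_pos h, if_pos fun v hv => (h v hv).symm, fib_congr h, mul_comm]
  · rw [if_neg h, if_neg fun h' => h fun v hv => (h' v hv).symm]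

/-- `g` depends only on the coordinates in `Λ`. -/
def DependsOn' (Λ : Finset V) (g : (V → Fin q) → ℝ) : Prop :=
  ∀ σ τ, (∀ v ∈ Λ, τ v = σ v) → g τ = g σ

lemma dependsOn_avg (h : Λ ⊆ Λ') : DependsOn' Λ' (avg P Λ f) :=
  fun _ _ hst => avg_congr fun v hv => hst v (h hv)

lemma avg_of_dependsOn (hg : DependsOn' Λ g) (hσ : σ ∈ P) : avg P Λ g σ = g σ := by
  unfold avg
  rw [sum_congr rfl fun τ hτ => hg σ τ (mem_fib.1 hτ).2, sum_const, nsmul_eq_mul]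
  field_simp [(fib_card_pos (Λ := Λ) hσ).ne']

lemma sum_dependsOn_mul_avg (hg : DependsOn' Λ g) :
    ∑ σ ∈ P, g σ * avg P Λ f σ = ∑ σ ∈ P, g σ * f σ := by
  rw [sum_mul_avg]
  exact sum_congr rfl fun σ hσ => by rw [avg_of_dependsOn hg hσ]

lemma sum_avg : ∑ σ ∈ P, avg P Λ f σ = ∑ σ ∈ P, f σ := by
  have := sum_dependsOn_mul_avg (P := P) (Λ := Λ) (f := f) (g := fun _ => 1) fun _ _ _ => rfl
  simpa using this

lemma sum_fib_avg (h : Λ ⊆ Λ') :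
    ∑ τ ∈ fib P Λ σ, avg P Λ' f τ = ∑ τ ∈ fib P Λ σ, f τ := by
  have := sum_dependsOn_mul_avg (P := P) (Λ := Λ') (f := f)
    (g := fun τ => if ∀ v ∈ Λ, τ v = σ v then 1 else 0) (by
      intro ρ τ hst
      have : (∀ v ∈ Λ, τ v = σ v) ↔ (∀ v ∈ Λ, ρ v = σ v) :=
        forall₂_congr fun v hv => by rw [hst v (h hv)]
      simp only [this])
  simpa [fib, sum_filter] using this

/-- `∑ x log x` for the conditional expectation given `Λ`. -/
noncomputable def entSum (P : Finset (V → Fin q)) (f : (V → Fin q) → ℝ) (Λ : Finset V) : ℝ :=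
  ∑ σ ∈ P, avg P Λ f σ * Real.log (avg P Λ f σ)

lemma entSum_eq (h : Λ ⊆ Λ') :
    entSum P f Λ = ∑ σ ∈ P, avg P Λ' f σ * Real.log (avg P Λ f σ) := by
  have h1 : DependsOn' Λ fun σ => Real.log (avg P Λ f σ) := fun σ τ hst => by
    simp only [avg_congr hst]
  have h2 : DependsOn' Λ' fun σ => Real.log (avg P Λ f σ) := fun σ τ hst => by
    simp only [dependsOn_avg h σ τ hst]
  unfold entSum
  simp only [mul_comm _ (Real.log _)]
  rw [sum_dependsOn_mul_avg h1, sum_dependsOn_mul_avg h2]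

lemma sq_sqrt_sub_le {x y : ℝ} (hx : 0 < x) (hy : 0 < y) :
    (√x - √y) ^ 2 ≤ x * Real.log (x / y) - x + y := by
  have hsx := Real.sqrt_pos.2 hx
  have hsy := Real.sqrt_pos.2 hy
  have hxx := Real.sq_sqrt hx.le
  have hyy := Real.sq_sqrt hy.le
  have h1 : Real.log (x / y) = -(2 * Real.log (√y / √x)) := by
    rw [← hxx, ← hyy, ← div_pow, Real.log_pow, Real.sqrt_sq hsx.le, Real.sqrt_sq hsy.le]
    rw [show (√y / √x) = (√x / √y)⁻¹ by rw [inv_div], Real.log_inv]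
    push_cast; ring
  have h2 := Real.log_le_sub_one_of_pos (div_pos hsy hsx)
  have h3 : x * (√y / √x) = √x * √y := by
    rw [← hxx, Real.sqrt_sq hsx.le]; field_simp
  have h4 : x * Real.log (√y / √x) ≤ x * (√y / √x - 1) := mul_le_mul_of_nonneg_left h2 hx.le
  rw [h1]
  nlinarith

lemma mul_log_div_ge {x y : ℝ} (hx : 0 < x) (hy : 0 < y) : x - y ≤ x * Real.log (x / y) := by
  have := sq_sqrt_sub_le hx hy
  nlinarith [sq_nonneg (√x - √y)]

lemma entSum_sub (hf : ∀ σ, 0 < f σ) (h : Λ ⊆ Λ') : entSum P f Λ' - entSum P f Λ =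
    ∑ σ ∈ P, (avg P Λ' f σ * Real.log (avg P Λ' f σ / avg P Λ f σ) - avg P Λ' f σ +
      avg P Λ f σ) := by
  rw [sum_add_distrib, sum_sub_distrib, sum_avg, sum_avg, sub_add_cancel, entSum_eq h]
  unfold entSum
  rw [← sum_sub_distrib]
  refine sum_congr rfl fun σ hσ => ?_
  rw [Real.log_div (avg_pos hf hσ).ne' (avg_pos hf hσ).ne']
  ring

lemma entSum_mono (hf : ∀ σ, 0 < f σ) (h : Λ ⊆ Λ') : entSum P f Λ ≤ entSum P f Λ' := by
  rw [← sub_nonneg, entSum_sub hf h]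
  refine sum_nonneg fun σ hσ => ?_
  have := mul_log_div_ge (avg_pos (Λ := Λ') hf hσ) (avg_pos (Λ := Λ) hf hσ)
  linarith

lemma sum_sq_sqrt_sub_le (hf : ∀ σ, 0 < f σ) (h : Λ ⊆ Λ') :
    ∑ σ ∈ P, (√(avg P Λ' f σ) - √(avg P Λ f σ)) ^ 2 ≤ entSum P f Λ' - entSum P f Λ := by
  rw [entSum_sub hf h]
  exact sum_le_sum fun σ hσ => sq_sqrt_sub_le (avg_pos hf hσ) (avg_pos hf hσ)

lemma entSum_second_diff (hf : ∀ σ, 0 < f σ) (h1 : Λ ⊆ Λ₁) (h2 : Λ ⊆ Λ₂) (h13 : Λ₁ ⊆ Λ₃)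
    (h23 : Λ₂ ⊆ Λ₃) :
    ∑ σ ∈ P, (avg P Λ f σ - avg P Λ₁ f σ * avg P Λ₂ f σ / avg P Λ f σ) ≤
      entSum P f Λ₃ - entSum P f Λ₁ - entSum P f Λ₂ + entSum P f Λ := by
  rw [entSum_eq h13, entSum_eq h23, entSum_eq (h1.trans h13), sum_sub_distrib, sum_avg,
    ← sum_avg (Λ := Λ₃), ← sum_sub_distrib]
  unfold entSum
  rw [← sum_sub_distrib, ← sum_sub_distrib, ← sum_add_distrib]
  refine sum_le_sum fun σ hσ => ?_
  have hX := avg_pos (Λ := Λ₃) hf hσ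
  have hA := avg_pos (Λ := Λ₁) hf hσ
  have hB := avg_pos (Λ := Λ₂) hf hσ
  have hM := avg_pos (Λ := Λ) hf hσ
  refine (mul_log_div_ge hX (div_pos (mul_pos hA hB) hM)).trans (le_of_eq ?_)
  rw [Real.log_div hX.ne' (div_pos (mul_pos hA hB) hM).ne', Real.log_div (mul_pos hA hB).ne' hM.ne',
    Real.log_mul hA.ne' hB.ne']
  ring

lemma sum_sub_mul_sub_div (hf : ∀ σ, 0 < f σ) :
    ∑ σ ∈ P, (avg P Λ f σ - avg P Λ₁ f σ * avg P Λ₂ f σ / avg P Λ f σ) =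
      -∑ σ ∈ P, (avg P Λ₁ f σ - avg P Λ f σ) * (avg P Λ₂ f σ - avg P Λ f σ) / avg P Λ f σ := by
  have e : ∀ σ ∈ P, (avg P Λ₁ f σ - avg P Λ f σ) * (avg P Λ₂ f σ - avg P Λ f σ) / avg P Λ f σ =
      avg P Λ₁ f σ * avg P Λ₂ f σ / avg P Λ f σ - avg P Λ₁ f σ - avg P Λ₂ f σ + avg P Λ f σ := by
    intro σ hσ
    have := (avg_pos (Λ := Λ) hf hσ).ne'
    field_simp
    ring
  rw [sum_congr rfl e]
  simp only [sum_add_distrib, sum_sub_distrib, sum_avg]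
  ring

lemma sum_sq_sub_div_le (hf : ∀ σ, 0 < f σ) (h : Λ ⊆ Λ') (hR0 : 0 ≤ R)
    (hR : ∀ σ ∈ P, avg P Λ' f σ ≤ R * avg P Λ f σ) :
    ∑ σ ∈ P, (avg P Λ' f σ - avg P Λ f σ) ^ 2 / avg P Λ f σ ≤
      2 * (R + 1) * (entSum P f Λ' - entSum P f Λ) := by
  refine le_trans ?_ (mul_le_mul_of_nonneg_left (sum_sq_sqrt_sub_le hf h) (by positivity))
  rw [mul_sum]
  refine sum_le_sum fun σ hσ => ?_
  have hA := avg_pos (Λ := Λ') hf hσ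
  have hM := avg_pos (Λ := Λ) hf hσ
  have hRA := hR σ hσ
  set A := avg P Λ' f σ
  set M := avg P Λ f σ
  have hAA := Real.sq_sqrt hA.le
  have hMM := Real.sq_sqrt hM.le
  have e : (A - M) ^ 2 = (√A - √M) ^ 2 * (√A + √M) ^ 2 := by
    rw [← mul_pow, ← hAA, ← hMM, Real.sqrt_sq (Real.sqrt_nonneg _), Real.sqrt_sq (Real.sqrt_nonneg _)]
    ring
  rw [div_le_iff₀ hM, e]
  have h2 : (√A + √M) ^ 2 ≤ 2 * (R + 1) * M := by nlinarith [sq_nonneg (√A - √M)]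
  have := mul_le_mul_of_nonneg_left h2 (sq_nonneg (√A - √M))
  linarith

end Averages

section Surgery

variable {V : Type*} [Fintype V] {q : ℕ} {G : SimpleGraph V} {L : V → Finset (Fin q)}
  {σ τ ρ : V → Fin q} {c : Fin q} {f : (V → Fin q) → ℝ} {Λ S U W : Finset V} {u v w i : V}
  {Δ m : ℕ} {A B P : Finset (V → Fin q)}

lemma card_agreeOff_le : (A.filter fun τ => ∀ w, w ∉ S → τ w = σ w).card ≤ q ^ S.card := by
  calc _ ≤ (univ : Finset (S → Fin q)).card := by
        refine card_le_card_of_injOn (fun τ w => τ w) (fun _ _ => mem_coe.2 (mem_univ _)) ?_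
        intro τ hτ τ' hτ' h
        simp only [coe_filter, Set.mem_ofPred_eq] at hτ hτ'
        ext w : 1
        by_cases hw : w ∈ S
        · exact congrFun h ⟨w, hw⟩
        · rw [hτ.2 w hw, hτ'.2 w hw]
    _ = q ^ S.card := by simp

/-- A map changing only the coordinates in `S` is at most `q ^ #S`-to-one. -/
lemma sum_comp_le {T : (V → Fin q) → V → Fin q} (hT : ∀ τ ∈ A, T τ ∈ B)
    (hS : ∀ τ ∈ A, ∀ w, w ∉ S → T τ w = τ w) (hf : ∀ τ ∈ B, 0 ≤ f τ) :
    ∑ τ ∈ A, f (T τ) ≤ (q : ℝ) ^ S.card * ∑ τ ∈ B, f τ := by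
  rw [← sum_fiberwise_of_maps_to hT, mul_sum]
  refine sum_le_sum fun ρ hρ => ?_
  rw [sum_congr rfl fun τ hτ => by rw [(mem_filter.1 hτ).2], sum_const, nsmul_eq_mul]
  refine mul_le_mul_of_nonneg_right ?_ (hf ρ hρ)
  have : (A.filter fun τ => T τ = ρ).card ≤ q ^ S.card := by
    refine le_trans (card_le_card fun τ hτ => ?_) (card_agreeOff_le (A := A) (S := S) (σ := ρ))
    rw [mem_filter] at hτ ⊢
    exact ⟨hτ.1, fun w hw => by rw [← hτ.2, hS τ hτ.1 w hw]⟩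
  exact_mod_cast this

/-- The lists leave two spare colors at every vertex. -/
structure SpareLists (Δ : ℕ) (G : SimpleGraph V) (L : V → Finset (Fin q)) : Prop where
  deg_le : ∀ v, (nbrs G v).card ≤ Δ
  le_card : ∀ v, Δ + 2 ≤ (L v).card

lemma SpareLists.exists_color (hL : SpareLists Δ G L) (τ : V → Fin q) (c : Fin q) (u : V) :
    ∃ d ∈ L u, d ≠ c ∧ ∀ w, G.Adj u w → τ w ≠ d := by
  have h : (insert c ((nbrs G u).image τ)).card < (L u).card := by
    have h1 := card_insert_le c ((nbrs G u).image τ)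
    have h2 : ((nbrs G u).image τ).card ≤ (nbrs G u).card := card_image_le
    have := hL.deg_le u
    have := hL.le_card u
    omega
  obtain ⟨d, hd, hd'⟩ := exists_mem_notMem_of_card_lt_card h
  rw [mem_insert, not_or] at hd'
  exact ⟨d, hd, hd'.1, fun w hw e => hd'.2 (mem_image.2 ⟨w, mem_nbrs.2 hw, e⟩)⟩

/-- Recolor the neighbours of `v` that use the color `c`. -/
noncomputable def evict (G : SimpleGraph V) (L : V → Finset (Fin q)) (v : V) (c : Fin q)
    (τ : V → Fin q) : V → Fin q := fun u =>
  if h : (∃ d ∈ L u, d ≠ c ∧ ∀ w, G.Adj u w → τ w ≠ d) ∧ G.Adj v u ∧ τ u = c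
  then h.1.choose else τ u

lemma evict_of_not (h : ¬(G.Adj v u ∧ τ u = c)) : evict G L v c τ u = τ u := by
  unfold evict
  rw [dif_neg fun h' => h h'.2]

lemma SpareLists.evict_spec (hL : SpareLists Δ G L) (h : G.Adj v u ∧ τ u = c) :
    evict G L v c τ u ∈ L u ∧ evict G L v c τ u ≠ c ∧
      ∀ w, G.Adj u w → τ w ≠ evict G L v c τ u := by
  have h' : (∃ d ∈ L u, d ≠ c ∧ ∀ w, G.Adj u w → τ w ≠ d) ∧ G.Adj v u ∧ τ u = c :=
    ⟨hL.exists_color τ c u, h⟩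
  unfold evict
  rw [dif_pos h']
  exact h'.1.choose_spec

lemma evict_self : evict G L v c τ v = τ v := evict_of_not fun h => G.loopless.irrefl v h.1

lemma SpareLists.evict_mem (hL : SpareLists Δ G L) (hτ : τ ∈ proper G L) :
    evict G L v c τ ∈ proper G L := by
  rw [mem_proper] at hτ ⊢
  refine ⟨fun u => ?_, fun u w huw => ?_⟩
  · by_cases h : G.Adj v u ∧ τ u = c
    · exact (hL.evict_spec h).1
    · rw [evict_of_not h]; exact hτ.1 u
  · by_cases hu : G.Adj v u ∧ τ u = c
    · rw [evict_of_not (u := w) fun hw => hτ.2 u w huw (hu.2.trans hw.2.symm)]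
      exact ((hL.evict_spec hu).2.2 w huw).symm
    · rw [evict_of_not hu]
      by_cases hw : G.Adj v w ∧ τ w = c
      · exact (hL.evict_spec hw).2.2 u huw.symm
      · rw [evict_of_not hw]; exact hτ.2 u w huw

lemma SpareLists.evict_ne (hL : SpareLists Δ G L) (h : G.Adj v u) : evict G L v c τ u ≠ c := by
  by_cases hu : τ u = c
  · exact (hL.evict_spec ⟨h, hu⟩).2.1
  · rw [evict_of_not fun h' => hu h'.2]; exact hu

/-- Recolor `v` to `c`, after clearing `c` from its neighbourhood. -/
noncomputable def force (G : SimpleGraph V) (L : V → Finset (Fin q)) (v : V) (c : Fin q)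
    (τ : V → Fin q) : V → Fin q := fun u => if u = v then c else evict G L v c τ u

lemma force_self : force G L v c τ v = c := if_pos rfl

lemma force_of_ne (h : u ≠ v) : force G L v c τ u = evict G L v c τ u := if_neg h

lemma SpareLists.force_mem (hL : SpareLists Δ G L) (hτ : τ ∈ proper G L) (hc : c ∈ L v) :
    force G L v c τ ∈ proper G L := by
  have h := mem_proper.1 (hL.evict_mem (v := v) (c := c) hτ)
  rw [mem_proper]
  refine ⟨fun u => ?_, fun u w huw => ?_⟩
  · rcases eq_or_ne u v with rfl | hu
    · rwa [force_self]
    · rw [force_of_ne hu]; exact h.1 u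
  · rcases eq_or_ne u v with rfl | hu
    · rw [force_self, force_of_ne huw.ne']
      exact (hL.evict_ne huw).symm
    · rw [force_of_ne hu]
      rcases eq_or_ne w v with rfl | hw
      · rw [force_self]
        exact hL.evict_ne huw.symm
      · rw [force_of_ne hw]; exact h.2 u w huw

/-- The closed neighbourhood. -/
noncomputable def star (G : SimpleGraph V) (v : V) : Finset V := insert v (nbrs G v)

lemma SpareLists.card_star_le (hL : SpareLists Δ G L) : (star G v).card ≤ Δ + 1 :=
  (card_insert_le _ _).trans (Nat.succ_le_succ (hL.deg_le v))

lemma evict_of_notMem_star (h : u ∉ star G v) : evict G L v c τ u = τ u :=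
  evict_of_not fun h' => h (mem_insert_of_mem (mem_nbrs.2 h'.1))

lemma force_of_notMem_star (h : u ∉ star G v) : force G L v c τ u = τ u := by
  have hu : u ≠ v := by rintro rfl; exact h (mem_insert_self _ _)
  rw [force_of_ne hu, evict_of_notMem_star h]

lemma SpareLists.q_pos (hL : SpareLists Δ G L) (v : V) : 1 ≤ q := by
  have h1 := hL.le_card v
  have h2 := card_le_univ (L v)
  rw [Fintype.card_fin] at h2
  omega

lemma SpareLists.pow_star_le (hL : SpareLists Δ G L) :
    (q : ℝ) ^ (star G v).card ≤ (q : ℝ) ^ (Δ + 1) :=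
  pow_le_pow_right₀ (by exact_mod_cast hL.q_pos v) hL.card_star_le

lemma SpareLists.fib_card_le (hL : SpareLists Δ G L) (hσ : σ ∈ proper G L) (v : V) :
    ((fib (proper G L) Λ σ).card : ℝ) ≤
      (q : ℝ) ^ (Δ + 1) * (fib (proper G L) (insert v Λ) σ).card := by
  have hq : (1 : ℝ) ≤ q := by exact_mod_cast hL.q_pos v
  by_cases hv : v ∈ Λ
  · rw [insert_eq_of_mem hv]
    exact le_mul_of_one_le_left (Nat.cast_nonneg _) (one_le_pow₀ hq)
  have key := sum_comp_le (A := fib (proper G L) Λ σ) (B := fib (proper G L) (insert v Λ) σ)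
    (T := force G L v (σ v)) (S := star G v) (f := fun _ => 1) (fun τ hτ => ?_)
    (fun τ _ w hw => force_of_notMem_star hw) (fun _ _ => zero_le_one)
  · simp only [sum_const, nsmul_eq_mul, mul_one] at key
    exact key.trans (mul_le_mul_of_nonneg_right hL.pow_star_le (Nat.cast_nonneg _))
  · rw [mem_fib] at hτ ⊢
    refine ⟨hL.force_mem hτ.1 ((mem_proper.1 hσ).1 v), fun w hw => ?_⟩
    rcases eq_or_ne w v with rfl | hwv
    · rw [force_self]
    · have hw' := (mem_insert.1 hw).resolve_left hwv
      rw [force_of_ne hwv, evict_of_not, hτ.2 w hw']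
      rw [hτ.2 w hw']
      exact fun h => (mem_proper.1 hσ).2 v w h.1 h.2.symm

lemma SpareLists.avg_insert_le (hL : SpareLists Δ G L) (hf : ∀ σ, 0 < f σ)
    (hσ : σ ∈ proper G L) (v : V) :
    avg (proper G L) (insert v Λ) f σ ≤ (q : ℝ) ^ (Δ + 1) * avg (proper G L) Λ f σ := by
  unfold avg
  have h1 := hL.fib_card_le (Λ := Λ) hσ v
  have h2 : ∑ τ ∈ fib (proper G L) (insert v Λ) σ, f τ ≤ ∑ τ ∈ fib (proper G L) Λ σ, f τ :=
    sum_le_sum_of_subset_of_nonneg (fib_anti (subset_insert _ _)) fun _ _ _ => (hf _).le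
  have hp := fib_card_pos (Λ := Λ) hσ
  have hp' := fib_card_pos (Λ := insert v Λ) hσ
  rw [mul_div_assoc', div_le_div_iff₀ hp' hp]
  have h3 : 0 ≤ ∑ τ ∈ fib (proper G L) Λ σ, f τ := sum_nonneg fun _ _ => (hf _).le
  calc _ ≤ (∑ τ ∈ fib (proper G L) Λ σ, f τ) * (fib (proper G L) Λ σ).card :=
        mul_le_mul_of_nonneg_right h2 hp.le
    _ ≤ (∑ τ ∈ fib (proper G L) Λ σ, f τ) *
          ((q : ℝ) ^ (Δ + 1) * (fib (proper G L) (insert v Λ) σ).card) :=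
        mul_le_mul_of_nonneg_left h1 h3
    _ = _ := by ring

end Surgery

section SecondDifference

variable {V : Type*} [Fintype V] {q : ℕ} {G : SimpleGraph V} {L : V → Finset (Fin q)}
  {σ τ ρ : V → Fin q} {c : Fin q} {f : (V → Fin q) → ℝ} {Λ : Finset V} {u v w i : V}
  {Δ : ℕ}

/-- The lists with the colors on `Λ` pinned to those of `σ`. -/
noncomputable def pin (L : V → Finset (Fin q)) (Λ : Finset V) (σ : V → Fin q) :
    V → Finset (Fin q) := fun v => if v ∈ Λ then {σ v} else L v

lemma fib_proper (hσ : σ ∈ proper G L) : fib (proper G L) Λ σ = proper G (pin L Λ σ) := by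
  ext τ
  rw [mem_fib, mem_proper, mem_proper, and_right_comm]
  refine and_congr_left fun _ => ⟨fun h v => ?_, fun h => ⟨fun v => ?_, fun v hv => ?_⟩⟩
  · unfold pin
    split_ifs with hv
    · exact mem_singleton.2 (h.2 v hv)
    · exact h.1 v
  · have := h v
    unfold pin at this
    split_ifs at this with hv
    · rw [mem_singleton.1 this]; exact (mem_proper.1 hσ).1 v
    · exact this
  · have := h v
    unfold pin at this
    rwa [if_pos hv, mem_singleton] at this

lemma LongLists.pin (hL : LongLists Δ G L) : LongLists Δ G (pin L Λ σ) where
  deg_le := hL.deg_le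
  card_list v := by
    unfold ListColoringMixing.pin
    split_ifs with hv
    · exact Or.inl (card_singleton _)
    · exact hL.card_list v

/-- The change of the conditional expectation when the color of `i` is revealed. -/
noncomputable def incr (P : Finset (V → Fin q)) (f : (V → Fin q) → ℝ) (Λ : Finset V) (i : V)
    (σ : V → Fin q) : ℝ := avg P (insert i Λ) f σ - avg P Λ f σ

lemma LongLists.sum_fib_sq_le (hL : LongLists Δ G L) (hσ : σ ∈ proper G L) :
    ∑ τ ∈ fib (proper G L) Λ σ, (∑ i, incr (proper G L) f Λ i τ) ^ 2 ≤
      24000 * q * ∑ i, ∑ τ ∈ fib (proper G L) Λ σ, incr (proper G L) f Λ i τ ^ 2 := by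
  set P := proper G L with hP
  set g : V → Fin q → ℝ := fun i d => (∑ ρ ∈ (fib P Λ σ).filter fun ρ => ρ i = d, f ρ) /
    ((fib P Λ σ).filter fun ρ => ρ i = d).card - avg P Λ f σ with hg
  have e : ∀ τ ∈ fib P Λ σ, ∀ i, g i (τ i) = incr P f Λ i τ := by
    intro τ hτ i
    have h1 : (fib P Λ σ).filter (fun ρ => ρ i = τ i) = fib P (insert i Λ) τ := by
      ext ρ
      rw [mem_filter, mem_fib, mem_fib, and_assoc]
      refine and_congr_right fun _ => ?_
      rw [forall_mem_insert, and_comm]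
      exact and_congr_right fun _ => forall₂_congr fun v hv => by rw [(mem_fib.1 hτ).2 v hv]
    rw [hg]
    simp only
    rw [h1]
    unfold incr
    rw [avg_congr (Λ := Λ) (mem_fib.1 hτ).2]
    rfl
  have key := sum_sq_sum_le (hL.pin (Λ := Λ) (σ := σ)) g ?_
  · rw [← fib_proper hσ, ← hP] at key
    rw [sum_congr rfl fun τ hτ => by rw [sum_congr rfl fun i _ => (e τ hτ i).symm]]
    refine key.trans (le_of_eq ?_)
    congr 1
    exact sum_congr rfl fun i _ => sum_congr rfl fun τ hτ => by rw [e τ hτ i]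
  · intro i
    rw [← fib_proper hσ, ← hP, sum_congr rfl fun τ hτ => e τ hτ i]
    unfold incr
    rw [sum_sub_distrib, sum_fib_avg (subset_insert _ _), sum_fib_avg Subset.rfl, sub_self]

lemma LongLists.sum_sq_div_le (hL : LongLists Δ G L) (hf : ∀ σ, 0 < f σ) :
    ∑ σ ∈ proper G L, (∑ i, incr (proper G L) f Λ i σ) ^ 2 / avg (proper G L) Λ f σ ≤
      24000 * q * ∑ i, ∑ σ ∈ proper G L,
        incr (proper G L) f Λ i σ ^ 2 / avg (proper G L) Λ f σ := by
  set P := proper G L with hP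
  have hd : DependsOn' Λ fun σ => (avg P Λ f σ)⁻¹ := fun σ τ h => by
    simp only [avg_congr h]
  simp only [div_eq_inv_mul]
  rw [← sum_dependsOn_mul_avg hd, sum_congr rfl fun i _ => (sum_dependsOn_mul_avg hd).symm,
    sum_comm, mul_sum]
  refine sum_le_sum fun σ hσ => ?_
  rw [← mul_sum, mul_left_comm]
  refine mul_le_mul_of_nonneg_left ?_ (inv_nonneg.2 (avg_pos hf hσ).le)
  unfold avg
  rw [← sum_div, mul_div_assoc']
  exact div_le_div_of_nonneg_right (hL.sum_fib_sq_le hσ) (Nat.cast_nonneg _)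

/-- The constant of the second-difference estimate. -/
def curvK (q Δ : ℕ) : ℕ := 24000 * q * (2 * (q ^ (Δ + 1) + 1))

/-- The entropy profile has almost nonnegative second differences. -/
lemma second_diff_ge (hL : LongLists Δ G L) (hS : SpareLists Δ G L) (hf : ∀ σ, 0 < f σ) :
    -(curvK q Δ * ∑ i, (entSum (proper G L) f (insert i Λ) - entSum (proper G L) f Λ)) ≤
      ∑ i, ∑ j ∈ univ.filter (fun j => j ≠ i),
        (entSum (proper G L) f (insert i (insert j Λ)) - entSum (proper G L) f (insert i Λ)
          - entSum (proper G L) f (insert j Λ) + entSum (proper G L) f Λ) := by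
  set P := proper G L with hP
  have h1 : ∀ i j, -∑ σ ∈ P, incr P f Λ i σ * incr P f Λ j σ / avg P Λ f σ ≤
      entSum P f (insert i (insert j Λ)) - entSum P f (insert i Λ) - entSum P f (insert j Λ) +
        entSum P f Λ := by
    intro i j
    have := entSum_second_diff (P := P) (Λ := Λ) (Λ₁ := insert i Λ) (Λ₂ := insert j Λ)
      (Λ₃ := insert i (insert j Λ)) hf (subset_insert _ _) (subset_insert _ _)
      (insert_subset_insert _ (subset_insert _ _)) (subset_insert _ _)
    rwa [sum_sub_mul_sub_div hf] at this
  refine le_trans ?_ (sum_le_sum fun i _ => sum_le_sum fun j _ => h1 i j)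
  have h2 : ∀ i, ∑ σ ∈ P, incr P f Λ i σ ^ 2 / avg P Λ f σ ≤
      2 * ((q : ℝ) ^ (Δ + 1) + 1) * (entSum P f (insert i Λ) - entSum P f Λ) := fun i =>
    sum_sq_sub_div_le hf (subset_insert _ _) (by positivity)
      fun σ hσ => hS.avg_insert_le hf hσ i
  have h3 := hL.sum_sq_div_le (Λ := Λ) hf
  rw [← hP] at h3
  have h4 : ∑ i, ∑ j ∈ univ.filter (fun j => j ≠ i),
      -∑ σ ∈ P, incr P f Λ i σ * incr P f Λ j σ / avg P Λ f σ =
      ∑ i, ∑ σ ∈ P, incr P f Λ i σ ^ 2 / avg P Λ f σ -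
        ∑ σ ∈ P, (∑ i, incr P f Λ i σ) ^ 2 / avg P Λ f σ := by
    have e1 : ∑ σ ∈ P, (∑ i, incr P f Λ i σ) ^ 2 / avg P Λ f σ =
        ∑ i, ∑ j, ∑ σ ∈ P, incr P f Λ i σ * incr P f Λ j σ / avg P Λ f σ := by
      rw [sum_congr rfl fun i _ => sum_comm, sum_comm]
      refine sum_congr rfl fun σ _ => ?_
      rw [sq, sum_mul_sum, sum_div]
      exact sum_congr rfl fun i _ => sum_div _ _ _
    rw [e1, ← sum_sub_distrib]
    refine sum_congr rfl fun i _ => ?_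
    rw [← sum_filter_add_sum_filter_not univ (fun j => j ≠ i), sum_neg_distrib]
    have : univ.filter (fun j => ¬ j ≠ i) = {i} := by ext; simp
    rw [this, sum_singleton]
    simp only [sq]
    ring
  rw [h4]
  have h5 : ∑ i, ∑ σ ∈ P, incr P f Λ i σ ^ 2 / avg P Λ f σ ≤
      2 * ((q : ℝ) ^ (Δ + 1) + 1) * ∑ i, (entSum P f (insert i Λ) - entSum P f Λ) := by
    rw [mul_sum]; exact sum_le_sum fun i _ => h2 i
  have h6 : 0 ≤ ∑ i, ∑ σ ∈ P, incr P f Λ i σ ^ 2 / avg P Λ f σ :=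
    sum_nonneg fun i _ => sum_nonneg fun σ hσ => div_nonneg (sq_nonneg _) (avg_pos hf hσ).le
  have h7 : (0 : ℝ) ≤ 24000 * q := by positivity
  have h8 := mul_le_mul_of_nonneg_left h5 h7
  have h9 : (curvK q Δ : ℝ) = 24000 * q * (2 * ((q : ℝ) ^ (Δ + 1) + 1)) := by
    unfold curvK; push_cast; ring
  rw [h9]
  linarith

end SecondDifference

section Bernoulli

variable {V : Type*} [Fintype V] {g h : Finset V → ℝ} {Λ A B : Finset V} {i j : V} {s t θ : ℝ}
  {K : ℕ}

/-- The Bernoulli weight of a set of vertices. -/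
noncomputable def berW (t : ℝ) (Λ : Finset V) : ℝ := ∏ v, if v ∈ Λ then t else 1 - t

/-- The Bernoulli weight away from `i`. -/
noncomputable def berWOff (t : ℝ) (i : V) (Λ : Finset V) : ℝ :=
  ∏ v ∈ univ.erase i, if v ∈ Λ then t else 1 - t

/-- The expectation of `g` at a random set containing each vertex with probability `t`. -/
noncomputable def berE (t : ℝ) (g : Finset V → ℝ) : ℝ := ∑ Λ, berW t Λ * g Λ

/-- The derivative of `g` in the direction `i`. -/
noncomputable def setDiff (i : V) (g : Finset V → ℝ) : Finset V → ℝ :=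
  fun Λ => g (insert i Λ) - g (Λ.erase i)

/-- The increment of `g` when `i` is added. -/
noncomputable def setAdd (i : V) (g : Finset V → ℝ) : Finset V → ℝ :=
  fun Λ => g (insert i Λ) - g Λ

lemma berW_nonneg (h0 : 0 ≤ t) (h1 : t ≤ 1) : 0 ≤ berW t Λ :=
  prod_nonneg fun v _ => by split_ifs <;> linarith

lemma berE_mono (h0 : 0 ≤ t) (h1 : t ≤ 1) (hgh : ∀ Λ, g Λ ≤ h Λ) : berE t g ≤ berE t h :=
  sum_le_sum fun Λ _ => mul_le_mul_of_nonneg_left (hgh Λ) (berW_nonneg h0 h1)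

lemma berE_sum {ι : Type*} (s : Finset ι) (g : ι → Finset V → ℝ) :
    berE t (fun Λ => ∑ i ∈ s, g i Λ) = ∑ i ∈ s, berE t (g i) := by
  unfold berE
  simp only [mul_sum]
  exact sum_comm

lemma berE_const_mul (c : ℝ) : berE t (fun Λ => c * g Λ) = c * berE t g := by
  unfold berE
  rw [mul_sum]
  exact sum_congr rfl fun _ _ => by ring

lemma berE_neg : berE t (fun Λ => -g Λ) = -berE t g := by
  unfold berE
  rw [← sum_neg_distrib]
  exact sum_congr rfl fun _ _ => by ring

/-- The weight of the sets containing `A` and disjoint from `B`. -/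
lemma sum_berW_filter (hAB : Disjoint A B) :
    ∑ Λ ∈ univ.filter (fun Λ => A ⊆ Λ ∧ Disjoint B Λ), berW t Λ =
      t ^ A.card * (1 - t) ^ B.card := by
  have h := prod_add (fun v : V => if v ∈ B then 0 else t)
    (fun v : V => if v ∈ A then 0 else 1 - t) univ
  have h1 : ∏ v : V, ((if v ∈ B then 0 else t) + (if v ∈ A then 0 else 1 - t)) =
      t ^ A.card * (1 - t) ^ B.card := by
    have e : ∀ v : V, ((if v ∈ B then 0 else t) + (if v ∈ A then 0 else 1 - t)) =
        (if v ∈ A then t else 1) * (if v ∈ B then 1 - t else 1) := by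
      intro v
      by_cases hA : v ∈ A
      · have := disjoint_left.1 hAB hA
        simp [hA, this]
      · by_cases hB : v ∈ B <;> simp [hA, hB]
    rw [prod_congr rfl fun v _ => e v, prod_mul_distrib, prod_ite_mem, prod_ite_mem]
    simp
  rw [← h1, h, powerset_univ, sum_filter]
  refine sum_congr rfl fun Λ _ => ?_
  have hW : berW t Λ = (∏ v ∈ Λ, t) * ∏ v ∈ univ \ Λ, (1 - t) := by
    unfold berW
    rw [prod_ite]
    congr 2
    · ext; simp
    · ext; simp
  split_ifs with hc
  · rw [hW]
    congr 1
    · exact prod_congr rfl fun v hv => (if_neg fun hB => disjoint_left.1 hc.2 hB hv).symm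
    · exact prod_congr rfl fun v hv => (if_neg fun hA => (mem_sdiff.1 hv).2 (hc.1 hA)).symm
  · rw [not_and_or] at hc
    symm
    rcases hc with hc | hc
    · obtain ⟨v, hvA, hv⟩ := not_subset.1 hc
      have : ∏ w ∈ univ \ Λ, (if w ∈ A then 0 else 1 - t) = 0 :=
        prod_eq_zero (mem_sdiff.2 ⟨mem_univ v, hv⟩) (if_pos hvA)
      rw [this, mul_zero]
    · obtain ⟨v, hvB, hv⟩ := not_disjoint_iff.1 hc
      have : ∏ w ∈ Λ, (if w ∈ B then 0 else t) = 0 := prod_eq_zero hv (if_pos hvB)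
      rw [this, zero_mul]

lemma sum_berW : ∑ Λ : Finset V, berW t Λ = 1 := by
  simpa using sum_berW_filter (t := t) (disjoint_empty_left (∅ : Finset V))

lemma berE_const (c : ℝ) : berE t (fun _ : Finset V => c) = c := by
  unfold berE
  rw [← sum_mul, sum_berW, one_mul]

lemma berE_sub : berE t (fun Λ => g Λ - h Λ) = berE t g - berE t h := by
  unfold berE
  rw [← sum_sub_distrib]
  exact sum_congr rfl fun _ _ => by ring

lemma berE_compl : berE t (fun Λ => g Λᶜ) = berE (1 - t) g := by
  unfold berE
  refine sum_nbij' (fun Λ => Λᶜ) (fun Λ => Λᶜ) (by simp) (by simp) (by simp) (by simp) ?_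
  intro Λ _
  congr 1
  unfold berW
  refine prod_congr rfl fun v _ => ?_
  by_cases hv : v ∈ Λ <;> simp [hv]

lemma berE_zero : berE 0 g = g ∅ := by
  unfold berE
  rw [sum_eq_single ∅]
  · simp [berW]
  · intro Λ _ hΛ
    obtain ⟨v, hv⟩ := nonempty_iff_ne_empty.2 hΛ
    have : berW 0 Λ = 0 := prod_eq_zero (mem_univ v) (if_pos hv)
    rw [this, zero_mul]
  · simp

lemma berE_one : berE 1 g = g univ := by
  have := berE_compl (t := 0) (g := g)
  rw [sub_zero] at this
  rw [← this, berE_zero, compl_empty]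

lemma sum_eq_sum_notMem (i : V) (F : Finset V → ℝ) :
    ∑ Λ, F Λ = ∑ Λ ∈ univ.filter (fun Λ => i ∉ Λ), (F Λ + F (insert i Λ)) := by
  rw [← sum_filter_add_sum_filter_not univ (fun Λ => i ∉ Λ), sum_add_distrib]
  congr 1
  symm
  refine sum_nbij' (fun Λ => insert i Λ) (fun Λ => Λ.erase i) ?_ ?_ ?_ ?_ ?_
  · intro Λ _; simp
  · intro Λ _; simp
  · intro Λ hΛ; exact erase_insert (mem_filter.1 hΛ).2
  · intro Λ hΛ; exact insert_erase (not_not.1 (mem_filter.1 hΛ).2)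
  · intro Λ _; rfl

lemma berW_of_notMem (hi : i ∉ Λ) : berW t Λ = (1 - t) * berWOff t i Λ := by
  unfold berW berWOff
  rw [← mul_prod_erase univ _ (mem_univ i), if_neg hi]

lemma berW_of_mem (hi : i ∈ Λ) : berW t Λ = t * berWOff t i Λ := by
  unfold berW berWOff
  rw [← mul_prod_erase univ _ (mem_univ i), if_pos hi]

lemma berWOff_insert : berWOff t i (insert i Λ) = berWOff t i Λ := by
  unfold berWOff
  refine prod_congr rfl fun v hv => ?_
  simp [ne_of_mem_erase hv]

lemma berE_setDiff : berE t (setDiff i g) =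
    ∑ Λ ∈ univ.filter (fun Λ => i ∉ Λ), berWOff t i Λ * (g (insert i Λ) - g Λ) := by
  unfold berE
  rw [sum_eq_sum_notMem i]
  refine sum_congr rfl fun Λ hΛ => ?_
  have hi := (mem_filter.1 hΛ).2
  rw [berW_of_notMem hi, berW_of_mem (mem_insert_self i Λ), berWOff_insert]
  unfold setDiff
  rw [insert_idem, erase_insert hi, erase_eq_of_notMem hi]
  ring

lemma berE_setAdd : berE t (setAdd i g) = (1 - t) * berE t (setDiff i g) := by
  rw [berE_setDiff, mul_sum]
  unfold berE
  rw [sum_eq_sum_notMem i]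
  refine sum_congr rfl fun Λ hΛ => ?_
  have hi := (mem_filter.1 hΛ).2
  rw [berW_of_notMem hi]
  unfold setAdd
  rw [insert_idem]
  ring

lemma setDiff_setAdd (hij : i ≠ j) : setDiff j (setAdd i g) = setAdd i (setDiff j g) := by
  funext Λ
  simp only [setDiff, setAdd]
  rw [Finset.insert_comm i j Λ, erase_insert_of_ne hij]
  ring

lemma setDiff_setDiff_self : setDiff i (setDiff i g) = 0 := by
  funext Λ
  simp only [setDiff, insert_idem, erase_insert_eq_erase, erase_idem, Pi.zero_apply]
  have : insert i (Λ.erase i) = insert i Λ := by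
    ext a
    by_cases ha : a = i <;> simp [ha]
  rw [this]
  ring

lemma berE_setAdd_setAdd (hij : i ≠ j) :
    berE t (setAdd j (setAdd i g)) = (1 - t) ^ 2 * berE t (setDiff i (setDiff j g)) := by
  rw [berE_setAdd, setDiff_setAdd hij, berE_setAdd]
  ring

lemma hasDerivAt_berW : HasDerivAt (fun t => berW t Λ)
    (∑ i, berWOff t i Λ * if i ∈ Λ then 1 else -1) t := by
  unfold berW berWOff
  have := HasDerivAt.fun_finsetProd (u := univ) (x := t)
    (f := fun (v : V) (t : ℝ) => if v ∈ Λ then t else 1 - t)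
    (f' := fun v => if v ∈ Λ then 1 else -1) (fun v _ => by
      by_cases hv : v ∈ Λ
      · simp only [hv, if_true]; exact hasDerivAt_id t
      · simp only [hv, if_false]
        simpa using (hasDerivAt_id t).const_sub 1)
  simpa using this

lemma hasDerivAt_berE : HasDerivAt (fun t => berE t g) (∑ i, berE t (setDiff i g)) t := by
  unfold berE
  have h1 : HasDerivAt (fun t => ∑ Λ, berW t Λ * g Λ)
      (∑ Λ, (∑ i, berWOff t i Λ * if i ∈ Λ then 1 else -1) * g Λ) t :=
    HasDerivAt.fun_sum fun Λ _ => hasDerivAt_berW.mul_const _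
  convert h1 using 1
  simp only [sum_mul]
  conv_rhs => rw [sum_comm]
  refine sum_congr rfl fun i _ => ?_
  have := berE_setDiff (V := V) (t := t) (i := i) (g := g)
  unfold berE at this
  rw [this, sum_eq_sum_notMem i]
  refine sum_congr rfl fun Λ hΛ => ?_
  have hi := (mem_filter.1 hΛ).2
  rw [if_neg hi, if_pos (mem_insert_self _ _), berWOff_insert]
  ring

/-- The derivative of the Bernoulli expectation. -/
noncomputable def berD (t : ℝ) (g : Finset V → ℝ) : ℝ := ∑ i, berE t (setDiff i g)

lemma hasDerivAt_berD :
    HasDerivAt (fun t => berD t g) (∑ i, ∑ j, berE t (setDiff j (setDiff i g))) t := by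
  unfold berD
  exact HasDerivAt.fun_sum fun i _ => hasDerivAt_berE

lemma berD_nonneg (hg : ∀ i Λ, g Λ ≤ g (insert i Λ)) (h0 : 0 ≤ t) (h1 : t ≤ 1) :
    0 ≤ berD t g := by
  refine sum_nonneg fun i _ => sum_nonneg fun Λ _ => mul_nonneg (berW_nonneg h0 h1) ?_
  unfold setDiff
  by_cases hi : i ∈ Λ
  · have := hg i (Λ.erase i)
    rw [insert_erase hi] at this
    rw [insert_eq_of_mem hi]
    linarith
  · rw [erase_eq_of_notMem hi]
    linarith [hg i Λ]

/-- A uniform lower bound on the second differences. -/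
def CurvBound (K : ℕ) (g : Finset V → ℝ) : Prop := ∀ Λ,
  -(K * ∑ i, (g (insert i Λ) - g Λ)) ≤ ∑ i, ∑ j ∈ univ.filter (fun j => j ≠ i),
    (g (insert i (insert j Λ)) - g (insert i Λ) - g (insert j Λ) + g Λ)

lemma CurvBound.deriv_ge (hK : CurvBound K g) (h0 : 0 ≤ t) (h1 : t < 1) :
    -(K * berD t g) ≤ (1 - t) * ∑ i, ∑ j, berE t (setDiff j (setDiff i g)) := by
  have h1' : 0 < 1 - t := by linarith
  have h2 := berE_mono h0 h1.le hK
  rw [berE_neg, berE_const_mul, berE_sum, berE_sum] at h2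
  have e1 : ∑ i : V, berE t (fun Λ => g (insert i Λ) - g Λ) = (1 - t) * berD t g := by
    unfold berD
    rw [mul_sum]
    exact sum_congr rfl fun i _ => berE_setAdd
  have e2 : ∑ i : V, berE t (fun Λ => ∑ j ∈ univ.filter (fun j => j ≠ i),
      (g (insert i (insert j Λ)) - g (insert i Λ) - g (insert j Λ) + g Λ)) =
      (1 - t) ^ 2 * ∑ i, ∑ j, berE t (setDiff j (setDiff i g)) := by
    rw [mul_sum]
    refine sum_congr rfl fun i _ => ?_
    rw [berE_sum, ← sum_filter_add_sum_filter_not univ (fun j => j ≠ i)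
      (fun j => berE t (setDiff j (setDiff i g))), mul_add, mul_sum]
    have : univ.filter (fun j => ¬ j ≠ i) = {i} := by ext; simp
    rw [this, sum_singleton, setDiff_setDiff_self]
    have e0 : berE t (0 : Finset V → ℝ) = 0 := by simp [berE]
    rw [e0, mul_zero, add_zero]
    refine sum_congr rfl fun j hj => ?_
    rw [← berE_setAdd_setAdd (mem_filter.1 hj).2]
    congr 1
    funext Λ
    unfold setAdd
    rw [Finset.insert_comm]
    ring
  rw [e1, e2] at h2
  have h3 : (1 - t) * (-(K * berD t g)) ≤
      (1 - t) * ((1 - t) * ∑ i, ∑ j, berE t (setDiff j (setDiff i g))) := by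
    linarith
  exact le_of_mul_le_mul_left h3 h1'

lemma CurvBound.monotoneOn (hK : CurvBound K g) :
    MonotoneOn (fun t => berD t g * ((1 - t) ^ K)⁻¹) (Set.Ico 0 1) := by
  have hd : ∀ t ∈ Set.Ico (0 : ℝ) 1, HasDerivAt (fun t => berD t g * ((1 - t) ^ K)⁻¹)
      ((∑ i, ∑ j, berE t (setDiff j (setDiff i g))) * ((1 - t) ^ K)⁻¹ +
        berD t g * (K * ((1 - t) ^ (K + 1))⁻¹)) t := by
    intro t ht
    have hp : 0 < 1 - t := by linarith [ht.2]
    refine hasDerivAt_berD.mul ?_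
    have h1 : HasDerivAt (fun t : ℝ => 1 - t) (-1) t := by
      simpa using (hasDerivAt_id t).const_sub 1
    have h2 := (h1.fun_pow K).fun_inv (pow_pos hp K).ne'
    convert h2 using 1
    rcases K with _ | K
    · simp
    · simp only [Nat.add_sub_cancel]
      field_simp
      ring
  refine monotoneOn_of_deriv_nonneg (convex_Ico 0 1)
    (fun t ht => (hd t ht).continuousAt.continuousWithinAt)
    (fun t ht => (hd t (interior_subset ht)).differentiableAt.differentiableWithinAt) ?_
  intro t ht
  have ht' := interior_subset ht
  rw [(hd t ht').deriv]
  have hp : 0 < 1 - t := by linarith [ht'.2]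
  have h := hK.deriv_ge ht'.1 ht'.2
  have e : (∑ i, ∑ j, berE t (setDiff j (setDiff i g))) * ((1 - t) ^ K)⁻¹ +
      berD t g * (K * ((1 - t) ^ (K + 1))⁻¹) =
      ((1 - t) * (∑ i, ∑ j, berE t (setDiff j (setDiff i g))) + K * berD t g) *
        ((1 - t) ^ (K + 1))⁻¹ := by
    field_simp
    ring
  rw [e]
  exact mul_nonneg (by linarith) (inv_nonneg.2 (pow_pos hp _).le)

/-- The constant comparing the full increment of `g` to that over the last fraction `θ`. -/
noncomputable def tailConst (K : ℕ) (θ : ℝ) : ℝ := 1 + 2 * 2 ^ K / (θ * θ ^ K)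

lemma CurvBound.sub_le (hK : CurvBound K g) (hg : ∀ i Λ, g Λ ≤ g (insert i Λ)) (hθ : 0 < θ)
    (hθ1 : θ ≤ 1) :
    g univ - g ∅ ≤ tailConst K θ * berE θ (fun S => g univ - g Sᶜ) := by
  have hs0 : 0 ≤ 1 - θ := by linarith
  set s := 1 - θ with hs
  set r := 1 - θ / 2 with hr
  have hmono := hK.monotoneOn
  have hd : ∀ t, HasDerivAt (fun t => berE t g) (berD t g) t := fun t => hasDerivAt_berE
  have hcont : Continuous fun t => berE t g :=
    continuous_iff_continuousAt.2 fun t => (hd t).continuousAt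
  have hdiff : Differentiable ℝ fun t => berE t g := fun t => (hd t).differentiableAt
  have hψs := berD_nonneg hg hs0 (by linarith : s ≤ 1)
  have hms : s ∈ Set.Ico (0 : ℝ) 1 := ⟨hs0, by linarith⟩
  have hse : 1 - s = θ := by rw [hs]; ring
  -- the initial segment
  have hA : berE s g - berE 0 g ≤ berD s g * (θ ^ K)⁻¹ := by
    have := Convex.image_sub_le_mul_sub_of_deriv_le (convex_Icc 0 s) hcont.continuousOn
      (hdiff.differentiableOn) (C := berD s g * (θ ^ K)⁻¹) (fun t ht => by
        rw [interior_Icc] at ht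
        rw [(hd t).deriv]
        have ht1 : t < 1 := by linarith [ht.2]
        have h := hmono ⟨ht.1.le, ht1⟩ hms ht.2.le
        simp only [hse] at h
        refine le_trans ?_ h
        have hψ := berD_nonneg hg ht.1.le ht1.le
        refine le_mul_of_one_le_right hψ ?_
        have h1t : 0 < 1 - t := by linarith
        exact (one_le_inv₀ (pow_pos h1t K)).2 (pow_le_one₀ h1t.le (by linarith [ht.1])))
      0 (Set.left_mem_Icc.2 hs0) s (Set.right_mem_Icc.2 hs0) hs0
    refine this.trans ?_
    have hc : 0 ≤ berD s g * (θ ^ K)⁻¹ := by positivity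
    nlinarith
  -- the middle segment
  have hB : berD s g * (2 ^ K)⁻¹ * (θ / 2) ≤ berE r g - berE s g := by
    have hsr : s ≤ r := by rw [hs, hr]; linarith
    have := Convex.mul_sub_le_image_sub_of_le_deriv (convex_Icc s r) hcont.continuousOn
      (hdiff.differentiableOn) (C := berD s g * (2 ^ K)⁻¹) (fun t ht => by
        rw [interior_Icc] at ht
        rw [(hd t).deriv]
        have ht1 : t < 1 := by linarith [ht.2]
        have h := hmono hms ⟨hs0.trans ht.1.le, ht1⟩ ht.1.le
        simp only [hse] at h
        have h1t : θ / 2 ≤ 1 - t := by linarith [ht.2]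
        have h1t' : 0 < 1 - t := by linarith
        have hψ := berD_nonneg hg (hs0.trans ht.1.le) ht1.le
        have h3 : berD s g * ((1 - t) ^ K / θ ^ K) ≤ berD t g := by
          have := mul_le_mul_of_nonneg_right h (pow_pos h1t' K).le
          rw [inv_mul_cancel_right₀ (pow_pos h1t' K).ne'] at this
          refine le_trans (le_of_eq ?_) this
          field_simp
        refine le_trans (mul_le_mul_of_nonneg_left ?_ hψs) h3
        rw [← div_pow, ← inv_pow]
        refine pow_le_pow_left₀ (by norm_num) ?_ K
        rw [le_div_iff₀ hθ]; linarith)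
      s (Set.left_mem_Icc.2 hsr) r (Set.right_mem_Icc.2 hsr) hsr
    have e : r - s = θ / 2 := by rw [hs, hr]; ring
    rwa [e] at this
  -- the final segment
  have hC : berE r g ≤ berE 1 g := by
    have hr1 : r ≤ 1 := by linarith
    have := Convex.mul_sub_le_image_sub_of_le_deriv (convex_Icc r 1) hcont.continuousOn
      (hdiff.differentiableOn) (C := 0) (fun t ht => by
        rw [interior_Icc] at ht
        rw [(hd t).deriv]
        exact berD_nonneg hg (by linarith [ht.1]) ht.2.le)
      r (Set.left_mem_Icc.2 hr1) 1 (Set.right_mem_Icc.2 hr1) hr1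
    linarith
  have hE : berE θ (fun S => g univ - g Sᶜ) = berE 1 g - berE s g := by
    rw [berE_sub, berE_const, berE_one, berE_compl]
  rw [hE]
  rw [berE_zero] at hA
  have h1 := berE_one (g := g)
  have hX : berD s g * (2 ^ K)⁻¹ * (θ / 2) ≤ berE 1 g - berE s g := by linarith
  have hY : berD s g * (θ ^ K)⁻¹ ≤ 2 * 2 ^ K / (θ * θ ^ K) * (berE 1 g - berE s g) := by
    have hc : 0 ≤ 2 * 2 ^ K / (θ * θ ^ K) := by positivity
    refine le_trans (le_of_eq ?_) (mul_le_mul_of_nonneg_left hX hc)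
    field_simp
  unfold tailConst
  linarith

end Bernoulli

section CrudeFactorization

variable {V : Type*} [Fintype V] {q : ℕ} {G : SimpleGraph V} {L : V → Finset (Fin q)}
  {σ τ ρ : V → Fin q} {c : ℝ} {f F X Y : (V → Fin q) → ℝ} {Λ U W : Finset V} {u v w i : V}
  {Δ : ℕ} {P : Finset (V → Fin q)}

lemma sum_le_sum_of_fib (h : ∀ σ ∈ P, ∑ τ ∈ fib P Λ σ, X τ ≤ ∑ τ ∈ fib P Λ σ, Y τ) :
    ∑ σ ∈ P, X σ ≤ ∑ σ ∈ P, Y σ := by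
  rw [← sum_avg (Λ := Λ) (f := X), ← sum_avg (Λ := Λ) (f := Y)]
  exact sum_le_sum fun σ hσ => div_le_div_of_nonneg_right (h σ hσ) (Nat.cast_nonneg _)

/-- The expected conditional variance given `Λ`, up to normalization. -/
noncomputable def varSum (P : Finset (V → Fin q)) (F : (V → Fin q) → ℝ) (Λ : Finset V) : ℝ :=
  ∑ σ ∈ P, (F σ - avg P Λ F σ) ^ 2

lemma avg_eq_of_mem_fib (hτ : τ ∈ fib P Λ σ) : avg P Λ F τ = avg P Λ F σ :=
  avg_congr (mem_fib.1 hτ).2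

lemma card_mul_avg (hσ : σ ∈ P) : (fib P Λ σ).card * avg P Λ F σ = ∑ τ ∈ fib P Λ σ, F τ :=
  mul_div_cancel₀ _ (fib_card_pos hσ).ne'

lemma sum_fib_sq_sub_avg_le (hσ : σ ∈ P) (c : ℝ) :
    ∑ τ ∈ fib P Λ σ, (F τ - avg P Λ F τ) ^ 2 ≤ ∑ τ ∈ fib P Λ σ, (F τ - c) ^ 2 := by
  rw [sum_congr rfl fun τ hτ => by rw [avg_eq_of_mem_fib hτ]]
  set m := avg P Λ F σ with hm
  have hN := fib_card_pos (Λ := Λ) hσ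
  have h1 : ∑ τ ∈ fib P Λ σ, F τ = (fib P Λ σ).card * m := (card_mul_avg hσ).symm
  have h2 : ∀ c : ℝ, ∑ τ ∈ fib P Λ σ, (F τ - c) ^ 2 =
      ∑ τ ∈ fib P Λ σ, F τ ^ 2 - 2 * c * ((fib P Λ σ).card * m) + (fib P Λ σ).card * c ^ 2 := by
    intro c
    rw [← h1, mul_sum, ← nsmul_eq_mul, ← sum_const, ← sum_sub_distrib, ← sum_add_distrib]
    exact sum_congr rfl fun _ _ => by ring
  rw [h2, h2]
  nlinarith [mul_nonneg hN.le (sq_nonneg (m - c))]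

lemma card_mul_sum_fib_sq_le (hσ : σ ∈ P) :
    (fib P Λ σ).card * ∑ τ ∈ fib P Λ σ, (F τ - avg P Λ F τ) ^ 2 ≤
      ∑ ρ ∈ fib P Λ σ, ∑ τ ∈ fib P Λ σ, (F τ - F ρ) ^ 2 := by
  rw [← nsmul_eq_mul, ← sum_const]
  exact sum_le_sum fun ρ _ => sum_fib_sq_sub_avg_le hσ (F ρ)

lemma sq_sub_le_of_mem (h : ∀ w ∈ Λ, τ w = ρ w) :
    (F τ - F ρ) ^ 2 ≤ 2 * (F τ - avg P Λ F τ) ^ 2 + 2 * (F ρ - avg P Λ F ρ) ^ 2 := by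
  rw [avg_congr (P := P) (f := F) h]
  nlinarith [sq_nonneg (F τ + F ρ - 2 * avg P Λ F ρ)]

lemma SpareLists.sum_fib_sq_le (hL : SpareLists Δ G L) (hσ : σ ∈ proper G L) (v : V)
    (U : Finset V) :
    ∑ τ ∈ fib (proper G L) (insert v U)ᶜ σ,
        (F τ - avg (proper G L) (insert v U)ᶜ F τ) ^ 2 ≤
      ∑ τ ∈ fib (proper G L) (insert v U)ᶜ σ, 24 * (q : ℝ) ^ (Δ + 1) *
        ((F τ - avg (proper G L) Uᶜ F τ) ^ 2 + (F τ - avg (proper G L) {v}ᶜ F τ) ^ 2) := by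
  set P := proper G L with hP
  set B := fib P (insert v U)ᶜ σ with hB
  set a : (V → Fin q) → ℝ := fun τ => (F τ - avg P Uᶜ F τ) ^ 2 with ha
  set b : (V → Fin q) → ℝ := fun τ => (F τ - avg P {v}ᶜ F τ) ^ 2 with hb
  set R : ℝ := (q : ℝ) ^ (Δ + 1) with hR
  have hR1 : 1 ≤ R := one_le_pow₀ (by exact_mod_cast hL.q_pos v)
  have ha0 : ∀ τ, 0 ≤ a τ := fun τ => sq_nonneg _
  have hb0 : ∀ τ, 0 ≤ b τ := fun τ => sq_nonneg _
  have hBcard : (0 : ℝ) < B.card := fib_card_pos hσ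
  have hfix : ∀ τ ∈ B, ∀ ρ ∈ B, ∀ w ∉ U, w ≠ v → ρ w = τ w := by
    intro τ hτ ρ hρ w hw hwv
    have hw' : w ∈ (insert v U)ᶜ := by simp [hw, hwv]
    rw [(mem_fib.1 hτ).2 w hw', (mem_fib.1 hρ).2 w hw']
  have hev : ∀ τ ∈ B, ∀ ρ ∈ B, ∀ w ∉ U, evict G L v (ρ v) τ w = τ w := by
    intro τ hτ ρ hρ w hw
    rcases eq_or_ne w v with rfl | hwv
    · exact evict_self
    · refine evict_of_not fun h => ?_
      rw [← hfix τ hτ ρ hρ w hw hwv] at h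
      exact (mem_proper.1 (mem_fib.1 hρ).1).2 v w h.1 h.2.symm
  have hevB : ∀ τ ∈ B, ∀ ρ ∈ B, evict G L v (ρ v) τ ∈ B := by
    intro τ hτ ρ hρ
    refine mem_fib.2 ⟨hL.evict_mem (mem_fib.1 hτ).1, fun w hw => ?_⟩
    rw [mem_compl, mem_insert, not_or] at hw
    rw [hev τ hτ ρ hρ w hw.2]
    exact (mem_fib.1 hτ).2 w (by simp [hw])
  have hfoB : ∀ τ ∈ B, ∀ ρ ∈ B, force G L v (ρ v) τ ∈ B := by
    intro τ hτ ρ hρ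
    refine mem_fib.2 ⟨hL.force_mem (mem_fib.1 hτ).1
      ((mem_proper.1 (mem_fib.1 hρ).1).1 v), fun w hw => ?_⟩
    rw [mem_compl, mem_insert, not_or] at hw
    rw [force_of_ne hw.1, hev τ hτ ρ hρ w hw.2]
    exact (mem_fib.1 hτ).2 w (by simp [hw])
  have hpt : ∀ τ ∈ B, ∀ ρ ∈ B, (F τ - F ρ) ^ 2 ≤
      6 * (a τ + a (evict G L v (ρ v) τ) + (b (evict G L v (ρ v) τ) + b (force G L v (ρ v) τ)) +
        (a (force G L v (ρ v) τ) + a ρ)) := by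
    intro τ hτ ρ hρ
    have h1 := sq_sub_le_of_mem (P := P) (F := F) (Λ := Uᶜ) (τ := τ)
      (ρ := evict G L v (ρ v) τ) fun w hw => (hev τ hτ ρ hρ w (mem_compl.1 hw)).symm
    have h2 := sq_sub_le_of_mem (P := P) (F := F) (Λ := {v}ᶜ) (τ := evict G L v (ρ v) τ)
      (ρ := force G L v (ρ v) τ) fun w hw => (force_of_ne (by simpa using hw)).symm
    have h3 := sq_sub_le_of_mem (P := P) (F := F) (Λ := Uᶜ) (τ := force G L v (ρ v) τ)
      (ρ := ρ) fun w hw => by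
        rcases eq_or_ne w v with rfl | hwv
        · exact force_self
        · rw [force_of_ne hwv, hev τ hτ ρ hρ w (mem_compl.1 hw),
            hfix τ hτ ρ hρ w (mem_compl.1 hw) hwv]
    simp only [ha, hb]
    set x := F τ
    set y := F (evict G L v (ρ v) τ)
    set z := F (force G L v (ρ v) τ)
    set t := F ρ
    have : (x - t) ^ 2 ≤ 3 * ((x - y) ^ 2 + (y - z) ^ 2 + (z - t) ^ 2) := by
      nlinarith [sq_nonneg ((x - y) - (y - z)), sq_nonneg ((y - z) - (z - t)),
        sq_nonneg ((x - y) - (z - t))]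
    linarith
  have hsum : ∀ ρ ∈ B, ∑ τ ∈ B, (F τ - F ρ) ^ 2 ≤
      6 * (∑ τ ∈ B, a τ + R * ∑ τ ∈ B, a τ + (R * ∑ τ ∈ B, b τ + R * ∑ τ ∈ B, b τ) +
        (R * ∑ τ ∈ B, a τ + B.card * a ρ)) := by
    intro ρ hρ
    refine (sum_le_sum fun τ hτ => hpt τ hτ ρ hρ).trans ?_
    rw [← mul_sum]
    simp only [sum_add_distrib]
    rw [sum_const, nsmul_eq_mul]
    have hs : ∀ X : (V → Fin q) → ℝ, (∀ τ, 0 ≤ X τ) →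
        (q : ℝ) ^ (star G v).card * ∑ τ ∈ B, X τ ≤ R * ∑ τ ∈ B, X τ := fun X hX =>
      mul_le_mul_of_nonneg_right hL.pow_star_le (sum_nonneg fun _ _ => hX _)
    have he : ∀ X : (V → Fin q) → ℝ, (∀ τ, 0 ≤ X τ) →
        ∑ τ ∈ B, X (evict G L v (ρ v) τ) ≤ R * ∑ τ ∈ B, X τ := fun X hX =>
      (sum_comp_le (T := evict G L v (ρ v)) (fun τ hτ => hevB τ hτ ρ hρ)
        (fun τ _ w hw => evict_of_notMem_star hw) fun τ _ => hX τ).trans (hs X hX)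
    have hf : ∀ X : (V → Fin q) → ℝ, (∀ τ, 0 ≤ X τ) →
        ∑ τ ∈ B, X (force G L v (ρ v) τ) ≤ R * ∑ τ ∈ B, X τ := fun X hX =>
      (sum_comp_le (T := force G L v (ρ v)) (fun τ hτ => hfoB τ hτ ρ hρ)
        (fun τ _ w hw => force_of_notMem_star hw) fun τ _ => hX τ).trans (hs X hX)
    have := he a ha0
    have := he b hb0
    have := hf a ha0
    have := hf b hb0
    linarith
  have key := (card_mul_sum_fib_sq_le (F := F) (Λ := (insert v U)ᶜ) hσ).trans (sum_le_sum hsum)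
  simp only [← mul_sum, sum_add_distrib, sum_const, nsmul_eq_mul, ← hB] at key
  rw [← mul_sum, sum_add_distrib]
  refine le_of_mul_le_mul_left (key.trans ?_) hBcard
  have hA : 0 ≤ ∑ τ ∈ B, a τ := sum_nonneg fun _ _ => ha0 _
  have hBb : 0 ≤ ∑ τ ∈ B, b τ := sum_nonneg fun _ _ => hb0 _
  have h1 : ∑ τ ∈ B, a τ ≤ R * ∑ τ ∈ B, a τ := le_mul_of_one_le_left hA hR1
  have h2 : 0 ≤ R * ∑ τ ∈ B, b τ := by positivity
  have h3 : (B.card : ℝ) * (6 * (2 * ∑ τ ∈ B, a τ + 2 * (R * ∑ τ ∈ B, a τ) +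
      2 * (R * ∑ τ ∈ B, b τ))) ≤
      B.card * (24 * R * (∑ τ ∈ B, a τ + ∑ τ ∈ B, b τ)) := by
    refine mul_le_mul_of_nonneg_left ?_ hBcard.le
    linarith
  linarith

lemma SpareLists.varSum_insert_le (hL : SpareLists Δ G L) (v : V) (U : Finset V) :
    varSum (proper G L) F (insert v U)ᶜ ≤ 24 * (q : ℝ) ^ (Δ + 1) *
      (varSum (proper G L) F Uᶜ + varSum (proper G L) F {v}ᶜ) := by
  unfold varSum
  rw [← sum_add_distrib, mul_sum]
  exact sum_le_sum_of_fib fun σ hσ => hL.sum_fib_sq_le hσ v U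

lemma varSum_nonneg : 0 ≤ varSum P F Λ := sum_nonneg fun _ _ => sq_nonneg _

lemma SpareLists.varSum_le (hL : SpareLists Δ G L) (U : Finset V) :
    varSum (proper G L) F Uᶜ ≤ (24 * (q : ℝ) ^ (Δ + 1)) ^ U.card *
      ∑ v ∈ U, varSum (proper G L) F {v}ᶜ := by
  induction U using Finset.induction_on with
  | empty =>
    unfold varSum
    rw [compl_empty, sum_congr rfl fun σ hσ => by rw [avg_univ hσ, sub_self]]
    simp
  | insert v U hv ih =>
    have hq : (1 : ℝ) ≤ 24 * (q : ℝ) ^ (Δ + 1) := by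
      have : (1 : ℝ) ≤ (q : ℝ) ^ (Δ + 1) := one_le_pow₀ (by exact_mod_cast hL.q_pos v)
      linarith
    refine (hL.varSum_insert_le v U).trans ?_
    rw [card_insert_of_notMem hv, sum_insert hv,
      pow_succ' (24 * (q : ℝ) ^ (Δ + 1)), mul_assoc (24 * (q : ℝ) ^ (Δ + 1))]
    refine mul_le_mul_of_nonneg_left ?_ (show (0 : ℝ) ≤ 24 * (q : ℝ) ^ (Δ + 1) by positivity)
    rw [mul_add, add_comm]
    refine add_le_add ?_ ih
    exact le_mul_of_one_le_left varSum_nonneg (one_le_pow₀ hq)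

/-- The expected conditional entropy of the coordinates in `U` given the others. -/
noncomputable def condEnt (P : Finset (V → Fin q)) (f : (V → Fin q) → ℝ) (U : Finset V) : ℝ :=
  entSum P f univ - entSum P f Uᶜ

lemma condEnt_nonneg (hf : ∀ σ, 0 < f σ) : 0 ≤ condEnt P f U :=
  sub_nonneg.2 (entSum_mono hf (subset_univ _))

lemma varSum_sqrt_le (hf : ∀ σ, 0 < f σ) :
    varSum P (fun σ => √(f σ)) Uᶜ ≤ condEnt P f U := by
  refine le_trans ?_ (sum_sq_sqrt_sub_le hf (subset_univ _))
  unfold varSum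
  refine sum_le_sum_of_fib (Λ := Uᶜ) fun σ hσ => ?_
  refine (sum_fib_sq_sub_avg_le hσ (√(avg P Uᶜ f σ))).trans (le_of_eq ?_)
  refine sum_congr rfl fun τ hτ => ?_
  rw [avg_univ (mem_fib.1 hτ).1, avg_eq_of_mem_fib hτ]

lemma mul_log_div_sub_le {x y : ℝ} (hx : 0 < x) (hy : 0 < y) :
    x * Real.log (x / y) - x + y ≤ (x - y) ^ 2 / y := by
  have h := mul_le_mul_of_nonneg_left (Real.log_le_sub_one_of_pos (div_pos hx hy)) hx.le
  have e : (x - y) ^ 2 / y = x * (x / y - 1) - x + y := by field_simp; ring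
  linarith

lemma card_fib_compl_le : (fib P Uᶜ σ).card ≤ q ^ U.card := by
  refine le_trans (le_of_eq ?_) (card_agreeOff_le (A := P) (S := U) (σ := σ))
  unfold fib
  simp only [mem_compl]

lemma sum_fib_sq_sub_avg_div_le (hf : ∀ σ, 0 < f σ) (hσ : σ ∈ P) :
    ∑ τ ∈ fib P Λ σ, (f τ - avg P Λ f τ) ^ 2 / avg P Λ f τ ≤
      ∑ τ ∈ fib P Λ σ, 2 * ((fib P Λ σ).card + 1) *
        (√(f τ) - avg P Λ (fun σ => √(f σ)) τ) ^ 2 := by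
  set B := fib P Λ σ with hB
  set M := avg P Λ f σ with hM
  set m := avg P Λ (fun σ => √(f σ)) σ with hm
  have hM0 : 0 < M := avg_pos hf hσ
  have hm0 : 0 < m := avg_pos (fun σ => Real.sqrt_pos.2 (hf σ)) hσ
  have hN : (0 : ℝ) < B.card := fib_card_pos hσ
  have e1 : ∀ τ ∈ B, (f τ - avg P Λ f τ) ^ 2 / avg P Λ f τ = (f τ - M) ^ 2 / M :=
    fun τ hτ => by rw [avg_eq_of_mem_fib hτ]
  have e2 : ∀ τ ∈ B, 2 * ((B.card : ℝ) + 1) * (√(f τ) - avg P Λ (fun σ => √(f σ)) τ) ^ 2 =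
      2 * ((B.card : ℝ) + 1) * (√(f τ) - m) ^ 2 :=
    fun τ hτ => by rw [avg_eq_of_mem_fib (F := fun σ => √(f σ)) hτ]
  rw [sum_congr rfl e1, sum_congr rfl e2]
  rw [← sum_div, div_le_iff₀ hM0]
  have h1 : ∑ τ ∈ B, (f τ - M) ^ 2 ≤ ∑ τ ∈ B, (f τ - m ^ 2) ^ 2 := by
    refine le_trans (le_of_eq ?_) (sum_fib_sq_sub_avg_le (F := f) hσ (m ^ 2))
    exact sum_congr rfl fun τ hτ => by rw [avg_eq_of_mem_fib hτ]
  refine h1.trans ?_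
  rw [sum_mul]
  refine sum_le_sum fun τ hτ => ?_
  have hfB : ∑ τ ∈ B, f τ = B.card * M := (card_mul_avg hσ).symm
  have hsB : ∑ τ ∈ B, √(f τ) = B.card * m :=
    (card_mul_avg (F := fun σ => √(f σ)) hσ).symm
  have h2 : f τ ≤ B.card * M := by
    rw [← hfB]; exact single_le_sum (fun τ _ => (hf τ).le) hτ
  have h3 : m ^ 2 ≤ M := by
    have := sq_sum_le_card_mul_sum_sq (s := B) (f := fun τ => √(f τ))
    rw [hsB, sum_congr rfl fun τ _ => Real.sq_sqrt (hf τ).le, hfB] at this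
    have h4 : (B.card : ℝ) ^ 2 * m ^ 2 ≤ (B.card : ℝ) ^ 2 * M := by nlinarith
    exact le_of_mul_le_mul_left h4 (by positivity)
  have hx := Real.sq_sqrt (hf τ).le
  set x := √(f τ)
  rw [← hx]
  have e : (x ^ 2 - m ^ 2) ^ 2 = (x - m) ^ 2 * (x + m) ^ 2 := by ring
  rw [e]
  have h5 : (x + m) ^ 2 ≤ 2 * (B.card + 1) * M := by nlinarith [sq_nonneg (x - m)]
  have := mul_le_mul_of_nonneg_left h5 (sq_nonneg (x - m))
  linarith

lemma condEnt_le_varSum (hf : ∀ σ, 0 < f σ) :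
    condEnt P f U ≤ 2 * ((q : ℝ) ^ U.card + 1) * varSum P (fun σ => √(f σ)) Uᶜ := by
  unfold condEnt
  rw [entSum_sub hf (subset_univ _)]
  refine (sum_le_sum fun σ hσ => mul_log_div_sub_le (avg_pos hf hσ) (avg_pos hf hσ)).trans ?_
  unfold varSum
  rw [mul_sum, sum_congr rfl fun σ hσ => by rw [avg_univ hσ]]
  refine sum_le_sum_of_fib (Λ := Uᶜ) fun σ hσ => (sum_fib_sq_sub_avg_div_le hf hσ).trans ?_
  refine sum_le_sum fun τ _ => mul_le_mul_of_nonneg_right ?_ (sq_nonneg _)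
  have : ((fib P Uᶜ σ).card : ℝ) ≤ (q : ℝ) ^ U.card := by exact_mod_cast card_fib_compl_le
  linarith

/-- The base of the crude exponential factorization constant. -/
noncomputable def crudeConst (q Δ : ℕ) : ℝ := 96 * q * (q : ℝ) ^ (Δ + 1)

/-- Factorization of entropy with an exponentially large constant. -/
lemma SpareLists.condEnt_le (hL : SpareLists Δ G L) (hf : ∀ σ, 0 < f σ) (U : Finset V) :
    condEnt (proper G L) f U ≤ crudeConst q Δ ^ U.card *
      ∑ v ∈ U, condEnt (proper G L) f {v} := by
  rcases U.eq_empty_or_nonempty with rfl | ⟨v, hv⟩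
  · simp [condEnt]
  have hq : (1 : ℝ) ≤ q := by exact_mod_cast hL.q_pos v
  have hk : U.card ≠ 0 := (card_pos.2 ⟨v, hv⟩).ne'
  refine (condEnt_le_varSum hf).trans ?_
  have h1 : ∑ v ∈ U, varSum (proper G L) (fun σ => √(f σ)) {v}ᶜ ≤
      ∑ v ∈ U, condEnt (proper G L) f {v} := sum_le_sum fun v _ => varSum_sqrt_le hf
  have h2 := (hL.varSum_le (F := fun σ => √(f σ)) U).trans
    (mul_le_mul_of_nonneg_left h1 (by positivity))
  have h3 := mul_le_mul_of_nonneg_left h2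
    (by positivity : (0 : ℝ) ≤ 2 * ((q : ℝ) ^ U.card + 1))
  refine h3.trans ?_
  rw [← mul_assoc]
  refine mul_le_mul_of_nonneg_right ?_ (sum_nonneg fun v _ => condEnt_nonneg hf)
  have e : crudeConst q Δ ^ U.card =
      4 ^ U.card * (q : ℝ) ^ U.card * (24 * (q : ℝ) ^ (Δ + 1)) ^ U.card := by
    rw [← mul_pow, ← mul_pow]; unfold crudeConst; congr 1; ring
  rw [e]
  refine mul_le_mul_of_nonneg_right ?_ (by positivity)
  have h4 : (1 : ℝ) ≤ (q : ℝ) ^ U.card := one_le_pow₀ hq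
  have h5 : (4 : ℝ) ≤ 4 ^ U.card := le_self_pow₀ (by norm_num) hk
  nlinarith

end CrudeFactorization

section Independence

variable {V : Type*} [Fintype V] {q : ℕ} {G : SimpleGraph V} {L : V → Finset (Fin q)}
  {σ τ ρ : V → Fin q} {f X : (V → Fin q) → ℝ} {Λ S T U W : Finset V} {u v w : V} {Δ : ℕ}

/-- `τ` on `W` and `σ` elsewhere. -/
noncomputable def glue (W : Finset V) (τ σ : V → Fin q) : V → Fin q :=
  fun u => if u ∈ W then τ u else σ u

lemma glue_of_mem (h : u ∈ W) : glue W τ σ u = τ u := if_pos h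

lemma glue_of_notMem (h : u ∉ W) : glue W τ σ u = σ u := if_neg h

lemma glue_mem (hτ : τ ∈ proper G L) (hσ : σ ∈ proper G L)
    (h : ∀ a ∈ W, ∀ b ∉ W, G.Adj a b → τ b = σ b) : glue W τ σ ∈ proper G L := by
  rw [mem_proper] at *
  refine ⟨fun u => ?_, fun u w huw => ?_⟩
  · by_cases hu : u ∈ W
    · rw [glue_of_mem hu]; exact hτ.1 u
    · rw [glue_of_notMem hu]; exact hσ.1 u
  · by_cases hu : u ∈ W <;> by_cases hw : w ∈ W
    · rw [glue_of_mem hu, glue_of_mem hw]; exact hτ.2 u w huw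
    · rw [glue_of_mem hu, glue_of_notMem hw, ← h u hu w hw huw]; exact hτ.2 u w huw
    · rw [glue_of_notMem hu, glue_of_mem hw, ← h w hw u hu huw.symm]; exact hτ.2 u w huw
    · rw [glue_of_notMem hu, glue_of_notMem hw]; exact hσ.2 u w huw

/-- There are no edges between `U` and `W`. -/
def NoEdges (G : SimpleGraph V) (U W : Finset V) : Prop := ∀ a ∈ U, ∀ b ∈ W, ¬G.Adj a b

lemma NoEdges.card_fib_le (h : NoEdges G U W) (hσ : σ ∈ proper G L)
    (hρ : ρ ∈ fib (proper G L) Wᶜ σ) :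
    (fib (proper G L) Uᶜ σ).card ≤ (fib (proper G L) Uᶜ ρ).card := by
  refine card_le_card_of_injOn (fun τ => glue U τ ρ) (fun τ hτ => ?_) ?_
  · have hτ' := mem_fib.1 (mem_coe.1 hτ)
    refine mem_coe.2 (mem_fib.2 ⟨glue_mem hτ'.1 (mem_fib.1 hρ).1 fun a ha b hb hab => ?_,
      fun w hw => glue_of_notMem (mem_compl.1 hw)⟩)
    rw [hτ'.2 b (mem_compl.2 hb), (mem_fib.1 hρ).2 b (mem_compl.2 fun hbW => h a ha b hbW hab)]
  · intro τ hτ τ' hτ' he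
    ext u : 1
    by_cases hu : u ∈ U
    · have := congrFun he u
      simp only [glue_of_mem hu] at this
      exact this
    · rw [(mem_fib.1 (mem_coe.1 hτ)).2 u (mem_compl.2 hu),
        (mem_fib.1 (mem_coe.1 hτ')).2 u (mem_compl.2 hu)]

lemma NoEdges.card_fib_eq (h : NoEdges G U W) (hσ : σ ∈ proper G L)
    (hρ : ρ ∈ fib (proper G L) Wᶜ σ) :
    (fib (proper G L) Uᶜ ρ).card = (fib (proper G L) Uᶜ σ).card := by
  refine le_antisymm (h.card_fib_le (mem_fib.1 hρ).1 ?_) (h.card_fib_le hσ hρ)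
  exact mem_fib.2 ⟨hσ, fun v hv => ((mem_fib.1 hρ).2 v hv).symm⟩

lemma NoEdges.sum_sum_fib (h : NoEdges G U W) (hUW : Disjoint U W) (hσ : σ ∈ proper G L) :
    ∑ ρ ∈ fib (proper G L) Wᶜ σ, ∑ τ ∈ fib (proper G L) Uᶜ ρ, X τ =
      ∑ τ ∈ fib (proper G L) (U ∪ W)ᶜ σ, X τ := by
  have hmaps : ∀ τ ∈ fib (proper G L) (U ∪ W)ᶜ σ, glue W τ σ ∈ fib (proper G L) Wᶜ σ := by
    intro τ hτ
    refine mem_fib.2 ⟨glue_mem (mem_fib.1 hτ).1 hσ fun a ha b hb hab => ?_,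
      fun w hw => glue_of_notMem (mem_compl.1 hw)⟩
    refine (mem_fib.1 hτ).2 b ?_
    rw [mem_compl, mem_union, not_or]
    exact ⟨fun hbU => h b hbU a ha hab.symm, hb⟩
  rw [← sum_fiberwise_of_maps_to hmaps]
  refine sum_congr rfl fun ρ hρ => sum_congr ?_ fun _ _ => rfl
  have hρ' := mem_fib.1 hρ
  ext τ
  rw [mem_filter, mem_fib, mem_fib]
  constructor
  · rintro ⟨hτ, hτ'⟩
    refine ⟨⟨hτ, fun w hw => ?_⟩, ?_⟩
    · rw [mem_compl, mem_union, not_or] at hw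
      rw [hτ' w (mem_compl.2 hw.1), hρ'.2 w (mem_compl.2 hw.2)]
    · ext w : 1
      by_cases hw : w ∈ W
      · rw [glue_of_mem hw, hτ' w (mem_compl.2 fun hU => disjoint_left.1 hUW hU hw)]
      · rw [glue_of_notMem hw, hρ'.2 w (mem_compl.2 hw)]
  · rintro ⟨⟨hτ, hτ'⟩, he⟩
    refine ⟨hτ, fun w hw => ?_⟩
    rw [← he]
    by_cases hwW : w ∈ W
    · rw [glue_of_mem hwW]
    · rw [glue_of_notMem hwW]
      refine hτ' w ?_
      rw [mem_compl, mem_union, not_or]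
      exact ⟨mem_compl.1 hw, hwW⟩

lemma NoEdges.avg_avg (h : NoEdges G U W) (hUW : Disjoint U W) (hσ : σ ∈ proper G L) :
    avg (proper G L) Wᶜ (avg (proper G L) Uᶜ f) σ = avg (proper G L) (U ∪ W)ᶜ f σ := by
  set P := proper G L with hP
  have hc : ((fib P (U ∪ W)ᶜ σ).card : ℝ) = (fib P Wᶜ σ).card * (fib P Uᶜ σ).card := by
    have := h.sum_sum_fib (X := fun _ => 1) hUW hσ
    simp only [sum_const, nsmul_eq_mul, mul_one] at this
    rw [← this, sum_congr rfl fun ρ hρ => by rw [h.card_fib_eq hσ hρ], sum_const, nsmul_eq_mul]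
  have e : ∑ ρ ∈ fib P Wᶜ σ, avg P Uᶜ f ρ =
      (∑ τ ∈ fib P (U ∪ W)ᶜ σ, f τ) / (fib P Uᶜ σ).card := by
    rw [← h.sum_sum_fib hUW hσ, sum_div]
    refine sum_congr rfl fun ρ hρ => ?_
    unfold avg
    rw [h.card_fib_eq hσ hρ]
  conv_lhs => unfold avg
  conv_rhs => unfold avg
  have e' := e
  unfold avg at e'
  rw [e', hc, div_div, mul_comm ((fib P Wᶜ σ).card : ℝ)]

lemma NoEdges.condEnt_union_le (h : NoEdges G U W) (hUW : Disjoint U W) (hf : ∀ σ, 0 < f σ) :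
    condEnt (proper G L) f (U ∪ W) ≤ condEnt (proper G L) f U + condEnt (proper G L) f W := by
  set P := proper G L with hP
  have hU : (U ∪ W)ᶜ ⊆ Uᶜ := compl_subset_compl.2 subset_union_left
  have hW : (U ∪ W)ᶜ ⊆ Wᶜ := compl_subset_compl.2 subset_union_right
  have key := entSum_second_diff (P := P) hf hW hU (subset_univ _) (subset_univ _)
  have e : ∑ σ ∈ P, avg P Wᶜ f σ * avg P Uᶜ f σ / avg P (U ∪ W)ᶜ f σ =
      ∑ σ ∈ P, avg P (U ∪ W)ᶜ f σ := by
    have hd : DependsOn' Wᶜ fun σ : V → Fin q => avg P Wᶜ f σ / avg P (U ∪ W)ᶜ f σ := by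
      intro σ τ hst
      simp only [avg_congr hst, dependsOn_avg hW σ τ hst]
    have h1 := sum_dependsOn_mul_avg (P := P) (f := avg P Uᶜ f) hd
    have h2 : ∑ σ ∈ P, avg P Wᶜ f σ / avg P (U ∪ W)ᶜ f σ * avg P Wᶜ (avg P Uᶜ f) σ =
        ∑ σ ∈ P, avg P Wᶜ f σ := by
      refine sum_congr rfl fun σ hσ => ?_
      rw [h.avg_avg hUW hσ, div_mul_cancel₀ _ (avg_pos hf hσ).ne']
    rw [h2, sum_avg, ← sum_avg (Λ := (U ∪ W)ᶜ)] at h1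
    rw [h1]
    exact sum_congr rfl fun σ _ => by ring
  rw [sum_sub_distrib, e, sub_self] at key
  unfold condEnt
  linarith

end Independence

section Components

variable {V : Type*} [Fintype V] {q : ℕ} {G : SimpleGraph V} {L : V → Finset (Fin q)}
  {f : (V → Fin q) → ℝ} {S T U W : Finset V} {u v w : V} {Δ : ℕ} {θ a : ℝ}

/-- The connected component of `v` in the subgraph induced by `S`. -/
noncomputable def comp (G : SimpleGraph V) (S : Finset V) (v : V) : Finset V :=
  univ.filter fun w => Relation.ReflTransGen (fun a b => G.Adj a b ∧ a ∈ S ∧ b ∈ S) v w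

lemma mem_comp : w ∈ comp G S v ↔
    Relation.ReflTransGen (fun a b => G.Adj a b ∧ a ∈ S ∧ b ∈ S) v w := by simp [comp]

lemma self_mem_comp : v ∈ comp G S v := mem_comp.2 Relation.ReflTransGen.refl

lemma comp_subset (hv : v ∈ S) : comp G S v ⊆ S := by
  intro w hw
  induction mem_comp.1 hw with
  | refl => exact hv
  | tail _ h _ => exact h.2.2

lemma comp_step (hw : w ∈ comp G S v) (hwS : w ∈ S) (huS : u ∈ S) (h : G.Adj w u) :
    u ∈ comp G S v := mem_comp.2 ((mem_comp.1 hw).tail ⟨h, hwS, huS⟩)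

lemma comp_mono (h : S ⊆ T) : comp G S v ⊆ comp G T v := fun w hw => by
  rw [mem_comp] at *
  induction hw with
  | refl => exact Relation.ReflTransGen.refl
  | tail _ hab ih => exact ih.tail ⟨hab.1, h hab.2.1, h hab.2.2⟩

lemma comp_subset_of_mem (hw : w ∈ comp G S v) : comp G S v ⊆ comp G S w := by
  intro u hu
  rw [mem_comp] at *
  refine Relation.ReflTransGen.trans ?_ hu
  clear hu
  induction hw with
  | refl => exact Relation.ReflTransGen.refl
  | tail _ hab ih => exact Relation.ReflTransGen.head ⟨hab.1.symm, hab.2.2, hab.2.1⟩ ih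

lemma SpareLists.condEnt_le_sum_comp (hL : SpareLists Δ G L) (hf : ∀ σ, 0 < f σ)
    (ha : 1 ≤ a) (hac : crudeConst q Δ ≤ a) (S : Finset V) :
    condEnt (proper G L) f S ≤
      ∑ v ∈ S, a ^ (comp G S v).card * condEnt (proper G L) f {v} := by
  induction S using Finset.strongInduction with
  | H S ih =>
    rcases S.eq_empty_or_nonempty with rfl | ⟨v, hv⟩
    · simp [condEnt]
    set U := comp G S v with hU
    have hUS : U ⊆ S := comp_subset hv
    have hne : NoEdges G U (S \ U) := fun x hx y hy hxy =>
      (mem_sdiff.1 hy).2 (comp_step hx (hUS hx) (mem_sdiff.1 hy).1 hxy)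
    have h1 := hne.condEnt_union_le (L := L) disjoint_sdiff hf
    rw [union_sdiff_of_subset hUS] at h1
    have h2 := ih (S \ U) (sdiff_ssubset hUS ⟨v, self_mem_comp⟩)
    have h0 : ∀ v, 0 ≤ condEnt (proper G L) f {v} := fun v => condEnt_nonneg hf
    refine h1.trans ?_
    rw [← sum_sdiff hUS, add_comm]
    refine add_le_add (h2.trans (sum_le_sum fun w _ => mul_le_mul_of_nonneg_right
      (pow_le_pow_right₀ ha (card_le_card (comp_mono sdiff_subset))) (h0 w))) ?_
    refine (hL.condEnt_le hf U).trans ?_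
    rw [mul_sum]
    refine sum_le_sum fun w hw => mul_le_mul_of_nonneg_right ?_ (h0 w)
    have hc0 : 0 ≤ crudeConst q Δ := by unfold crudeConst; positivity
    exact (pow_le_pow_left₀ hc0 hac _).trans
      (pow_le_pow_right₀ ha (card_le_card (comp_subset_of_mem hw)))

/-- The outer vertex boundary. -/
noncomputable def bdry (G : SimpleGraph V) (U : Finset V) : Finset V :=
  univ.filter fun w => w ∉ U ∧ ∃ u ∈ U, G.Adj u w

lemma card_bdry_le (hG : ∀ v, (nbrs G v).card ≤ Δ) : (bdry G U).card ≤ U.card * Δ := by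
  refine (card_le_card (t := U.biUnion (nbrs G)) fun w hw => ?_).trans
    (card_biUnion_le_card_mul _ _ _ fun u _ => hG u)
  obtain ⟨u, hu, huw⟩ := (mem_filter.1 hw).2.2
  exact mem_biUnion.2 ⟨u, hu, mem_nbrs.2 huw⟩

lemma comp_eq_of_disjoint_bdry (hT : v ∈ T) (hU : comp G T v = U) (hUS : U ⊆ S)
    (hd : Disjoint (bdry G U) S) : comp G S v = U := by
  refine Subset.antisymm ?_ ?_
  · intro w hw
    have : Relation.ReflTransGen (fun a b => G.Adj a b ∧ a ∈ S ∧ b ∈ S) v w := mem_comp.1 hw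
    clear hw
    induction this with
    | refl => exact hU ▸ self_mem_comp
    | tail _ h ih =>
      by_contra hc
      exact disjoint_left.1 hd (mem_filter.2 ⟨mem_univ _, hc, _, ih, h.1⟩) h.2.2
  · intro w hw
    rw [← hU, mem_comp] at hw
    have hall : ∀ {w}, Relation.ReflTransGen (fun a b => G.Adj a b ∧ a ∈ T ∧ b ∈ T) v w →
        w ∈ S := fun hw => hUS (hU ▸ mem_comp.2 hw)
    induction hw with
    | refl => exact self_mem_comp
    | tail h1 h2 ih => exact comp_step ih (hall h1) (hall (h1.tail h2)) h2.1

/-- Components of a sparse random set are small in exponential moments. -/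
lemma berE_pow_comp_le (hG : ∀ v, (nbrs G v).card ≤ Δ) (hθ0 : 0 ≤ θ) (hθ1 : θ ≤ 1) (ha : 0 ≤ a)
    (haθ : a * θ ≤ (1 / 2) ^ (Δ + 1)) (v : V) :
    berE θ (fun S => if v ∈ S then a ^ (comp G S v).card else 0) ≤ 1 := by
  have e : ∀ t : ℝ, ∀ F : Finset V → ℝ, berE t (fun S => if v ∈ S then F (comp G S v) else 0) =
      ∑ U, ∑ S ∈ univ.filter (fun S => v ∈ S ∧ comp G S v = U), berW t S * F U := by
    intro t F
    unfold berE
    simp only [mul_ite, mul_zero]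
    rw [← sum_filter, ← sum_fiberwise (g := fun S => comp G S v)]
    refine sum_congr rfl fun U _ => ?_
    rw [filter_filter]
    exact sum_congr rfl fun S hS => by rw [(mem_filter.1 hS).2.2]
  have h1 : berE (1 / 2) (fun S => if v ∈ S then (1 : ℝ) else 0) ≤ 1 := by
    refine (berE_mono (t := 1 / 2) (h := fun _ => (1 : ℝ)) (by norm_num) (by norm_num)
      fun S => ?_).trans (le_of_eq (berE_const _))
    split_ifs <;> norm_num
  refine le_trans ?_ h1
  rw [e θ fun U => a ^ U.card, e (1 / 2) fun _ => 1]
  refine sum_le_sum fun U _ => ?_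
  rcases (univ.filter fun S => v ∈ S ∧ comp G S v = U).eq_empty_or_nonempty with h0 | ⟨T, hT⟩
  · rw [h0]; simp
  obtain ⟨hvT, hTU⟩ := (mem_filter.1 hT).2
  have hvU : v ∈ U := hTU ▸ self_mem_comp
  rw [← sum_mul, ← sum_mul, mul_one]
  have h2 : ∑ S ∈ univ.filter (fun S => v ∈ S ∧ comp G S v = U), berW θ S ≤ θ ^ U.card := by
    have := sum_berW_filter (t := θ) (disjoint_empty_right U)
    rw [card_empty, pow_zero, mul_one] at this
    rw [← this]
    refine sum_le_sum_of_subset_of_nonneg (fun S hS => ?_) fun _ _ _ => berW_nonneg hθ0 hθ1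
    obtain ⟨hv, hS⟩ := (mem_filter.1 hS).2
    exact mem_filter.2 ⟨mem_univ _, hS ▸ comp_subset hv, disjoint_empty_left _⟩
  have hUb : Disjoint U (bdry G U) :=
    disjoint_left.2 fun x hx hx' => (mem_filter.1 hx').2.1 hx
  have h3 : (1 / 2 : ℝ) ^ U.card * (1 - 1 / 2) ^ (bdry G U).card ≤
      ∑ S ∈ univ.filter (fun S => v ∈ S ∧ comp G S v = U), berW (1 / 2) S := by
    rw [← sum_berW_filter hUb]
    refine sum_le_sum_of_subset_of_nonneg (fun S hS => ?_)
      fun _ _ _ => berW_nonneg (by norm_num) (by norm_num)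
    obtain ⟨hUS, hd⟩ := (mem_filter.1 hS).2
    exact mem_filter.2 ⟨mem_univ _, hUS hvU, comp_eq_of_disjoint_bdry hvT hTU hUS hd⟩
  refine le_trans (mul_le_mul_of_nonneg_right h2 (pow_nonneg ha _)) (le_trans ?_ h3)
  rw [← mul_pow, mul_comm θ a]
  refine (pow_le_pow_left₀ (mul_nonneg ha hθ0) haθ _).trans ?_
  rw [show (1 - 1 / 2 : ℝ) = 1 / 2 by norm_num, ← pow_add, ← pow_mul]
  refine pow_le_pow_of_le_one (by norm_num) (by norm_num) ?_
  have := card_bdry_le (U := U) hG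
  nlinarith

/-- The base of the exponential moment. -/
noncomputable def expBase (q Δ : ℕ) : ℝ := crudeConst q Δ + 1

/-- The density of the random set of resampled vertices. -/
noncomputable def density (q Δ : ℕ) : ℝ := (1 / 2) ^ (Δ + 1) / expBase q Δ

/-- The constant of the approximate tensorization of entropy. -/
noncomputable def tensorConst (q Δ : ℕ) : ℝ := tailConst (curvK q Δ) (density q Δ)

lemma one_le_expBase : 1 ≤ expBase q Δ := by
  have : 0 ≤ crudeConst q Δ := by unfold crudeConst; positivity
  unfold expBase; linarith

lemma density_pos : 0 < density q Δ :=
  div_pos (by positivity) (zero_lt_one.trans_le one_le_expBase)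

lemma density_le_one : density q Δ ≤ 1 :=
  div_le_one_of_le₀ ((pow_le_one₀ (by norm_num) (by norm_num)).trans one_le_expBase)
    (zero_le_one.trans one_le_expBase)

lemma one_le_tensorConst : 1 ≤ tensorConst q Δ := by
  have := density_pos (q := q) (Δ := Δ)
  unfold tensorConst tailConst
  have : 0 ≤ 2 * 2 ^ curvK q Δ / (density q Δ * density q Δ ^ curvK q Δ) := by positivity
  linarith

/-- Approximate tensorization of entropy. -/
theorem condEnt_univ_le (hL : LongLists Δ G L) (hS : SpareLists Δ G L) (hf : ∀ σ, 0 < f σ) :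
    condEnt (proper G L) f univ ≤ tensorConst q Δ * ∑ v, condEnt (proper G L) f {v} := by
  have hK : CurvBound (curvK q Δ) (entSum (proper G L) f) := fun Λ => second_diff_ge hL hS hf
  have hθ0 := density_pos (q := q) (Δ := Δ)
  have hθ1 := density_le_one (q := q) (Δ := Δ)
  have ha := one_le_expBase (q := q) (Δ := Δ)
  have h1 := hK.sub_le (fun i Λ => entSum_mono hf (subset_insert _ _)) hθ0 hθ1
  have e : condEnt (proper G L) f univ =
      entSum (proper G L) f univ - entSum (proper G L) f ∅ := by
    unfold condEnt; rw [compl_univ]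
  rw [e]
  refine h1.trans (mul_le_mul_of_nonneg_left ?_ (zero_le_one.trans one_le_tensorConst))
  have h2 : ∀ S, entSum (proper G L) f univ - entSum (proper G L) f Sᶜ ≤
      ∑ v, condEnt (proper G L) f {v} *
        (if v ∈ S then expBase q Δ ^ (comp G S v).card else 0) := by
    intro S
    refine (hS.condEnt_le_sum_comp hf ha (by unfold expBase; linarith) S).trans (le_of_eq ?_)
    simp only [mul_ite, mul_zero]
    rw [sum_ite_mem, univ_inter]
    exact sum_congr rfl fun v _ => by rw [mul_comm]
  refine (berE_mono hθ0.le hθ1 h2).trans ?_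
  rw [berE_sum]
  refine sum_le_sum fun v _ => ?_
  rw [berE_const_mul]
  refine mul_le_of_le_one_right (condEnt_nonneg hf) ?_
  refine berE_pow_comp_le hL.deg_le hθ0.le hθ1 (zero_le_one.trans ha) (le_of_eq ?_) v
  unfold density
  exact mul_div_cancel₀ _ (zero_lt_one.trans_le ha).ne'

end Components

section Contraction

variable {V : Type*} [Fintype V] {q : ℕ} {P : Finset (V → Fin q)}
  {σ τ : V → Fin q} {f p : (V → Fin q) → ℝ} {Δ : ℕ}

/-- The Glauber update of a density, set to `1` off the support. -/
noncomputable def densityStep (P : Finset (V → Fin q)) (f : (V → Fin q) → ℝ) :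
    (V → Fin q) → ℝ :=
  fun σ => if σ ∈ P then ∑ v, (Fintype.card V : ℝ)⁻¹ * avg P {v}ᶜ f σ else 1

lemma densityStep_of_mem (hσ : σ ∈ P) :
    densityStep P f σ = ∑ v, (Fintype.card V : ℝ)⁻¹ * avg P {v}ᶜ f σ := if_pos hσ

lemma card_inv_pos [Nonempty V] : 0 < (Fintype.card V : ℝ)⁻¹ :=
  inv_pos.2 (Nat.cast_pos.2 Fintype.card_pos)

lemma sum_card_inv [Nonempty V] : ∑ _v : V, (Fintype.card V : ℝ)⁻¹ = 1 := by
  rw [sum_const, card_univ, nsmul_eq_mul]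
  exact mul_inv_cancel₀ (Nat.cast_ne_zero.2 Fintype.card_ne_zero)

lemma densityStep_pos [Nonempty V] (hf : ∀ σ, 0 < f σ) (σ : V → Fin q) :
    0 < densityStep P f σ := by
  unfold densityStep
  split_ifs with hσ
  · exact sum_pos (fun v _ => mul_pos card_inv_pos (avg_pos hf hσ)) univ_nonempty
  · exact one_pos

lemma sum_densityStep [Nonempty V] : ∑ σ ∈ P, densityStep P f σ = ∑ σ ∈ P, f σ := by
  rw [sum_congr rfl fun σ hσ => densityStep_of_mem hσ, sum_comm]
  simp only [← mul_sum, sum_avg]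
  rw [mul_sum, ← sum_mul, sum_card_inv, one_mul]

lemma entSum_univ : entSum P f univ = ∑ σ ∈ P, f σ * Real.log (f σ) :=
  sum_congr rfl fun σ hσ => by rw [avg_univ hσ]

lemma avg_empty : avg P ∅ f σ = (∑ τ ∈ P, f τ) / P.card := by
  unfold avg; rw [fib_empty]

lemma condEnt_univ : condEnt P f univ = entSum P f univ - entSum P f ∅ := by
  unfold condEnt; rw [compl_univ]

lemma entSum_densityStep_le [Nonempty V] (hf : ∀ σ, 0 < f σ) :
    entSum P (densityStep P f) univ ≤ (Fintype.card V : ℝ)⁻¹ * ∑ v, entSum P f {v}ᶜ := by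
  rw [entSum_univ]
  unfold entSum
  rw [sum_comm, mul_sum]
  refine sum_le_sum fun σ hσ => ?_
  rw [densityStep_of_mem hσ, mul_sum]
  have := Real.convexOn_mul_log.map_sum_le (t := univ) (w := fun _ : V => (Fintype.card V : ℝ)⁻¹)
    (p := fun v => avg P {v}ᶜ f σ) (fun _ _ => card_inv_pos.le) sum_card_inv
    (fun v _ => (avg_pos hf hσ).le)
  simpa only [smul_eq_mul] using this

lemma condEnt_densityStep_le [Nonempty V] {K : ℝ} (hK : 0 < K) (hf : ∀ σ, 0 < f σ)
    (h : condEnt P f univ ≤ K * ∑ v, condEnt P f {v}) :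
    condEnt P (densityStep P f) univ ≤
      (1 - (K * Fintype.card V)⁻¹) * condEnt P f univ := by
  have h1 := entSum_densityStep_le (P := P) hf
  have h2 : entSum P (densityStep P f) ∅ = entSum P f ∅ := by
    unfold entSum
    simp only [avg_empty, sum_densityStep]
  have h3 : ∑ v, condEnt P f {v} =
      Fintype.card V * entSum P f univ - ∑ v, entSum P f {v}ᶜ := by
    unfold condEnt
    rw [sum_sub_distrib, sum_const, card_univ, nsmul_eq_mul]
  have h4 : (Fintype.card V : ℝ)⁻¹ * ∑ v, entSum P f {v}ᶜ =
      entSum P f univ - (Fintype.card V : ℝ)⁻¹ * ∑ v, condEnt P f {v} := by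
    have : (Fintype.card V : ℝ) ≠ 0 := Nat.cast_ne_zero.2 Fintype.card_ne_zero
    rw [h3]; field_simp; ring
  have h5 : (K * Fintype.card V : ℝ)⁻¹ * condEnt P f univ ≤
      (Fintype.card V : ℝ)⁻¹ * ∑ v, condEnt P f {v} := by
    rw [mul_inv, mul_comm K⁻¹, mul_assoc]
    refine mul_le_mul_of_nonneg_left ?_ card_inv_pos.le
    rwa [inv_mul_le_iff₀ hK]
  rw [h4] at h1
  rw [condEnt_univ] at h5 ⊢
  rw [h2, condEnt_univ]
  linarith

lemma sum_abs_sub_two_sq_le (hP : P.Nonempty) (hf : ∀ σ, 0 < f σ)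
    (hm : ∑ σ ∈ P, f σ = 2 * P.card) :
    (∑ σ ∈ P, |f σ - 2|) ^ 2 ≤ condEnt P f univ * (8 * P.card) := by
  have hc : (P.card : ℝ) ≠ 0 := Nat.cast_ne_zero.2 hP.card_ne_zero
  have h1 := sum_sq_sqrt_sub_le (P := P) hf (subset_univ (∅ : Finset V))
  have e1 : ∑ σ ∈ P, (√(avg P univ f σ) - √(avg P ∅ f σ)) ^ 2 =
      ∑ σ ∈ P, |√(f σ) - √2| ^ 2 := by
    refine sum_congr rfl fun σ hσ => ?_
    rw [avg_univ hσ, avg_empty, hm, mul_div_assoc, div_self hc, mul_one, sq_abs]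
  rw [e1, ← condEnt_univ] at h1
  have h2 := sum_mul_sq_le_sq_mul_sq P (fun σ => |√(f σ) - √2|) (fun σ => √(f σ) + √2)
  have e2 : ∑ σ ∈ P, |√(f σ) - √2| * (√(f σ) + √2) = ∑ σ ∈ P, |f σ - 2| := by
    refine sum_congr rfl fun σ _ => ?_
    have h0 : 0 ≤ √(f σ) + √2 := by positivity
    conv_lhs => rw [← abs_of_nonneg h0, ← abs_mul]
    congr 1
    have a1 := Real.sq_sqrt (hf σ).le
    have a2 := Real.sq_sqrt (zero_le_two (α := ℝ))
    linear_combination a1 - a2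
  have h3 : ∑ σ ∈ P, (√(f σ) + √2) ^ 2 ≤ 8 * P.card := by
    have : ∀ σ ∈ P, (√(f σ) + √2) ^ 2 ≤ 2 * f σ + 4 := fun σ _ => by
      have a1 := Real.sq_sqrt (hf σ).le
      have a2 := Real.sq_sqrt (zero_le_two (α := ℝ))
      nlinarith [sq_nonneg (√(f σ) - √2)]
    refine (sum_le_sum this).trans (le_of_eq ?_)
    rw [sum_add_distrib, ← mul_sum, hm, sum_const, nsmul_eq_mul]
    ring
  rw [e2] at h2
  exact h2.trans (mul_le_mul h1 h3 (sum_nonneg fun _ _ => sq_nonneg _) (condEnt_nonneg hf))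

lemma densityStep_affine [Nonempty V] {c : ℝ} (hσ : σ ∈ P)
    (h : ∀ τ ∈ P, f τ = c * p τ + 1) :
    densityStep P f σ = c * ∑ v, (Fintype.card V : ℝ)⁻¹ * avg P {v}ᶜ p σ + 1 := by
  have : ∀ v : V, avg P {v}ᶜ f σ = c * avg P {v}ᶜ p σ + 1 := by
    intro v
    have hc : ((fib P {v}ᶜ σ).card : ℝ) ≠ 0 := (fib_card_pos hσ).ne'
    unfold avg
    rw [sum_congr rfl fun τ hτ => h τ (mem_fib.1 hτ).1, sum_add_distrib, ← mul_sum, sum_const,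
      nsmul_eq_mul, mul_one, add_div, div_self hc, mul_div_assoc]
  rw [densityStep_of_mem hσ]
  simp only [this, mul_add, mul_one]
  rw [sum_add_distrib, sum_card_inv, mul_sum]
  exact congrArg (· + 1) (sum_congr rfl fun v _ => by ring)

/-- The point mass at `σ₀`, as a density mixed with the stationary one. -/
noncomputable def startDensity (P : Finset (V → Fin q)) (σ₀ : V → Fin q) : (V → Fin q) → ℝ :=
  fun σ => P.card * (if σ₀ = σ then 1 else 0) + 1

lemma startDensity_pos (σ₀ σ : V → Fin q) : 0 < startDensity P σ₀ σ := by
  unfold startDensity; positivity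

lemma sum_startDensity (hσ : σ ∈ P) : ∑ τ ∈ P, startDensity P σ τ = 2 * P.card := by
  unfold startDensity
  rw [sum_add_distrib, ← mul_sum, sum_ite_eq, if_pos hσ, sum_const, nsmul_eq_mul]
  ring

lemma condEnt_startDensity_le (hσ : σ ∈ P) :
    condEnt P (startDensity P σ) univ ≤ 2 * P.card * (Fintype.card V * Real.log q) := by
  have hN : (1 : ℝ) ≤ P.card := Nat.one_le_cast.2 (card_pos.2 ⟨σ, hσ⟩)
  have hN0 : (P.card : ℝ) ≠ 0 := by positivity
  have e1 : entSum P (startDensity P σ) ∅ = P.card * (2 * Real.log 2) := by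
    unfold entSum
    simp only [avg_empty, sum_startDensity hσ, mul_div_assoc, div_self hN0, mul_one]
    rw [sum_const, nsmul_eq_mul]
  have e2 : entSum P (startDensity P σ) univ = (P.card + 1) * Real.log (P.card + 1) := by
    rw [entSum_univ, sum_eq_single_of_mem σ hσ]
    · simp [startDensity]
    · intro τ _ hτ
      simp [startDensity, hτ.symm]
  have h1 : Real.log (P.card + 1) ≤ Real.log 2 + Real.log P.card := by
    rw [← Real.log_mul two_ne_zero hN0]
    exact Real.log_le_log (by positivity) (by linarith)
  have h2 : Real.log P.card ≤ Fintype.card V * Real.log q := by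
    rw [← Real.log_pow]
    refine Real.log_le_log (by positivity) ?_
    have : P.card ≤ q ^ Fintype.card V := by
      have := card_le_univ P
      rwa [Fintype.card_fun, Fintype.card_fin] at this
    exact_mod_cast this
  have h0 : 0 ≤ Real.log (P.card + 1) := Real.log_nonneg (by linarith)
  rw [condEnt_univ, e1, e2]
  nlinarith

/-- Entropy decay along the Glauber dynamics, with the resulting total variation bound. -/
lemma iterate_densityStep [Nonempty V] {K : ℝ} (hK : 1 ≤ K) (hσ : σ ∈ P)
    (h : ∀ f : (V → Fin q) → ℝ, (∀ σ, 0 < f σ) →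
      condEnt P f univ ≤ K * ∑ v, condEnt P f {v}) (t : ℕ) :
    (∀ τ, 0 < (densityStep P)^[t] (startDensity P σ) τ) ∧
      ∑ τ ∈ P, (densityStep P)^[t] (startDensity P σ) τ = 2 * P.card ∧
      condEnt P ((densityStep P)^[t] (startDensity P σ)) univ ≤
        (1 - (K * Fintype.card V)⁻¹) ^ t * (2 * P.card * (Fintype.card V * Real.log q)) := by
  have hV : (1 : ℝ) ≤ Fintype.card V := Nat.one_le_cast.2 Fintype.card_pos
  have h1 : (K * Fintype.card V : ℝ)⁻¹ ≤ 1 := inv_le_one_of_one_le₀ (by nlinarith)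
  induction t with
  | zero =>
    refine ⟨startDensity_pos σ, sum_startDensity hσ, ?_⟩
    rw [pow_zero, one_mul]
    exact condEnt_startDensity_le hσ
  | succ t ih =>
    simp only [Function.iterate_succ_apply']
    refine ⟨densityStep_pos ih.1, sum_densityStep.trans ih.2.1, ?_⟩
    refine (condEnt_densityStep_le (zero_lt_one.trans_le hK) ih.1 (h _ ih.1)).trans ?_
    rw [pow_succ', mul_assoc]
    exact mul_le_mul_of_nonneg_left ih.2.2 (by linarith)

/-- The constant of the mixing time bound. -/
noncomputable def mixConst (K : ℝ) (q : ℕ) : ℝ :=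
  K * (1 + Real.log (64 * (q + 1)) / Real.log 2)

lemma mixConst_pos {K : ℝ} (hK : 1 ≤ K) : 0 < mixConst K q := by
  have h1 : 0 ≤ Real.log (64 * (q + 1)) :=
    Real.log_nonneg (by have : (0 : ℝ) ≤ q := Nat.cast_nonneg q
                        linarith)
  have h2 := Real.log_pos one_lt_two
  unfold mixConst
  positivity

lemma pow_decay_le {K : ℝ} (hK : 1 ≤ K) {n t : ℕ} (hn : 2 ≤ n) (hq : 1 ≤ q)
    (ht : mixConst K q * n * Real.log n ≤ t) :
    (1 - (K * n)⁻¹) ^ t * (n * Real.log q) ≤ 1 / 64 := by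
  have hn' : (2 : ℝ) ≤ n := by exact_mod_cast hn
  have hq' : (1 : ℝ) ≤ q := by exact_mod_cast hq
  have hK0 : 0 < K := zero_lt_one.trans_le hK
  have hKn : 0 < K * n := by positivity
  have h1 : (K * n)⁻¹ ≤ 1 := inv_le_one_of_one_le₀ (by nlinarith)
  have hl2 := Real.log_pos one_lt_two
  have hln : Real.log 2 ≤ Real.log n := Real.log_le_log two_pos hn'
  have hlq : 0 ≤ Real.log (64 * (q + 1)) := Real.log_nonneg (by linarith)
  have h2 : Real.log (64 * (q + 1) * n) ≤ (K * n)⁻¹ * t := by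
    rw [Real.log_mul (by positivity) (by positivity), inv_mul_eq_div, le_div_iff₀ hKn]
    refine le_trans ?_ ht
    have : Real.log (64 * (q + 1)) ≤ Real.log (64 * (q + 1)) / Real.log 2 * Real.log n := by
      rw [div_mul_eq_mul_div, le_div_iff₀ hl2]
      exact mul_le_mul_of_nonneg_left hln hlq
    unfold mixConst
    calc _ ≤ (Real.log (64 * (q + 1)) / Real.log 2 * Real.log n + Real.log n) * (K * n) :=
          mul_le_mul_of_nonneg_right (by linarith) hKn.le
      _ = _ := by ring
  have h3 : (1 - (K * n)⁻¹) ^ t ≤ (64 * (q + 1) * n : ℝ)⁻¹ := by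
    refine (pow_le_pow_left₀ (by linarith) (Real.one_sub_le_exp_neg _) t).trans ?_
    rw [← Real.exp_nat_mul, ← Real.exp_log (show (0 : ℝ) < 64 * (q + 1) * n by positivity),
      ← Real.exp_neg]
    exact Real.exp_le_exp.2 (by linarith)
  have h4 : Real.log q ≤ q + 1 := (Real.log_le_self (by positivity)).trans (by linarith)
  have h5 : 0 ≤ Real.log q := Real.log_nonneg hq'
  calc _ ≤ (64 * (q + 1) * n : ℝ)⁻¹ * (n * (q + 1)) :=
        mul_le_mul h3 (mul_le_mul_of_nonneg_left h4 (by positivity)) (by positivity)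
          (by positivity)
    _ = 1 / 64 := by field_simp

end Contraction

section Glauber

variable {V : Type*} [Fintype V] {q : ℕ} {G : SimpleGraph V} {L : V → Finset (Fin q)}
  {σ τ : V → Fin q} {Δ : ℕ}

lemma uniformProper_eq (σ : V → Fin q) :
    uniformProper G L σ = if σ ∈ proper G L then ((proper G L).card : ℝ)⁻¹ else 0 := by
  have h : ∀ τ : V → Fin q, IsProperListColoring G L τ ↔ τ ∈ proper G L := fun τ =>
    mem_proper.symm
  have e : (univ.filter fun τ : V → Fin q => IsProperListColoring G L τ) = proper G L := by
    ext τ; simp [h]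
  unfold uniformProper
  rw [e]
  simp only [h]

lemma mem_fib_compl_singleton {P : Finset (V → Fin q)} {v : V} :
    τ ∈ fib P {v}ᶜ σ ↔ τ ∈ P ∧ ∀ w, w ≠ v → σ w = τ w := by
  rw [mem_fib]
  exact and_congr_right fun _ => forall_congr' fun w => by
    rw [mem_compl, mem_singleton, eq_comm (a := τ w)]

lemma sum_uniformProper_update (v : V) :
    ∑ c, uniformProper G L (Function.update σ v c) =
      ((proper G L).card : ℝ)⁻¹ * (fib (proper G L) {v}ᶜ σ).card := by
  simp only [uniformProper_eq]
  rw [← sum_filter, sum_const, nsmul_eq_mul, mul_comm]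
  congr 2
  refine card_bij (fun c _ => Function.update σ v c) (fun c hc => ?_) (fun c _ c' _ h => ?_)
    fun τ hτ => ?_
  · exact mem_fib_compl_singleton.2 ⟨(mem_filter.1 hc).2, fun w hw => by simp [hw]⟩
  · simpa using congrFun h v
  · obtain ⟨hτP, hτ⟩ := mem_fib_compl_singleton.1 hτ
    have e : Function.update σ v (τ v) = τ := by
      ext w : 1
      by_cases hw : w = v
      · subst hw; simp
      · simp [hw, hτ w hw]
    exact ⟨τ v, mem_filter.2 ⟨mem_univ _, by rwa [e]⟩, e⟩

lemma glauber_apply (hσ : σ ∈ proper G L) (τ : V → Fin q) :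
    glauber (uniformProper G L) σ τ = ∑ v, (Fintype.card V : ℝ)⁻¹ *
      if τ ∈ fib (proper G L) {v}ᶜ σ then ((fib (proper G L) {v}ᶜ σ).card : ℝ)⁻¹ else 0 := by
  unfold glauber
  rw [mul_sum]
  refine sum_congr rfl fun v _ => ?_
  congr 1
  by_cases h : ∀ w, w ≠ v → σ w = τ w
  · have e : Function.update σ v (τ v) = τ := by
      ext w : 1
      by_cases hw : w = v
      · subst hw; simp
      · simp [hw, h w hw]
    rw [if_pos h]
    unfold condMarg
    rw [e, sum_uniformProper_update, uniformProper_eq]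
    have hN : ((proper G L).card : ℝ) ≠ 0 := Nat.cast_ne_zero.2 (card_pos.2 ⟨σ, hσ⟩).ne'
    by_cases hτ : τ ∈ proper G L
    · rw [if_pos hτ, if_pos (mem_fib_compl_singleton.2 ⟨hτ, h⟩)]
      have hc : ((fib (proper G L) {v}ᶜ σ).card : ℝ) ≠ 0 :=
        (fib_card_pos hσ).ne'
      field_simp
    · rw [if_neg hτ, if_neg fun h' => hτ (mem_fib.1 h').1, zero_div]
  · rw [if_neg h, if_neg fun h' => h (mem_fib_compl_singleton.1 h').2]

lemma glauber_pow_of_notMem (hσ : σ ∈ proper G L) (t : ℕ) (hτ : τ ∉ proper G L) :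
    (glauber (uniformProper G L) ^ t) σ τ = 0 := by
  induction t generalizing τ with
  | zero =>
    rw [pow_zero, Matrix.one_apply_ne]
    rintro rfl
    exact hτ hσ
  | succ t ih =>
    rw [pow_succ, Matrix.mul_apply]
    refine sum_eq_zero fun ρ _ => ?_
    by_cases hρ : ρ ∈ proper G L
    · rw [glauber_apply hρ, sum_eq_zero, mul_zero]
      intro v _
      rw [if_neg fun h => hτ (mem_fib.1 h).1, mul_zero]
    · rw [ih hρ, zero_mul]

lemma glauber_pow_succ (hσ : σ ∈ proper G L) (t : ℕ) (hτ : τ ∈ proper G L) :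
    (glauber (uniformProper G L) ^ (t + 1)) σ τ = ∑ v, (Fintype.card V : ℝ)⁻¹ *
      avg (proper G L) {v}ᶜ ((glauber (uniformProper G L) ^ t) σ) τ := by
  set P := proper G L with hP
  set p := (glauber (uniformProper G L) ^ t) σ with hp
  rw [pow_succ, Matrix.mul_apply,
    ← sum_subset (subset_univ P) fun ρ _ hρ => by rw [glauber_pow_of_notMem hσ t hρ, zero_mul],
    sum_congr rfl fun ρ hρ => by rw [glauber_apply hρ τ, mul_sum], sum_comm]
  refine sum_congr rfl fun v _ => ?_
  unfold avg
  have e : ∑ ρ ∈ fib P {v}ᶜ τ, p ρ =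
      ∑ ρ ∈ P, if τ ∈ fib P {v}ᶜ ρ then p ρ else 0 := by
    rw [← sum_filter]
    refine sum_congr ?_ fun _ _ => rfl
    ext ρ
    rw [mem_filter, mem_fib_compl_singleton, mem_fib_compl_singleton]
    exact ⟨fun h => ⟨h.1, hτ, fun w hw => (h.2 w hw).symm⟩,
      fun h => ⟨h.1, fun w hw => (h.2.2 w hw).symm⟩⟩
  rw [e, sum_div, mul_sum]
  refine sum_congr rfl fun ρ _ => ?_
  split_ifs with h
  · rw [fib_congr (P := P) (Λ := {v}ᶜ) (σ := τ) (τ := ρ) fun w hw =>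
      ((mem_fib.1 h).2 w hw).symm]
    ring
  · ring

lemma iterate_densityStep_eq [Nonempty V] (hσ : σ ∈ proper G L) (t : ℕ) (hτ : τ ∈ proper G L) :
    (densityStep (proper G L))^[t] (startDensity (proper G L) σ) τ =
      (proper G L).card * (glauber (uniformProper G L) ^ t) σ τ + 1 := by
  induction t generalizing τ with
  | zero =>
    rw [pow_zero, Matrix.one_apply]
    rfl
  | succ t ih =>
    rw [Function.iterate_succ_apply', densityStep_affine hτ fun ρ hρ => ih hρ,
      glauber_pow_succ hσ t hτ]

/-- The total variation bound for the Glauber dynamics. -/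
lemma glauber_tv_le (hL : LongLists Δ G L) (hS : SpareLists Δ G L) (hn : 2 ≤ Fintype.card V)
    (hσ : σ ∈ proper G L) {t : ℕ}
    (ht : mixConst (tensorConst q Δ) q * Fintype.card V * Real.log (Fintype.card V) ≤ t) :
    (1 / 2) * ∑ τ, |(glauber (uniformProper G L) ^ t) σ τ - uniformProper G L τ| ≤ 1 / 4 := by
  have : Nonempty V := Fintype.card_pos_iff.1 (by omega)
  obtain ⟨v⟩ := this
  have : Nonempty V := ⟨v⟩
  set P := proper G L with hP
  have hN : (0 : ℝ) < P.card := Nat.cast_pos.2 (card_pos.2 ⟨σ, hσ⟩)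
  obtain ⟨h1, h2, h3⟩ := iterate_densityStep (one_le_tensorConst (q := q) (Δ := Δ)) hσ
    (fun f hf => condEnt_univ_le hL hS hf) t
  have h4 := sum_abs_sub_two_sq_le ⟨σ, hσ⟩ h1 h2
  have h5 := pow_decay_le (one_le_tensorConst (q := q) (Δ := Δ)) hn (hS.q_pos v) ht
  have h6 : (∑ τ ∈ P, |(densityStep P)^[t] (startDensity P σ) τ - 2|) ^ 2 ≤
      (P.card / 2 : ℝ) ^ 2 := by
    refine h4.trans ?_
    have : condEnt P ((densityStep P)^[t] (startDensity P σ)) univ ≤ P.card / 32 := by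
      refine h3.trans ?_
      calc _ = 2 * P.card * ((1 - (tensorConst q Δ * Fintype.card V)⁻¹) ^ t *
            (Fintype.card V * Real.log q)) := by ring
        _ ≤ 2 * P.card * (1 / 64) := mul_le_mul_of_nonneg_left h5 (by positivity)
        _ = _ := by ring
    nlinarith
  have h7 := (abs_le.1 (abs_le_of_sq_le_sq h6 (by positivity))).2
  have e : ∑ τ, |(glauber (uniformProper G L) ^ t) σ τ - uniformProper G L τ| =
      (∑ τ ∈ P, |(densityStep P)^[t] (startDensity P σ) τ - 2|) / P.card := by
    rw [← sum_subset (subset_univ P) fun τ _ hτ => by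
      rw [glauber_pow_of_notMem hσ t hτ, uniformProper_eq, if_neg hτ, sub_zero, abs_zero], sum_div]
    refine sum_congr rfl fun τ hτ => ?_
    rw [uniformProper_eq, if_pos hτ, iterate_densityStep_eq hσ t hτ, eq_div_iff hN.ne',
      ← abs_of_pos hN, ← abs_mul, abs_of_pos hN]
    congr 1
    field_simp
    ring
  rw [e]
  have h8 : (∑ τ ∈ P, |(densityStep P)^[t] (startDensity P σ) τ - 2|) / P.card ≤ 1 / 2 := by
    rw [div_le_iff₀ hN]
    linarith
  linarith

end Glauber

end ListColoringMixing

/-- optimal `O(n log n)` mixing of the Glauber dynamics for proper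
list-colorings below the `11/6` threshold.  There is a constant `ε > 0` such that for all
integers `q, Δ` there is a constant `C = C(q,Δ) > 0` with: for every list-coloring instance
`(G, L)` on `n ≥ 2` vertices with maximum degree at most `Δ` and `|L v| ≥ max((11/6 − ε)Δ, Δ+2)`
for all `v`, the Glauber dynamics for the uniform distribution `μ` on proper list-colorings
has `t_mix(1/4) ≤ C·n·log n`: started from any proper list-coloring, after any number
`t ≥ C·n·log n` of steps the total variation distance to `μ` is at most `1/4`. -/
theorem list_coloring_glauber_mixing :
    ∃ ε : ℝ, 0 < ε ∧
      ∀ q Δ : ℕ, ∃ C : ℝ, 0 < C ∧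
        ∀ (V : Type) [Fintype V] [DecidableEq V],
          ∀ (G : SimpleGraph V) (L : V → Finset (Fin q)),
            2 ≤ Fintype.card V →
            (∀ v : V, (Finset.univ.filter fun w => G.Adj v w).card ≤ Δ) →
            (∀ v : V,
              max (((11 : ℝ) / 6 - ε) * (Δ : ℝ)) ((Δ : ℝ) + 2) ≤ ((L v).card : ℝ)) →
            ∀ σ₀ : V → Fin q, IsProperListColoring G L σ₀ →
              ∀ t : ℕ, C * (Fintype.card V : ℝ) * Real.log (Fintype.card V : ℝ) ≤ (t : ℝ) →
                (1 / 2) * ∑ σ : V → Fin q,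
                    |((glauber (uniformProper G L)) ^ t) σ₀ σ - uniformProper G L σ|
                  ≤ 1 / 4 := by
  refine ⟨1 / 10000, by norm_num, fun q Δ => ⟨ListColoringMixing.mixConst
    (ListColoringMixing.tensorConst q Δ) q,
    ListColoringMixing.mixConst_pos ListColoringMixing.one_le_tensorConst, ?_⟩⟩
  intro V _ inst G L hn hΔ hL σ₀ hσ₀ t ht
  obtain rfl : inst = fun a b => Classical.propDecidable (a = b) := Subsingleton.elim _ _
  have hdeg : ∀ v, (ListColoringMixing.nbrs G v).card ≤ Δ := hΔ
  have hcard : ∀ v, Δ + 2 ≤ (L v).card := fun v => by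
    have := (le_max_right _ _).trans (hL v)
    exact_mod_cast this
  exact ListColoringMixing.glauber_tv_le
    ⟨hdeg, fun v => Or.inr ⟨(le_max_left _ _).trans (hL v), hcard v⟩⟩ ⟨hdeg, hcard⟩ hn
    (ListColoringMixing.mem_proper.2 hσ₀) ht
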